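/- Let n ≥ 4 and let (u, p) be a smooth solution of the steady Navier-Stokes equations on B₁ \ {0} ⊂ ℝⁿ (B₁ the open unit ball). If there is a constant C > 0 such that |u(x)| ≤ C/|x| for all x ∈ B₁ \ {0}, then u extends to a function that is smooth (in particular locally bounded) on all of B₁; that is, the singularity at the origin is removable. -/

import Mathlib

namespace SteadyNS

open MeasureTheory Set Filter Topology
open scoped ContDiff

section

/-- Euclidean `n`-space. -/
abbrev E (n : ℕ) := EuclideanSpace ℝ (Fin n)

variable {n : ℕ}

/-- The `i`-th partial derivative. -/
noncomputable def pd (i : Fin n) (f : E n → ℝ) : E n → ℝ :=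
  fun x => fderiv ℝ f x (EuclideanSpace.single i 1)

/-- The Laplacian, as the sum of the second partial derivatives. -/
noncomputable def lap (f : E n → ℝ) : E n → ℝ := fun x => ∑ i, pd i (pd i f) x

theorem pd_congr {i : Fin n} {f g : E n → ℝ} {x : E n} (h : f =ᶠ[𝓝 x] g) :
    pd i f x = pd i g x := by
  simp only [pd, h.fderiv_eq]

theorem pd_eqOn {i : Fin n} {f g : E n → ℝ} {U : Set (E n)} (hU : IsOpen U) (h : EqOn f g U) :
    EqOn (pd i f) (pd i g) U := fun _ hx => pd_congr (h.eventuallyEq_of_mem (hU.mem_nhds hx))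

theorem pd_mul {i : Fin n} {f g : E n → ℝ} {x : E n} (hf : DifferentiableAt ℝ f x)
    (hg : DifferentiableAt ℝ g x) :
    pd i (fun y => f y * g y) x = pd i f x * g x + f x * pd i g x := by
  simp only [pd]
  rw [fderiv_fun_mul hf hg]
  simp; ring

theorem pd_add {i : Fin n} {f g : E n → ℝ} {x : E n} (hf : DifferentiableAt ℝ f x)
    (hg : DifferentiableAt ℝ g x) :
    pd i (fun y => f y + g y) x = pd i f x + pd i g x := by
  simp only [pd]
  rw [fderiv_fun_add hf hg]
  simp

theorem pd_sub {i : Fin n} {f g : E n → ℝ} {x : E n} (hf : DifferentiableAt ℝ f x)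
    (hg : DifferentiableAt ℝ g x) :
    pd i (fun y => f y - g y) x = pd i f x - pd i g x := by
  simp only [pd]
  rw [fderiv_fun_sub hf hg]
  simp

theorem pd_neg {i : Fin n} {f : E n → ℝ} {x : E n} :
    pd i (fun y => - f y) x = - pd i f x := by
  simp only [pd]
  rw [fderiv_fun_neg]
  simp

theorem pd_const {i : Fin n} {c : ℝ} {x : E n} : pd i (fun _ => c) x = 0 := by
  simp [pd]

theorem pd_const_mul {i : Fin n} {f : E n → ℝ} {x : E n} (c : ℝ)
    (hf : DifferentiableAt ℝ f x) :
    pd i (fun y => c * f y) x = c * pd i f x := by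
  rw [pd_mul (by fun_prop) hf, pd_const]; ring

theorem pd_sum {ι : Type*} {s : Finset ι} {i : Fin n} {f : ι → E n → ℝ} {x : E n}
    (hf : ∀ j ∈ s, DifferentiableAt ℝ (f j) x) :
    pd i (fun y => ∑ j ∈ s, f j y) x = ∑ j ∈ s, pd i (f j) x := by
  simp only [pd]
  rw [fderiv_fun_sum hf]
  simp

theorem pd_coord {i j : Fin n} {x : E n} : pd i (fun y => y j) x = if i = j then 1 else 0 := by
  simp only [pd]
  have : HasFDerivAt (fun y : E n => y j) (EuclideanSpace.proj j : E n →L[ℝ] ℝ) x :=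
    (EuclideanSpace.proj j : E n →L[ℝ] ℝ).hasFDerivAt
  rw [this.fderiv]
  simp [eq_comm]

theorem fderiv_apply_eq_sum (f : E n → ℝ) (x v : E n) :
    fderiv ℝ f x v = ∑ i, v i * pd i f x := by
  conv_lhs => rw [← (EuclideanSpace.basisFun (Fin n) ℝ).sum_repr v]
  simp [pd, map_sum]

theorem norm_fderiv_le_sum (f : E n → ℝ) (x : E n) :
    ‖fderiv ℝ f x‖ ≤ ∑ i, |pd i f x| := by
  refine ContinuousLinearMap.opNorm_le_bound _ (Finset.sum_nonneg fun i _ => abs_nonneg _) ?_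
  intro v
  rw [fderiv_apply_eq_sum, Finset.sum_mul]
  refine (norm_sum_le _ _).trans (Finset.sum_le_sum fun i _ => ?_)
  rw [norm_mul, mul_comm, Real.norm_eq_abs]
  gcongr
  exact PiLp.norm_apply_le v i

theorem contDiffOn_pd {i : Fin n} {f : E n → ℝ} {U : Set (E n)} (hU : IsOpen U)
    (hf : ContDiffOn ℝ ∞ f U) : ContDiffOn ℝ ∞ (pd i f) U :=
  (hf.fderiv_of_isOpen hU (m := ∞) (by simp)).clm_apply contDiffOn_const

theorem contDiff_pd {i : Fin n} {f : E n → ℝ} (hf : ContDiff ℝ ∞ f) : ContDiff ℝ ∞ (pd i f) :=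
  (hf.fderiv_right (m := ∞) (by simp)).clm_apply contDiff_const

theorem measurable_pd (i : Fin n) (f : E n → ℝ) : Measurable (pd i f) :=
  measurable_fderiv_apply_const ℝ f _

theorem tsupport_pd (i : Fin n) (f : E n → ℝ) : tsupport (pd i f) ⊆ tsupport f :=
  tsupport_fderiv_apply_subset ℝ _

theorem hasCompactSupport_pd {i : Fin n} {f : E n → ℝ} (hf : HasCompactSupport f) :
    HasCompactSupport (pd i f) := hf.of_isClosed_subset (isClosed_tsupport _) (tsupport_pd i f)

theorem two_le_infty : (2 : WithTop ℕ∞) ≤ ∞ := by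
  exact WithTop.coe_le_coe.2 (le_top : (2 : ℕ∞) ≤ ⊤)

theorem pd_comm {f : E n → ℝ} {x : E n} (hf : ContDiffAt ℝ ∞ f x) (i j : Fin n) :
    pd i (pd j f) x = pd j (pd i f) x := by
  have hs := hf.isSymmSndFDerivAt (by simpa using two_le_infty)
  have hd : DifferentiableAt ℝ (fderiv ℝ f) x :=
    (hf.fderiv_right (m := 1) (by simpa [one_add_one_eq_two] using two_le_infty)).differentiableAt (by simp)
  have key : ∀ v w : E n, fderiv ℝ (fun y => fderiv ℝ f y v) x w = fderiv ℝ (fderiv ℝ f) x w v := by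
    intro v w
    rw [fderiv_clm_apply hd (by fun_prop)]
    simp
  change fderiv ℝ (fun y => fderiv ℝ f y _) x _ = fderiv ℝ (fun y => fderiv ℝ f y _) x _
  rw [key, key]
  exact hs _ _

theorem pd_radial {G : ℝ → ℝ} {x : E n} {G' : ℝ} (hG : HasDerivAt G G' (‖x‖ ^ 2)) (i : Fin n) :
    pd i (fun y => G (‖y‖ ^ 2)) x = 2 * x i * G' := by
  have h := hG.comp_hasFDerivAt x (hasStrictFDerivAt_norm_sq x).hasFDerivAt
  have h2 : HasFDerivAt (fun y : E n => G (‖y‖ ^ 2)) _ x := h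
  simp only [pd]
  rw [h2.fderiv]
  simp [EuclideanSpace.inner_single_right]
  ring

theorem integral_pd_eq_zero {f : E n → ℝ} (hf : ContDiff ℝ 1 f) (hc : HasCompactSupport f)
    (i : Fin n) : ∫ x, pd i f x = 0 := by
  have h := integral_mul_fderiv_eq_neg_fderiv_mul_of_integrable (μ := (volume : Measure (E n)))
    (f := fun _ => (1 : ℝ)) (g := f) (v := EuclideanSpace.single i 1) (by simp) ?_ ?_
    (by intros; fun_prop) (by intro x _; exact (hf.differentiable (by simp)).differentiableAt)
  · simpa [pd] using h
  · simp only [one_mul]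
    refine Continuous.integrable_of_hasCompactSupport ?_ (hasCompactSupport_pd hc)
    exact (hf.continuous_fderiv (by simp)).clm_apply continuous_const
  · simpa using hf.continuous.integrable_of_hasCompactSupport hc

/-- Divergence theorem for fields that are smooth on an open set, cut off by a test function. -/
theorem integral_div_eq_zero {U : Set (E n)} (hU : IsOpen U) {V : Fin n → E n → ℝ}
    (hV : ∀ i, ContDiffOn ℝ 1 (V i) U) {S : Set (E n)} (hS : IsCompact S) (hSU : S ⊆ U)
    (hV0 : ∀ i, ∀ x ∉ S, V i x = 0) : ∫ x, ∑ i, pd i (V i) x = 0 := by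
  have hts : ∀ i, tsupport (V i) ⊆ S := fun i =>
    closure_minimal (fun x hx => by_contra fun h => hx (hV0 i x h)) hS.isClosed
  have hc : ∀ i, HasCompactSupport (V i) := fun i =>
    hS.of_isClosed_subset (isClosed_tsupport _) (hts i)
  have hd : ∀ i, ContDiff ℝ 1 (V i) := by
    intro i
    rw [contDiff_iff_contDiffAt]
    intro x
    by_cases hx : x ∈ U
    · exact (hV i).contDiffAt (hU.mem_nhds hx)
    · have : V i =ᶠ[𝓝 x] fun _ => 0 := by
        filter_upwards [hS.isClosed.isOpen_compl.mem_nhds (fun h => hx (hSU h))] with y hy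
        exact hV0 i y hy
      exact contDiffAt_const.congr_of_eventuallyEq this
  rw [integral_finsetSum]
  · exact Finset.sum_eq_zero fun i _ => integral_pd_eq_zero (hd i) (hc i) i
  · intro i _
    refine Continuous.integrable_of_hasCompactSupport ?_ (hasCompactSupport_pd (hc i))
    exact ((hd i).continuous_fderiv (by simp)).clm_apply continuous_const

end

section

variable {n : ℕ}

/-- Smooth steady Navier-Stokes flow on an open set, in components. -/
structure NS (U : Set (E n)) (u : Fin n → E n → ℝ) (p : E n → ℝ) : Prop where
  isOpen : IsOpen U
  smooth_u : ∀ j, ContDiffOn ℝ ∞ (u j) U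
  smooth_p : ContDiffOn ℝ ∞ p U
  meas_u : ∀ j, Measurable (u j)
  meas_p : Measurable p
  mom : ∀ x ∈ U, ∀ j, -(∑ i, pd i (pd i (u j)) x) + (∑ i, u i x * pd i (u j) x) + pd j p x = 0
  div : ∀ x ∈ U, ∑ i, pd i (u i) x = 0

namespace NS

variable {U : Set (E n)} {u : Fin n → E n → ℝ} {p : E n → ℝ} (h : NS U u p)
include h

theorem contDiffAt_u {x : E n} (hx : x ∈ U) (j : Fin n) : ContDiffAt ℝ ∞ (u j) x :=
  (h.smooth_u j).contDiffAt (h.isOpen.mem_nhds hx)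

theorem diff_u {x : E n} (hx : x ∈ U) (j : Fin n) : DifferentiableAt ℝ (u j) x :=
  (h.contDiffAt_u hx j).differentiableAt (by simp)

theorem smooth_du (i j : Fin n) : ContDiffOn ℝ ∞ (pd i (u j)) U :=
  contDiffOn_pd h.isOpen (h.smooth_u j)

theorem diff_du {x : E n} (hx : x ∈ U) (i j : Fin n) : DifferentiableAt ℝ (pd i (u j)) x :=
  ((h.smooth_du i j).contDiffAt (h.isOpen.mem_nhds hx)).differentiableAt (by simp)

theorem diff_ddu {x : E n} (hx : x ∈ U) (i j k : Fin n) :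
    DifferentiableAt ℝ (pd i (pd j (u k))) x :=
  ((contDiffOn_pd h.isOpen (h.smooth_du j k)).contDiffAt
    (h.isOpen.mem_nhds hx)).differentiableAt (by simp)

theorem diff_p {x : E n} (hx : x ∈ U) : DifferentiableAt ℝ p x :=
  (h.smooth_p.contDiffAt (h.isOpen.mem_nhds hx)).differentiableAt (by simp)

theorem diff_dp {x : E n} (hx : x ∈ U) (i : Fin n) : DifferentiableAt ℝ (pd i p) x :=
  ((contDiffOn_pd h.isOpen h.smooth_p).contDiffAt
    (h.isOpen.mem_nhds hx)).differentiableAt (by simp)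

theorem weak_div {f : E n → ℝ} (hf : ContDiffOn ℝ ∞ f U) {S : Set (E n)} (hS : IsCompact S)
    (hSU : S ⊆ U) (hf0 : ∀ x ∉ S, f x = 0) : ∫ x, ∑ i, u i x * pd i f x = 0 := by
  rw [← integral_div_eq_zero h.isOpen (V := fun i x => u i x * f x) (S := S) ?_ hS hSU ?_]
  · congr 1
    ext x
    by_cases hx : x ∈ U
    · have hfd : DifferentiableAt ℝ f x :=
        (hf.contDiffAt (h.isOpen.mem_nhds hx)).differentiableAt (by simp)
      have : ∀ i, pd i (fun x => u i x * f x) x = pd i (u i) x * f x + u i x * pd i f x :=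
        fun i => pd_mul (h.diff_u hx i) hfd
      simp_rw [this, Finset.sum_add_distrib, ← Finset.sum_mul, h.div x hx]
      simp
    · have hn : ∀ᶠ y in 𝓝 x, y ∉ S := hS.isClosed.isOpen_compl.mem_nhds fun hh => hx (hSU hh)
      refine Finset.sum_congr rfl fun i _ => ?_
      rw [pd_congr (g := fun _ => 0) (hn.mono fun y hy => hf0 y hy),
        pd_congr (f := fun x => u i x * f x) (g := fun _ => 0)
          (hn.mono fun y hy => by simp [hf0 y hy])]
      simp [pd_const]
  · exact fun i => ((h.smooth_u i).mul hf).of_le (by simp)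
  · intro i x hx; simp [hf0 x hx]

theorem weak_mom {ψ : Fin n → E n → ℝ} (hψ : ∀ j, ContDiffOn ℝ ∞ (ψ j) U) {S : Set (E n)}
    (hS : IsCompact S) (hSU : S ⊆ U) (hψ0 : ∀ j, ∀ x ∉ S, ψ j x = 0) :
    ∫ x, ((∑ j, u j x * lap (ψ j) x) + (∑ i, ∑ j, u i x * u j x * pd i (ψ j) x)
      + p x * ∑ i, pd i (ψ i) x) = 0 := by
  rw [← integral_div_eq_zero h.isOpen (V := fun i x => (∑ j, ((u i x * u j x - pd i (u j) x) * ψ j x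
    + u j x * pd i (ψ j) x)) + p x * ψ i x) (S := S) ?_ hS hSU ?_]
  · congr 1
    ext x
    by_cases hx : x ∈ U
    · have hd : ∀ j, DifferentiableAt ℝ (ψ j) x := fun j =>
        ((hψ j).contDiffAt (h.isOpen.mem_nhds hx)).differentiableAt (by simp)
      have hdd : ∀ i j, DifferentiableAt ℝ (pd i (ψ j)) x := fun i j =>
        ((contDiffOn_pd h.isOpen (hψ j)).contDiffAt
          (h.isOpen.mem_nhds hx)).differentiableAt (by simp)
      have hu := h.diff_u hx
      have hdu := h.diff_du hx
      have hp := h.diff_p hx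
      have e1 : ∀ i, pd i (fun x => (∑ j, ((u i x * u j x - pd i (u j) x) * ψ j x
          + u j x * pd i (ψ j) x)) + p x * ψ i x) x =
          (∑ j, ((pd i (u i) x * u j x + u i x * pd i (u j) x - pd i (pd i (u j)) x) * ψ j x
            + u i x * u j x * pd i (ψ j) x + u j x * pd i (pd i (ψ j)) x))
            + (pd i p x * ψ i x + p x * pd i (ψ i) x) := by
        intro i
        rw [pd_add (by fun_prop) (by fun_prop), pd_sum (by intros; fun_prop), pd_mul hp (hd i)]
        congr 1
        refine Finset.sum_congr rfl fun j _ => ?_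
        rw [pd_add (by fun_prop) (by fun_prop), pd_mul (by fun_prop) (hd j),
          pd_sub (by fun_prop) (by fun_prop), pd_mul (hu i) (hu j), pd_mul (hu j) (hdd i j)]
        ring
      simp_rw [e1]
      have e2 : ∑ i, ∑ j, (pd i (u i) x * u j x + u i x * pd i (u j) x - pd i (pd i (u j)) x)
          * ψ j x = - ∑ j, pd j p x * ψ j x := by
        rw [Finset.sum_comm, ← Finset.sum_neg_distrib]
        refine Finset.sum_congr rfl fun j _ => ?_
        rw [← Finset.sum_mul]
        simp only [Finset.sum_add_distrib, Finset.sum_sub_distrib, ← Finset.sum_mul, h.div x hx]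
        have := h.mom x hx j
        linear_combination ψ j x * this
      simp only [Finset.sum_add_distrib] at e2 ⊢
      rw [e2, Finset.mul_sum]
      have e3 : ∑ j, u j x * lap (ψ j) x = ∑ i, ∑ j, u j x * pd i (pd i (ψ j)) x := by
        rw [Finset.sum_comm]
        simp [lap, Finset.mul_sum]
      rw [e3]; ring
    · have hn : ∀ᶠ y in 𝓝 x, y ∉ S := hS.isClosed.isOpen_compl.mem_nhds fun hh => hx (hSU hh)
      have z0 : ∀ j, ψ j =ᶠ[𝓝 x] fun _ => 0 := fun j => hn.mono fun y hy => hψ0 j y hy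
      have z1 : ∀ i j, pd i (ψ j) =ᶠ[𝓝 x] fun _ => 0 := fun i j =>
        (z0 j).eventuallyEq_nhds.mono fun y hy => by rw [pd_congr hy, pd_const]
      have z2 : ∀ i j, pd i (pd i (ψ j)) x = 0 := fun i j => by rw [pd_congr (z1 i j), pd_const]
      have z3 : ∀ i, pd i (fun x => (∑ j, ((u i x * u j x - pd i (u j) x) * ψ j x
          + u j x * pd i (ψ j) x)) + p x * ψ i x) x = 0 := by
        intro i
        rw [pd_congr (g := fun _ => 0), pd_const]
        filter_upwards [hn.eventually_nhds] with y hy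
        have w0 : ∀ j, ψ j =ᶠ[𝓝 y] fun _ => 0 := fun j => hy.mono fun y hy => hψ0 j y hy
        have w1 : ∀ i j, pd i (ψ j) y = 0 := fun i j => by rw [pd_congr (w0 j), pd_const]
        simp [w1, (w0 _).eq_of_nhds]
      simp [z3, lap, z2, (z1 _ _).eq_of_nhds]
  · intro i
    have := h.smooth_u
    have := h.smooth_du
    have := h.smooth_p
    have : ∀ j, ContDiffOn ℝ ∞ (pd i (ψ j)) U := fun j => contDiffOn_pd h.isOpen (hψ j)
    refine ContDiffOn.of_le (n := ∞) ?_ (by simp)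
    refine ContDiffOn.add (ContDiffOn.sum fun j _ => ?_) (by fun_prop)
    fun_prop
  · intro i x hx
    have hn : ∀ᶠ y in 𝓝 x, y ∉ S := hS.isClosed.isOpen_compl.mem_nhds hx
    have w0 : ∀ j, ψ j =ᶠ[𝓝 x] fun _ => 0 := fun j => hn.mono fun y hy => hψ0 j y hy
    have w1 : ∀ i j, pd i (ψ j) x = 0 := fun i j => by rw [pd_congr (w0 j), pd_const]
    simp [w1, (w0 _).eq_of_nhds]

end NS

end

section

variable {n : ℕ}

theorem pd_eq_zero_off {S : Set (E n)} (hS : IsClosed S) {f : E n → ℝ} (hf : ∀ x ∉ S, f x = 0)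
    (i : Fin n) : ∀ x ∉ S, pd i f x = 0 := by
  intro x hx
  have hn : ∀ᶠ y in 𝓝 x, y ∉ S := hS.isOpen_compl.mem_nhds hx
  rw [pd_congr (g := fun _ => 0) (hn.mono fun y hy => hf y hy), pd_const]

theorem lap_eq_zero_off {S : Set (E n)} (hS : IsClosed S) {f : E n → ℝ} (hf : ∀ x ∉ S, f x = 0) :
    ∀ x ∉ S, lap f x = 0 := fun x hx => by
  simp [lap, pd_eq_zero_off hS (pd_eq_zero_off hS hf _) _ x hx]

/-- The total head pressure. -/
noncomputable def head (u : Fin n → E n → ℝ) (p : E n → ℝ) : E n → ℝ :=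
  fun x => 1 / 2 * (∑ j, u j x * u j x) + p x

namespace NS

variable {U : Set (E n)} {u : Fin n → E n → ℝ} {p : E n → ℝ} (h : NS U u p)
include h

theorem smooth_head : ContDiffOn ℝ ∞ (head u p) U := by
  have := h.smooth_u
  have := h.smooth_p
  unfold head
  refine ContDiffOn.add (contDiffOn_const.mul (ContDiffOn.sum fun j _ => ?_)) (by fun_prop)
  fun_prop

theorem pd_sq {x : E n} (hx : x ∈ U) (i : Fin n) :
    pd i (fun x => ∑ j, u j x * u j x) x = 2 * ∑ j, u j x * pd i (u j) x := by
  have hu := h.diff_u hx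
  rw [pd_sum (by intros; fun_prop), Finset.mul_sum]
  refine Finset.sum_congr rfl fun j _ => ?_
  rw [pd_mul (hu j) (hu j)]; ring

theorem pd_head {x : E n} (hx : x ∈ U) (i : Fin n) :
    pd i (head u p) x = (∑ j, u j x * pd i (u j) x) + pd i p x := by
  have hu := h.diff_u hx
  have hp := h.diff_p hx
  unfold head
  rw [pd_add (by fun_prop) hp, pd_const_mul _ (by fun_prop), h.pd_sq hx]
  ring

theorem u_lap_u {x : E n} (hx : x ∈ U) :
    ∑ j, u j x * (∑ i, pd i (pd i (u j)) x) = ∑ i, u i x * pd i (head u p) x := by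
  simp_rw [h.pd_head hx, mul_add, Finset.sum_add_distrib, Finset.mul_sum]
  rw [Finset.sum_comm (f := fun i j => u i x * (u j x * pd i (u j) x)), ← Finset.sum_add_distrib]
  refine Finset.sum_congr rfl fun j _ => ?_
  have := h.mom x hx j
  have e : ∑ i, u i x * (u j x * pd i (u j) x) = u j x * ∑ i, u i x * pd i (u j) x := by
    rw [Finset.mul_sum]; exact Finset.sum_congr rfl fun i _ => by ring
  rw [e, ← Finset.mul_sum]
  linear_combination (-u j x) * this

theorem energy {η : E n → ℝ} (hη : ContDiffOn ℝ ∞ η U) {S : Set (E n)} (hS : IsCompact S)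
    (hSU : S ⊆ U) (hη0 : ∀ x ∉ S, η x = 0) :
    ∫ x, ((∑ i, ∑ j, pd i (u j) x * pd i (u j) x) * η x
      - 1 / 2 * (∑ j, u j x * u j x) * lap η x
      - head u p x * ∑ i, u i x * pd i η x) = 0 := by
  rw [← integral_div_eq_zero h.isOpen (V := fun i x => (∑ j, u j x * pd i (u j) x) * η x
    - 1 / 2 * ((∑ j, u j x * u j x) * pd i η x) - u i x * (head u p x * η x)) (S := S) ?_ hS hSU ?_]
  · congr 1
    ext x
    by_cases hx : x ∈ U
    · have hd : DifferentiableAt ℝ η x :=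
        (hη.contDiffAt (h.isOpen.mem_nhds hx)).differentiableAt (by simp)
      have hdd : ∀ i, DifferentiableAt ℝ (pd i η) x := fun i =>
        ((contDiffOn_pd h.isOpen hη).contDiffAt
          (h.isOpen.mem_nhds hx)).differentiableAt (by simp)
      have hu := h.diff_u hx
      have hdu := h.diff_du hx
      have hH : DifferentiableAt ℝ (head u p) x :=
        (h.smooth_head.contDiffAt (h.isOpen.mem_nhds hx)).differentiableAt (by simp)
      have e1 : ∀ i, pd i (fun x => (∑ j, u j x * pd i (u j) x) * η x
          - 1 / 2 * ((∑ j, u j x * u j x) * pd i η x) - u i x * (head u p x * η x)) x =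
          (∑ j, pd i (u j) x * pd i (u j) x) * η x + (∑ j, u j x * pd i (pd i (u j)) x) * η x
          - 1 / 2 * (∑ j, u j x * u j x) * pd i (pd i η) x - pd i (u i) x * (head u p x * η x)
          - u i x * pd i (head u p) x * η x - head u p x * (u i x * pd i η x) := by
        intro i
        have e0 : pd i (fun x => ∑ j, u j x * pd i (u j) x) x =
            (∑ j, pd i (u j) x * pd i (u j) x) + ∑ j, u j x * pd i (pd i (u j)) x := by
          rw [pd_sum (by intros; fun_prop), ← Finset.sum_add_distrib]
          exact Finset.sum_congr rfl fun j _ => pd_mul (hu j) (hdu i j)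
        rw [pd_sub (by fun_prop) (by fun_prop), pd_sub (by fun_prop) (by fun_prop),
          pd_mul (by fun_prop) hd, pd_const_mul _ (by fun_prop), pd_mul (by fun_prop) (hdd i),
          pd_mul (hu i) (by fun_prop), pd_mul hH hd, h.pd_sq hx, e0]
        ring
      simp_rw [e1, Finset.sum_sub_distrib, Finset.sum_add_distrib, ← Finset.sum_mul,
        ← Finset.mul_sum, h.div x hx, ← h.u_lap_u hx, lap]
      have e3 : ∑ i, ∑ j, u j x * pd i (pd i (u j)) x = ∑ j, u j x * ∑ i, pd i (pd i (u j)) x := by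
        rw [Finset.sum_comm]; simp [Finset.mul_sum]
      rw [e3]; ring
    · have hxS : x ∉ S := fun hh => hx (hSU hh)
      rw [hη0 x hxS, lap_eq_zero_off hS.isClosed hη0 x hxS]
      simp_rw [pd_eq_zero_off hS.isClosed hη0 _ x hxS]
      simp only [mul_zero, Finset.sum_const_zero, sub_self]
      refine (Finset.sum_eq_zero fun i _ => pd_eq_zero_off hS.isClosed ?_ i x hxS).symm
      intro y hy
      simp [hη0 y hy, pd_eq_zero_off hS.isClosed hη0 _ y hy]
  · intro i
    have := h.smooth_u
    have := h.smooth_du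
    have := h.smooth_head
    have : ContDiffOn ℝ ∞ (pd i η) U := contDiffOn_pd h.isOpen hη
    refine ContDiffOn.of_le (n := ∞) ?_ (by simp)
    refine ContDiffOn.sub (ContDiffOn.sub (ContDiffOn.mul (ContDiffOn.sum fun j _ => ?_) hη)
      (contDiffOn_const.mul (ContDiffOn.mul (ContDiffOn.sum fun j _ => ?_) ?_))) ?_ <;> fun_prop
  · intro i y hy
    simp [hη0 y hy, pd_eq_zero_off hS.isClosed hη0 _ y hy]

theorem lap_head {x : E n} (hx : x ∈ U) :
    lap (head u p) x = (∑ i, u i x * pd i (head u p) x)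
      + 1 / 2 * ∑ i, ∑ j, (pd i (u j) x - pd j (u i) x) ^ 2 := by
  have hu := h.diff_u hx
  have hdu := h.diff_du hx
  have hddu := h.diff_ddu hx
  have hdp := h.diff_dp hx
  have e1 : ∀ i, pd i (pd i (head u p)) x = (∑ j, pd i (u j) x * pd i (u j) x)
      + (∑ j, u j x * pd i (pd i (u j)) x) + pd i (pd i p) x := by
    intro i
    rw [pd_eqOn h.isOpen (fun y hy => h.pd_head hy i) hx, pd_add (by fun_prop) (by fun_prop),
      pd_sum (by intros; fun_prop), ← Finset.sum_add_distrib]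
    congr 1
    exact Finset.sum_congr rfl fun j _ => pd_mul (hu j) (hdu i j)
  have e2 : ∀ j, pd j (fun x => -(∑ i, pd i (pd i (u j)) x) + (∑ i, u i x * pd i (u j) x)
      + pd j p x) x = 0 := fun j => by
    rw [pd_eqOn h.isOpen (g := fun _ => 0) (fun y hy => h.mom y hy j) hx, pd_const]
  have e3 : ∀ j, pd j (pd j p) x = (∑ i, pd j (pd i (pd i (u j))) x)
      - ∑ i, (pd j (u i) x * pd i (u j) x + u i x * pd j (pd i (u j)) x) := by
    intro j
    have := e2 j
    rw [pd_add (by fun_prop) (by fun_prop), pd_add (by fun_prop) (by fun_prop), pd_neg,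
      pd_sum (by intros; fun_prop), pd_sum (by intros; fun_prop)] at this
    have e : ∀ i, pd j (fun y => u i y * pd i (u j) y) x
        = pd j (u i) x * pd i (u j) x + u i x * pd j (pd i (u j)) x := fun i =>
      pd_mul (hu i) (hdu i j)
    simp_rw [e] at this
    linarith
  have d1 : ∀ i, ∑ j, pd i (pd j (u j)) x = 0 := by
    intro i
    rw [← pd_sum (by intros; fun_prop), pd_eqOn h.isOpen (g := fun _ => 0) h.div hx, pd_const]
  have d1' : ∀ i, ∀ y ∈ U, ∑ j, pd i (pd j (u j)) y = 0 := by
    intro i y hy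
    rw [← pd_sum (fun j _ => h.diff_du hy j j), pd_eqOn h.isOpen (g := fun _ => 0) h.div hy,
      pd_const]
  have d2 : ∀ i, ∑ j, pd i (pd i (pd j (u j))) x = 0 := by
    intro i
    rw [← pd_sum (by intros; fun_prop), pd_eqOn h.isOpen (g := fun _ => 0) (d1' i) hx, pd_const]
  have c3 : ∀ i j, pd j (pd i (pd i (u j))) x = pd i (pd i (pd j (u j))) x := by
    intro i j
    rw [pd_comm ((h.smooth_du i j).contDiffAt (h.isOpen.mem_nhds hx)) j i]
    exact pd_eqOn h.isOpen (fun y hy => pd_comm (h.contDiffAt_u hy j) j i) hx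
  have f1 : ∑ j, ∑ i, pd j (pd i (pd i (u j))) x = 0 := by
    rw [Finset.sum_comm]
    simp_rw [c3, d2]; simp
  have f2 : ∑ j, ∑ i, u i x * pd j (pd i (u j)) x = 0 := by
    rw [Finset.sum_comm]
    simp_rw [← Finset.mul_sum, fun i j => pd_comm (h.contDiffAt_u hx j) j i, d1]; simp
  have f3 : ∑ i, ∑ j, u j x * pd i (pd i (u j)) x = ∑ i, u i x * pd i (head u p) x := by
    rw [← h.u_lap_u hx, Finset.sum_comm]; simp [Finset.mul_sum]
  have f4 : ∑ i, ∑ j, (pd i (u j) x - pd j (u i) x) ^ 2 =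
      2 * (∑ i, ∑ j, pd i (u j) x * pd i (u j) x) - 2 * ∑ i, ∑ j, pd i (u j) x * pd j (u i) x := by
    have : ∀ i j, (pd i (u j) x - pd j (u i) x) ^ 2 = pd i (u j) x * pd i (u j) x
      + pd j (u i) x * pd j (u i) x - 2 * (pd i (u j) x * pd j (u i) x) := fun i j => by ring
    simp_rw [this, Finset.sum_sub_distrib, Finset.sum_add_distrib, ← Finset.mul_sum]
    rw [Finset.sum_comm (f := fun i j => pd j (u i) x * pd j (u i) x)]
    ring
  simp_rw [lap, e1, e3, Finset.sum_add_distrib, Finset.sum_sub_distrib, Finset.sum_add_distrib]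
  rw [f1, f2, f3, f4]
  ring

theorem weak_transport {B η : E n → ℝ} (hB : ContDiffOn ℝ 2 B U) (hη : ContDiffOn ℝ ∞ η U)
    {S : Set (E n)} (hS : IsCompact S) (hSU : S ⊆ U) (hη0 : ∀ x ∉ S, η x = 0) :
    ∫ x, (η x * (lap B x - ∑ i, u i x * pd i B x)
      - B x * (lap η x + ∑ i, u i x * pd i η x)) = 0 := by
  have hB1 : ∀ i, ContDiffOn ℝ 1 (pd i B) U := fun i =>
    (hB.fderiv_of_isOpen h.isOpen (m := 1) (by norm_num)).clm_apply contDiffOn_const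
  have hη1 : ∀ i, ContDiffOn ℝ ∞ (pd i η) U := fun i => contDiffOn_pd h.isOpen hη
  rw [← integral_div_eq_zero h.isOpen (V := fun i x => η x * pd i B x - B x * pd i η x
    - u i x * (B x * η x)) (S := S) ?_ hS hSU ?_]
  · congr 1
    ext x
    by_cases hx : x ∈ U
    · have hd : DifferentiableAt ℝ η x :=
        (hη.contDiffAt (h.isOpen.mem_nhds hx)).differentiableAt (by simp)
      have hdd : ∀ i, DifferentiableAt ℝ (pd i η) x := fun i =>
        ((hη1 i).contDiffAt (h.isOpen.mem_nhds hx)).differentiableAt (by simp)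
      have hb : DifferentiableAt ℝ B x :=
        (hB.contDiffAt (h.isOpen.mem_nhds hx)).differentiableAt (by simp)
      have hbd : ∀ i, DifferentiableAt ℝ (pd i B) x := fun i =>
        ((hB1 i).contDiffAt (h.isOpen.mem_nhds hx)).differentiableAt (by simp)
      have hu := h.diff_u hx
      have e1 : ∀ i, pd i (fun x => η x * pd i B x - B x * pd i η x - u i x * (B x * η x)) x =
          η x * pd i (pd i B) x - B x * pd i (pd i η) x - pd i (u i) x * (B x * η x)
          - η x * (u i x * pd i B x) - B x * (u i x * pd i η x) := by
        intro i
        rw [pd_sub (by fun_prop) (by fun_prop), pd_sub (by fun_prop) (by fun_prop),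
          pd_mul hd (hbd i), pd_mul hb (hdd i), pd_mul (hu i) (by fun_prop), pd_mul hb hd]
        ring
      simp_rw [e1, Finset.sum_sub_distrib, ← Finset.sum_mul, ← Finset.mul_sum, h.div x hx, lap]
      ring
    · have hxS : x ∉ S := fun hh => hx (hSU hh)
      rw [hη0 x hxS, lap_eq_zero_off hS.isClosed hη0 x hxS]
      simp_rw [pd_eq_zero_off hS.isClosed hη0 _ x hxS]
      simp only [mul_zero, zero_mul, add_zero, Finset.sum_const_zero, sub_self]
      refine (Finset.sum_eq_zero fun i _ => pd_eq_zero_off hS.isClosed ?_ i x hxS).symm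
      intro y hy
      simp [hη0 y hy, pd_eq_zero_off hS.isClosed hη0 _ y hy]
  · intro i
    have h1 := (h.smooth_u i).of_le (m := 1) (by simp)
    have h2 := (hη1 i).of_le (m := 1) (by simp)
    have h3 := hη.of_le (m := 1) (by simp)
    have h4 := hB.of_le (m := 1) (by norm_num)
    have h5 := hB1 i
    fun_prop
  · intro i y hy
    simp [hη0 y hy, pd_eq_zero_off hS.isClosed hη0 _ y hy]

end NS

end

section

variable {n : ℕ}

theorem contDiff_deriv {F : ℝ → ℝ} (hF : ContDiff ℝ ∞ F) : ContDiff ℝ ∞ (deriv F) :=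
  ((contDiff_infty_iff_deriv (f := F)).1 hF).2

theorem ContDiff.hasDerivAt_deriv {F : ℝ → ℝ} (hF : ContDiff ℝ ∞ F) (s : ℝ) :
    HasDerivAt F (deriv F s) s := (hF.differentiable (by simp) s).hasDerivAt

theorem contDiff_radial {F : ℝ → ℝ} (hF : ContDiff ℝ ∞ F) :
    ContDiff ℝ ∞ (fun x : E n => F (‖x‖ ^ 2)) := hF.comp (contDiff_norm_sq ℝ)

theorem pd_radial' {F : ℝ → ℝ} (hF : ContDiff ℝ ∞ F) (i : Fin n) (x : E n) :
    pd i (fun y => F (‖y‖ ^ 2)) x = 2 * x i * deriv F (‖x‖ ^ 2) :=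
  pd_radial (ContDiff.hasDerivAt_deriv hF _) i

theorem pd_pd_radial {F : ℝ → ℝ} (hF : ContDiff ℝ ∞ F) (i j : Fin n) (x : E n) :
    pd i (pd j (fun y => F (‖y‖ ^ 2))) x = (if i = j then 2 * deriv F (‖x‖ ^ 2) else 0) +
      4 * x i * x j * deriv (deriv F) (‖x‖ ^ 2) := by
  have h1 : pd j (fun y : E n => F (‖y‖ ^ 2)) = fun y => 2 * (y j * deriv F (‖y‖ ^ 2)) := by
    ext y; rw [pd_radial' hF]; ring
  have hd : DifferentiableAt ℝ (fun y : E n => deriv F (‖y‖ ^ 2)) x :=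
    (contDiff_radial (contDiff_deriv hF)).differentiable (by simp) x
  rw [h1, pd_const_mul _ (by fun_prop), pd_mul (by fun_prop) hd, pd_coord,
    pd_radial' (contDiff_deriv hF)]
  split_ifs <;> ring

theorem sum_mul_self_eq (x : E n) : ∑ i, x i * x i = ‖x‖ ^ 2 := by
  rw [EuclideanSpace.norm_sq_eq]
  refine Finset.sum_congr rfl fun i _ => ?_
  rw [Real.norm_eq_abs, sq_abs, sq]

theorem lap_radial {F : ℝ → ℝ} (hF : ContDiff ℝ ∞ F) (x : E n) :
    lap (fun y => F (‖y‖ ^ 2)) x =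
      2 * n * deriv F (‖x‖ ^ 2) + 4 * ‖x‖ ^ 2 * deriv (deriv F) (‖x‖ ^ 2) := by
  simp only [lap, pd_pd_radial hF, if_true, Finset.sum_add_distrib, Finset.sum_const,
    Finset.card_univ, Fintype.card_fin, nsmul_eq_mul]
  rw [← sum_mul_self_eq, Finset.mul_sum, Finset.sum_mul]
  congr 1
  · ring
  · exact Finset.sum_congr rfl fun i _ => by ring

/-- A smooth cutoff, `0` for `s ≤ 1` and `1` for `s ≥ 2`. -/
noncomputable def kap (s : ℝ) : ℝ := Real.smoothTransition (s - 1)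

theorem contDiff_kap : ContDiff ℝ ∞ kap :=
  Real.smoothTransition.contDiff.comp (contDiff_id.sub contDiff_const)

theorem kap_zero {s : ℝ} (h : s ≤ 1) : kap s = 0 :=
  Real.smoothTransition.zero_of_nonpos (by linarith)

theorem kap_one {s : ℝ} (h : 2 ≤ s) : kap s = 1 :=
  Real.smoothTransition.one_of_one_le (by linarith)

theorem kap_nonneg (s : ℝ) : 0 ≤ kap s := Real.smoothTransition.nonneg _

theorem kap_le_one (s : ℝ) : kap s ≤ 1 := Real.smoothTransition.le_one _

/-- `s ^ a` cut off near the origin. -/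
theorem contDiff_rpow_mul {a : ℝ} {F : ℝ → ℝ} (hF : ContDiff ℝ ∞ F) {δ : ℝ} (hδ : 0 < δ)
    (h0 : ∀ s < δ, F s = 0) : ContDiff ℝ ∞ (fun s : ℝ => s ^ a * F s) := by
  rw [contDiff_iff_contDiffAt]
  intro s
  rcases lt_or_ge s δ with h | h
  · have : (fun s : ℝ => s ^ a * F s) =ᶠ[𝓝 s] fun _ => 0 := by
      filter_upwards [gt_mem_nhds h] with y hy
      simp [h0 y hy]
    exact contDiffAt_const.congr_of_eventuallyEq this
  · exact (Real.contDiffAt_rpow_const_of_ne (by linarith)).mul hF.contDiffAt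

/-- Smooth kernels supported in the closed unit ball. -/
structure Ker (K : E n → ℝ) : Prop where
  smooth : ContDiff ℝ ∞ K
  supp : ∀ x, 1 < ‖x‖ → K x = 0

theorem Ker.pd {K : E n → ℝ} (h : Ker K) (i : Fin n) : Ker (pd i K) where
  smooth := contDiff_pd h.smooth
  supp := fun x hx => by
    rw [pd_congr (g := fun _ => 0), pd_const]
    filter_upwards [(isOpen_lt continuous_const continuous_norm).mem_nhds hx] with y hy
    exact h.supp y hy

theorem Ker.sum {ι : Type*} {s : Finset ι} {K : ι → E n → ℝ} (h : ∀ i ∈ s, Ker (K i)) :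
    Ker (fun x => ∑ i ∈ s, K i x) where
  smooth := ContDiff.sum fun i hi => (h i hi).smooth
  supp := fun x hx => Finset.sum_eq_zero fun i hi => (h i hi).supp x hx

theorem Ker.sub {K L : E n → ℝ} (h : Ker K) (h' : Ker L) : Ker (fun x => K x - L x) where
  smooth := h.smooth.sub h'.smooth
  supp := fun x hx => by rw [h.supp x hx, h'.supp x hx, sub_zero]

theorem Ker.lap {K : E n → ℝ} (h : Ker K) : Ker (lap K) :=
  Ker.sum (s := Finset.univ) fun i _ => (h.pd i).pd i

theorem Ker.hasCompactSupport {K : E n → ℝ} (h : Ker K) : HasCompactSupport K :=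
  HasCompactSupport.intro (isCompact_closedBall 0 1) fun x hx => h.supp x (by simpa using hx)

theorem Ker.integrable {K : E n → ℝ} (h : Ker K) : Integrable K :=
  h.smooth.continuous.integrable_of_hasCompactSupport h.hasCompactSupport

theorem Ker.bounded {K : E n → ℝ} (h : Ker K) : ∃ M, 0 ≤ M ∧ ∀ x, |K x| ≤ M := by
  obtain ⟨M, hM⟩ := h.smooth.continuous.bounded_above_of_compact_support h.hasCompactSupport
  exact ⟨M, (norm_nonneg _).trans (hM 0), hM⟩

section kernel

/-- The profile of the kernels: `s ^ (-(n-2)/2)` away from the origin. -/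
noncomputable def prof (n : ℕ) (s : ℝ) : ℝ := s ^ (-(((n : ℝ) - 2) / 2)) * kap (2 * s)

theorem contDiff_prof : ContDiff ℝ ∞ (prof n) :=
  contDiff_rpow_mul (δ := 1 / 2) (contDiff_kap.comp (contDiff_const.mul contDiff_id)) (by norm_num)
    fun s hs => kap_zero (by linarith)

theorem prof_eq {s : ℝ} (hs : 1 ≤ s) : prof n s = s ^ (-(((n : ℝ) - 2) / 2)) := by
  simp [prof, kap_one (show 2 ≤ 2 * s by linarith)]

theorem deriv_eqOn_Ici {F G : ℝ → ℝ} (hF : ContDiff ℝ ∞ F) {a : ℝ} (ha : 0 < a)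
    (hG : ContDiffOn ℝ ∞ G (Ioi 0))
    (h : ∀ s, a ≤ s → F s = G s) (s : ℝ) (hs : a ≤ s) : deriv F s = deriv G s := by
  have key : EqOn (deriv F) (deriv G) (closure (Ioi a)) := by
    refine EqOn.of_subset_closure (s := Ioi a) (t := Ici a) ?_ ?_ ?_ ?_ ?_ |>.mono ?_
    · intro s hs
      refine Filter.EventuallyEq.deriv_eq ?_
      filter_upwards [Ioi_mem_nhds hs] with y hy
      exact h y (le_of_lt hy)
    · exact (contDiff_deriv hF).continuous.continuousOn
    · exact (hG.continuousOn_deriv_of_isOpen isOpen_Ioi (by simp)).mono fun x hx => lt_of_lt_of_le ha hx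
    · exact Ioi_subset_Ici_self
    · simp
    · simp
  exact key (by simpa using hs)

/-- The radial profile of the Laplacian of a radial function with profile `q`. -/
noncomputable def prof2 (n : ℕ) (s : ℝ) : ℝ := 2 * n * prof n s + 4 * s * deriv (prof n) s

theorem contDiff_prof2 : ContDiff ℝ ∞ (prof2 n) :=
  (contDiff_const.mul contDiff_prof).add
    ((contDiff_const.mul contDiff_id).mul (contDiff_deriv contDiff_prof))

theorem contDiffOn_rpow (a : ℝ) : ContDiffOn ℝ ∞ (fun s : ℝ => s ^ a) (Ioi 0) := fun _ hs =>
  (Real.contDiffAt_rpow_const_of_ne (ne_of_gt hs)).contDiffWithinAt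

theorem prof2_eq {s : ℝ} (hs : 1 ≤ s) : prof2 n s = 4 * s ^ (-(((n : ℝ) - 2) / 2)) := by
  have h0 : 0 < s := by linarith
  rw [prof2, prof_eq hs, deriv_eqOn_Ici contDiff_prof one_pos (contDiffOn_rpow _)
    (fun s hs => prof_eq hs) s hs, Real.deriv_rpow_const, Real.rpow_sub_one h0.ne']
  field_simp
  ring

theorem deriv_prof2_eq {s : ℝ} (hs : 1 ≤ s) :
    deriv (prof2 n) s = -(2 * ((n : ℝ) - 2)) * s ^ (-(((n : ℝ) - 2) / 2) - 1) := by
  rw [deriv_eqOn_Ici contDiff_prof2 one_pos (contDiffOn_const.mul (contDiffOn_rpow _))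
    (fun s hs => prof2_eq hs) s hs, deriv_const_mul_field']
  simp only [Real.deriv_rpow_const]
  ring

/-- The mollifier, the bilaplacian of a regularised fundamental solution. -/
noncomputable def phi : E n → ℝ := lap (fun x => prof2 n (‖x‖ ^ 2))

theorem phi_eq (x : E n) : phi x = 2 * n * deriv (prof2 n) (‖x‖ ^ 2) +
    4 * ‖x‖ ^ 2 * deriv (deriv (prof2 n)) (‖x‖ ^ 2) := lap_radial contDiff_prof2 x

theorem phi_zero {x : E n} (hx : 1 ≤ ‖x‖) : phi x = 0 := by
  have hs : 1 ≤ ‖x‖ ^ 2 := one_le_pow₀ hx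
  have h0 : 0 < ‖x‖ ^ 2 := by linarith
  rw [phi_eq, deriv_prof2_eq hs, deriv_eqOn_Ici (contDiff_deriv contDiff_prof2) one_pos
    (contDiffOn_const.mul (contDiffOn_rpow _)) (fun s hs => deriv_prof2_eq hs) _ hs,
    deriv_const_mul_field']
  simp only [Real.deriv_rpow_const]
  have e : ∀ a : ℝ, (‖x‖ ^ 2) ^ (a - 1 - 1) = (‖x‖ ^ 2) ^ (a - 1) / ‖x‖ ^ 2 := fun a =>
    Real.rpow_sub_one h0.ne' _
  rw [e]
  field_simp
  ring

theorem ker_phi : Ker (phi (n := n)) where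
  smooth := by
    unfold phi lap
    exact ContDiff.sum fun i _ => contDiff_pd (contDiff_pd (contDiff_radial contDiff_prof2))
  supp := fun x hx => phi_zero hx.le

theorem integral_phi_ne_zero (hn : 4 ≤ n) : ∫ x : E n, phi x ≠ 0 := by
  have hX : ContDiff ℝ ∞ (fun s => 1 - kap s) := contDiff_const.sub contDiff_kap
  set X : ℝ → ℝ := fun s => 1 - kap s with hXdef
  have hX1 : ∀ s, s ≤ 1 → X s = 1 := fun s hs => by simp [hXdef, kap_zero hs]
  have hX2 : ∀ s, 2 ≤ s → X s = 0 := fun s hs => by simp [hXdef, kap_one hs]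
  have hnn : (4 : ℝ) ≤ n := by exact_mod_cast hn
  -- the integrand after integration by parts
  have hdX : ∀ s, s < 1 → deriv X s = 0 := fun s hs => by
    have : X =ᶠ[𝓝 s] fun _ => 1 := by
      filter_upwards [gt_mem_nhds hs] with y hy using hX1 y (le_of_lt hy)
    rw [this.deriv_eq]; simp
  have hdX2 : ∀ s, 2 < s → deriv X s = 0 := fun s hs => by
    have : X =ᶠ[𝓝 s] fun _ => 0 := by
      filter_upwards [lt_mem_nhds hs] with y hy using hX2 y (le_of_lt hy)
    rw [this.deriv_eq]; simp
  have hanti : Antitone X := by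
    intro a b hab
    have : kap a ≤ kap b := Real.smoothTransition.monotone (by linarith)
    simp only [hXdef]; linarith
  have hdXle : ∀ s, deriv X s ≤ 0 := fun s => hanti.deriv_nonpos
  set W : E n → ℝ := fun x => 4 * ‖x‖ ^ 2 * (deriv (prof2 n) (‖x‖ ^ 2) * deriv X (‖x‖ ^ 2)) with hW
  have hWc : Continuous W := by
    have h1 := (contDiff_radial (n := n) (contDiff_deriv (contDiff_prof2 (n := n)))).continuous
    have h2 := (contDiff_radial (n := n) (contDiff_deriv hX)).continuous
    fun_prop
  have hWs : HasCompactSupport W := by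
    refine HasCompactSupport.intro (isCompact_closedBall 0 2) fun x hx => ?_
    have : 2 < ‖x‖ := by simpa using hx
    simp [hW, hdX2 (‖x‖ ^ 2) (by nlinarith)]
  have hWn : 0 ≤ W := by
    intro x
    simp only [hW]
    rcases lt_or_ge (‖x‖ ^ 2) 1 with h | h
    · simp [hdX _ h]
    · rw [deriv_prof2_eq h]
      have := hdXle (‖x‖ ^ 2)
      have h3 : (0:ℝ) ≤ (‖x‖ ^ 2) ^ (-(((n : ℝ) - 2) / 2) - 1) := by positivity
      refine mul_nonneg (by positivity) (mul_nonneg_of_nonpos_of_nonpos ?_ this)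
      nlinarith
  have h := integral_div_eq_zero isOpen_univ (V := fun i (x : E n) =>
    pd i (fun x => prof2 n (‖x‖ ^ 2)) x * X (‖x‖ ^ 2)) (S := Metric.closedBall 0 2) ?_
    (isCompact_closedBall 0 2) (subset_univ _) ?_
  · have e : ∀ x : E n, ∑ i, pd i (fun x => pd i (fun x => prof2 n (‖x‖ ^ 2)) x * X (‖x‖ ^ 2)) x =
        phi x + W x := by
      intro x
      have hd := (contDiff_radial (n := n) hX).differentiable (by simp) x
      have hd' := fun i => (contDiff_pd (i := i) (contDiff_radial (n := n)
        (contDiff_prof2 (n := n)))).differentiable (by simp) x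
      have : ∀ i, pd i (fun x => pd i (fun x => prof2 n (‖x‖ ^ 2)) x * X (‖x‖ ^ 2)) x =
        pd i (pd i (fun x => prof2 n (‖x‖ ^ 2))) x * X (‖x‖ ^ 2) +
          (x i * x i) * (4 * (deriv (prof2 n) (‖x‖ ^ 2) * deriv X (‖x‖ ^ 2))) := by
        intro i
        rw [pd_mul (hd' i) hd, pd_radial' hX, pd_radial' contDiff_prof2]
        ring
      simp only [this, Finset.sum_add_distrib, ← Finset.sum_mul, sum_mul_self_eq]
      have e2 : ∑ i, pd i (pd i fun x => prof2 n (‖x‖ ^ 2)) x = phi x := rfl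
      rw [e2]
      congr 1
      · rcases le_or_gt 1 ‖x‖ with h | h
        · simp [phi_zero h]
        · rw [hX1 _ (by nlinarith [norm_nonneg x]), mul_one]
      · simp only [hW]; ring
    simp only [e] at h
    rw [integral_add ker_phi.integrable (hWc.integrable_of_hasCompactSupport hWs)] at h
    intro h0
    rw [h0, zero_add] at h
    have hz := (hWc.ae_eq_iff_eq volume continuous_const).1
      ((integral_eq_zero_iff_of_nonneg hWn (hWc.integrable_of_hasCompactSupport hWs)).1 h)
    obtain ⟨s, hs, hs'⟩ := exists_deriv_eq_slope X (show (1 : ℝ) < 2 by norm_num)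
      hX.continuous.continuousOn (hX.differentiable (by simp)).differentiableOn
    rw [hX1 1 le_rfl, hX2 2 le_rfl] at hs'
    let y : E n := EuclideanSpace.single ⟨0, by omega⟩ (Real.sqrt s)
    have hy : ‖y‖ ^ 2 = s := by
      simp only [y, PiLp.norm_single, Real.norm_eq_abs, sq_abs]
      exact Real.sq_sqrt (by linarith [hs.1])
    have hyz := congrFun hz y
    simp only [hW, hy, hs', deriv_prof2_eq hs.1.le] at hyz
    have h4 : (0:ℝ) < s ^ (-(((n : ℝ) - 2) / 2) - 1) := Real.rpow_pos_of_pos (by linarith [hs.1]) _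
    have h5 : 0 < s := by linarith [hs.1]
    have h6 : (n : ℝ) - 2 > 0 := by linarith
    have : 0 < 4 * s * (-(2 * ((n : ℝ) - 2)) * s ^ (-(((n : ℝ) - 2) / 2) - 1) * ((0 - 1) / (2 - 1))) := by
      have : 0 < 4 * s * ((2 * ((n : ℝ) - 2)) * s ^ (-(((n : ℝ) - 2) / 2) - 1)) := by positivity
      linarith
    exact absurd hyz this.ne'
  · intro i
    refine ContDiff.contDiffOn (ContDiff.of_le (n := ∞) ?_ (by simp))
    exact (contDiff_pd (contDiff_radial contDiff_prof2)).mul (contDiff_radial hX)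
  · intro i x hx
    have : 2 < ‖x‖ := by simpa using hx
    simp [hX2 (‖x‖ ^ 2) (by nlinarith)]

noncomputable def tprof (n : ℕ) (s : ℝ) : ℝ := 2 ^ ((n : ℝ) - 2) * prof n (4 * s) - prof n s

theorem contDiff_tprof : ContDiff ℝ ∞ (tprof n) :=
  (contDiff_const.mul (contDiff_prof.comp (contDiff_const.mul contDiff_id))).sub contDiff_prof

theorem tprof_zero {s : ℝ} (hs : 1 ≤ s) : tprof n s = 0 := by
  rw [tprof, prof_eq hs, prof_eq (by linarith), Real.mul_rpow (by norm_num) (by linarith),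
    show (4 : ℝ) = 2 ^ (2 : ℝ) by norm_num, ← Real.rpow_mul (by norm_num), ← mul_assoc,
    ← Real.rpow_add (by norm_num)]
  ring_nf
  simp

/-- The potential whose bilaplacian is the difference of two rescaled mollifiers. -/
noncomputable def pot (x : E n) : ℝ := ∫ s in (1 : ℝ)..(‖x‖ ^ 2), tprof n s

theorem hasDerivAt_int_tprof (s : ℝ) :
    HasDerivAt (fun s => ∫ r in (1 : ℝ)..s, tprof n r) (tprof n s) s :=
  intervalIntegral.integral_hasDerivAt_right (contDiff_tprof.continuous.intervalIntegrable _ _)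
    (contDiff_tprof.continuous.stronglyMeasurableAtFilter _ _) contDiff_tprof.continuous.continuousAt

theorem deriv_int_tprof : deriv (fun s => ∫ r in (1 : ℝ)..s, tprof n r) = tprof n :=
  funext fun s => (hasDerivAt_int_tprof s).deriv

theorem contDiff_int_tprof : ContDiff ℝ ∞ (fun s => ∫ r in (1 : ℝ)..s, tprof n r) := by
  rw [contDiff_infty_iff_deriv, deriv_int_tprof]
  exact ⟨fun s => (hasDerivAt_int_tprof s).differentiableAt, contDiff_tprof⟩

theorem ker_pot : Ker (pot (n := n)) where
  smooth := contDiff_radial contDiff_int_tprof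
  supp := fun x hx => by
    have h1 : 1 ≤ ‖x‖ ^ 2 := one_le_pow₀ hx.le
    rw [pot, intervalIntegral.integral_congr (g := fun _ => 0)]
    · simp
    · intro s hs
      rw [uIcc_of_le h1] at hs
      exact tprof_zero hs.1

theorem lap_pot (x : E n) : lap pot x =
    2 ^ ((n : ℝ) - 2) * prof2 n (4 * ‖x‖ ^ 2) - prof2 n (‖x‖ ^ 2) := by
  have := lap_radial (n := n) (contDiff_int_tprof (n := n)) x
  rw [deriv_int_tprof] at this
  have hd : deriv (tprof n) (‖x‖ ^ 2) = 2 ^ ((n : ℝ) - 2) * (4 * deriv (prof n) (4 * ‖x‖ ^ 2))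
      - deriv (prof n) (‖x‖ ^ 2) := by
    have h1 := (ContDiff.hasDerivAt_deriv (contDiff_prof (n := n)) (4 * ‖x‖ ^ 2)).comp (‖x‖ ^ 2)
      ((hasDerivAt_id (‖x‖ ^ 2)).const_mul 4)
    have h2 := (h1.const_mul (2 ^ ((n : ℝ) - 2))).sub
      (ContDiff.hasDerivAt_deriv (contDiff_prof (n := n)) (‖x‖ ^ 2))
    refine HasDerivAt.deriv (HasDerivAt.congr_deriv h2 ?_)
    ring
  rw [hd] at this
  simp only [prof2]
  refine Eq.trans this ?_
  simp only [tprof]; ring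

theorem lap_lap_pot (x : E n) : lap (lap pot) x = 2 ^ n * phi ((2 : ℝ) • x) - phi x := by
  have e : lap (pot (n := n)) = fun x : E n => (fun s =>
      2 ^ ((n : ℝ) - 2) * prof2 n (4 * s) - prof2 n s) (‖x‖ ^ 2) := funext lap_pot
  have h0 := contDiff_prof2 (n := n)
  have h0' := contDiff_deriv h0
  have hc : ContDiff ℝ ∞ (fun s => 2 ^ ((n : ℝ) - 2) * prof2 n (4 * s) - prof2 n s) :=
    (contDiff_const.mul (h0.comp (contDiff_const.mul contDiff_id))).sub h0
  have key : ∀ (F : ℝ → ℝ) (a s : ℝ), ContDiff ℝ ∞ F →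
      deriv (fun s => a * F (4 * s) - F s) s = a * (4 * deriv F (4 * s)) - deriv F s := by
    intro F a s hF
    have h1 := (ContDiff.hasDerivAt_deriv hF (4 * s)).comp s ((hasDerivAt_id s).const_mul 4)
    have h2 := (h1.const_mul a).sub (ContDiff.hasDerivAt_deriv hF s)
    refine HasDerivAt.deriv (HasDerivAt.congr_deriv h2 ?_)
    ring
  rw [e, lap_radial hc]
  have d1 : deriv (fun s => 2 ^ ((n : ℝ) - 2) * prof2 n (4 * s) - prof2 n s) =
      fun s => (2 ^ ((n : ℝ) - 2) * 4) * deriv (prof2 n) (4 * s) - deriv (prof2 n) s := by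
    ext s; rw [key _ _ _ h0]; ring
  have hp : (2 : ℝ) ^ ((n : ℝ) - 2) = 2 ^ n / 4 := by
    rw [Real.rpow_sub (by norm_num), Real.rpow_natCast]; norm_num
  rw [d1, key _ _ _ h0', phi_eq, phi_eq, norm_smul, mul_pow, hp]
  norm_num
  ring

end kernel

end

section

variable {n : ℕ}

/-- Averages at scale `t`: `∫ K z * f (x - t z) dz`. -/
noncomputable def cv (K : E n → ℝ) (t : ℝ) (f : E n → ℝ) (x : E n) : ℝ :=
  ∫ z, K z * f (x - t • z)

theorem cv_eq (K : E n → ℝ) {t : ℝ} (ht : 0 < t) (f : E n → ℝ) (x : E n) :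
    cv K t f x = (t ^ n)⁻¹ * ∫ y, K (t⁻¹ • (x - y)) * f y := by
  rw [← integral_sub_left_eq_self (fun y => K (t⁻¹ • (x - y)) * f y) volume x]
  have h := Measure.integral_comp_smul (volume : Measure (E n))
    (fun w => K (t⁻¹ • (x - (x - w))) * f (x - w)) t
  rw [finrank_euclideanSpace_fin, abs_of_pos (by positivity), smul_eq_mul] at h
  rw [← h, cv]
  congr 1
  ext z
  rw [sub_sub_cancel, smul_smul, inv_mul_cancel₀ ht.ne', one_smul]

theorem sub_smul_mem {R r t : ℝ} {x z : E n} (hx : x ∈ Metric.ball (0 : E n) (R - r)) (ht : 0 ≤ t)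
    (htr : t ≤ r) (hz : ‖z‖ ≤ 1) : x - t • z ∈ Metric.ball (0 : E n) R := by
  rw [mem_ball_zero_iff] at *
  have h1 := norm_sub_le x (t • z)
  rw [norm_smul, Real.norm_eq_abs, abs_of_nonneg ht] at h1
  have : t * ‖z‖ ≤ t := by nlinarith [norm_nonneg z]
  linarith

theorem Ker.mul_congr {K : E n → ℝ} (hK : Ker K) {z : E n} {a b : ℝ} (h : ‖z‖ ≤ 1 → a = b) :
    K z * a = K z * b := by
  rcases le_or_gt ‖z‖ 1 with h1 | h1
  · rw [h h1]
  · simp [hK.supp z h1]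

theorem cv_congr {K : E n → ℝ} (hK : Ker K) {R r t : ℝ} {x : E n} {f g : E n → ℝ}
    (hx : x ∈ Metric.ball (0 : E n) (R - r)) (ht : 0 ≤ t) (htr : t ≤ r)
    (h : ∀ y ∈ Metric.ball (0 : E n) R, f y = g y) : cv K t f x = cv K t g x := by
  refine integral_congr_ae (ae_of_all _ fun z => hK.mul_congr fun hz => h _ (sub_smul_mem hx ht htr hz))

/-- The `L¹` norm of a kernel. -/
noncomputable def L1 (K : E n → ℝ) : ℝ := ∫ z, |K z|

theorem L1_nonneg (K : E n → ℝ) : 0 ≤ L1 K := integral_nonneg fun _ => abs_nonneg _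

theorem integral_mul_le {K : E n → ℝ} (hK : Ker K) {g : E n → ℝ} {M : ℝ}
    (h : ∀ z, ‖z‖ ≤ 1 → |g z| ≤ M) : |∫ z, K z * g z| ≤ L1 K * M := by
  have := norm_integral_le_of_norm_le (μ := volume) (f := fun z => K z * g z)
    (hK.integrable.norm.mul_const M) (ae_of_all _ fun z => ?_)
  · rw [integral_mul_const] at this
    exact this
  · rcases le_or_gt ‖z‖ 1 with h1 | h1
    · rw [norm_mul]; gcongr; exact h z h1
    · simp [hK.supp z h1]

theorem abs_cv_le {K : E n → ℝ} (hK : Ker K) {R r t M : ℝ} {x : E n} {f : E n → ℝ}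
    (hx : x ∈ Metric.ball (0 : E n) (R - r)) (ht : 0 ≤ t) (htr : t ≤ r)
    (h : ∀ y ∈ Metric.ball (0 : E n) R, |f y| ≤ M) : |cv K t f x| ≤ L1 K * M :=
  integral_mul_le hK fun _ hz => h _ (sub_smul_mem hx ht htr hz)

theorem integrable_cv {K : E n → ℝ} (hK : Ker K) {R r t M : ℝ} {x : E n} {f : E n → ℝ}
    (hf : Measurable f) (hx : x ∈ Metric.ball (0 : E n) (R - r)) (ht : 0 ≤ t) (htr : t ≤ r)
    (h : ∀ y ∈ Metric.ball (0 : E n) R, |f y| ≤ M) :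
    Integrable fun z => K z * f (x - t • z) := by
  refine (hK.integrable.norm.mul_const M).mono' ?_ (ae_of_all _ fun z => ?_)
  · exact (hK.smooth.continuous.measurable.mul (hf.comp (by fun_prop))).aestronglyMeasurable
  · rcases le_or_gt ‖z‖ 1 with h1 | h1
    · rw [norm_mul]; gcongr; exact h _ (sub_smul_mem hx ht htr h1)
    · simp [hK.supp z h1]

theorem Ker.fderiv_bounded {K : E n → ℝ} (hK : Ker K) : ∃ M, 0 ≤ M ∧ ∀ x, ‖fderiv ℝ K x‖ ≤ M := by
  obtain ⟨M, hM⟩ := (hK.smooth.continuous_fderiv (by simp)).bounded_above_of_compact_support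
    (hK.hasCompactSupport.fderiv ℝ)
  exact ⟨M, (norm_nonneg _).trans (hM 0), hM⟩

theorem integrable_indicator_ball {f : E n → ℝ} (hf : Measurable f) {R M : ℝ}
    (h : ∀ y ∈ Metric.ball (0 : E n) R, |f y| ≤ M) :
    Integrable (indicator (Metric.ball (0 : E n) R) f) := by
  rw [integrable_indicator_iff measurableSet_ball]
  exact Measure.integrableOn_of_bounded measure_ball_lt_top.ne hf.aestronglyMeasurable (M := M)
    ((ae_restrict_iff' measurableSet_ball).2 (ae_of_all _ h))

theorem cv_pd {K : E n → ℝ} (hK : Ker K) {R r t M : ℝ} {x : E n} {f : E n → ℝ}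
    (hf : Measurable f) (hx : x ∈ Metric.ball (0 : E n) (R - r)) (ht : 0 < t) (htr : t ≤ r)
    (h : ∀ y ∈ Metric.ball (0 : E n) R, |f y| ≤ M) :
    DifferentiableAt ℝ (cv K t f) x ∧ ∀ i, pd i (cv K t f) x = t⁻¹ * cv (pd i K) t f x := by
  set g := indicator (Metric.ball (0 : E n) R) f with hg
  have hgi : Integrable g := integrable_indicator_ball hf h
  have hgm : Measurable g := hf.indicator measurableSet_ball
  have hfg : ∀ y ∈ Metric.ball (0 : E n) R, f y = g y := fun y hy => (indicator_of_mem hy f).symm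
  obtain ⟨D, hD0, hD⟩ := hK.fderiv_bounded
  have hKd : ∀ x, DifferentiableAt ℝ K x := hK.smooth.differentiable (by simp)
  have hKc := hK.smooth.continuous
  have hmF : ∀ x : E n, AEStronglyMeasurable
      (fun y => g y • (t⁻¹ • fderiv ℝ K (t⁻¹ • (x - y)))) volume := fun x => by
    have h0 : Continuous (fun y : E n => t⁻¹ • (x - y)) := by fun_prop
    have h1 := ((hK.smooth.continuous_fderiv (by simp)).comp h0).const_smul t⁻¹
    exact hgm.aestronglyMeasurable.smul h1.aestronglyMeasurable
  have hmain := hasFDerivAt_integral_of_dominated_of_fderiv_le (μ := volume) (𝕜 := ℝ)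
    (F := fun x y => K (t⁻¹ • (x - y)) * g y) (x₀ := x) (s := univ)
    (F' := fun x y => g y • (t⁻¹ • fderiv ℝ K (t⁻¹ • (x - y))))
    (bound := fun y => |g y| * (t⁻¹ * D)) univ_mem ?_ ?_ ?_ ?_ ?_ ?_
  · have h2 := hmain.const_mul ((t ^ n)⁻¹)
    have heq : cv K t f =ᶠ[𝓝 x] fun x => (t ^ n)⁻¹ * ∫ y, K (t⁻¹ • (x - y)) * g y := by
      filter_upwards [Metric.isOpen_ball.mem_nhds hx] with y hy
      rw [cv_congr hK hy ht.le htr hfg, cv_eq K ht]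
    have h3 := h2.congr_of_eventuallyEq heq
    refine ⟨h3.differentiableAt, fun i => ?_⟩
    rw [pd, h3.fderiv, cv_congr (hK.pd i) hx ht.le htr hfg, cv_eq _ ht]
    simp only [smul_apply, smul_eq_mul]
    rw [ContinuousLinearMap.integral_apply, mul_left_comm, ← integral_const_mul t⁻¹]
    · refine congrArg (fun a => (t ^ n)⁻¹ * a)
        (integral_congr_ae (μ := volume) (ae_of_all _ fun y => ?_))
      change (g y • (t⁻¹ • fderiv ℝ K (t⁻¹ • (x - y)))) _ = t⁻¹ * _
      rw [smul_apply, smul_apply, smul_eq_mul, smul_eq_mul, pd]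
      ring
    · refine (hgi.norm.mul_const (t⁻¹ * D)).mono' (hmF x) (ae_of_all _ fun y => ?_)
      · rw [norm_smul, norm_smul, Real.norm_eq_abs t⁻¹, abs_of_pos (inv_pos.2 ht)]
        gcongr
        exact hD _
  · exact Eventually.of_forall fun x =>
      ((hKc.measurable.comp (by fun_prop)).mul hgm).aestronglyMeasurable
  · obtain ⟨B, _, hB⟩ := hK.bounded
    refine (hgi.norm.const_mul B).mono' ?_ (ae_of_all _ fun y => ?_)
    · exact ((hKc.measurable.comp (by fun_prop)).mul hgm).aestronglyMeasurable
    · rw [norm_mul]; gcongr; exact hB _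
  · exact hmF x
  · refine ae_of_all _ fun y x _ => ?_
    rw [norm_smul, norm_smul, Real.norm_eq_abs t⁻¹, abs_of_pos (inv_pos.2 ht)]
    gcongr
    · rfl
    · exact hD _
  · exact hgi.norm.mul_const _
  · refine ae_of_all _ fun y x _ => ?_
    have h1 : HasFDerivAt (fun x : E n => t⁻¹ • (x - y)) (t⁻¹ • ContinuousLinearMap.id ℝ (E n)) x :=
      ((hasFDerivAt_id x).sub_const y).const_smul t⁻¹
    have h2 := ((hKd (t⁻¹ • (x - y))).hasFDerivAt.comp x h1).mul_const (g y)
    refine h2.congr_fderiv ?_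
    ext v
    simp

/-- Differentiation of an average falls on the averaged function. -/
theorem cv_pd' {K : E n → ℝ} (hK : Ker K) {R r t M : ℝ} {x : E n} {f : E n → ℝ}
    (hf : Measurable f) (hx : x ∈ Metric.ball (0 : E n) (R - r)) (ht : 0 ≤ t) (htr : t ≤ r)
    (h : ∀ y ∈ Metric.ball (0 : E n) R, |f y| ≤ M)
    (hfd : ∀ y ∈ Metric.ball (0 : E n) R, DifferentiableAt ℝ f y)
    (hfb : ∀ y ∈ Metric.ball (0 : E n) R, ∀ i, |pd i f y| ≤ M) :
    DifferentiableAt ℝ (cv K t f) x ∧ ∀ i, pd i (cv K t f) x = cv K t (pd i f) x := by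
  have hKc := hK.smooth.continuous
  have hfb' : ∀ y ∈ Metric.ball (0 : E n) R, ‖fderiv ℝ f y‖ ≤ n * M := fun y hy => by
    refine (norm_fderiv_le_sum f y).trans ((Finset.sum_le_sum fun i _ => hfb y hy i).trans ?_)
    simp
  have hmeas : ∀ x : E n, AEStronglyMeasurable (fun z => K z • fderiv ℝ f (x - t • z)) volume :=
    fun x => (hKc.measurable.smul ((measurable_fderiv ℝ f).comp (by fun_prop))).aestronglyMeasurable
  have hbd : ∀ z, ∀ y ∈ Metric.ball (0 : E n) (R - r), ‖K z • fderiv ℝ f (y - t • z)‖ ≤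
      |K z| * (n * M) := by
    intro z y hy
    rcases le_or_gt ‖z‖ 1 with h1 | h1
    · rw [norm_smul]; gcongr
      · rfl
      · exact hfb' _ (sub_smul_mem hy ht htr h1)
    · simp [hK.supp z h1]
  have hmain := hasFDerivAt_integral_of_dominated_of_fderiv_le (μ := volume) (𝕜 := ℝ)
    (F := fun x z => K z * f (x - t • z)) (x₀ := x) (s := Metric.ball (0 : E n) (R - r))
    (F' := fun x z => K z • fderiv ℝ f (x - t • z))
    (bound := fun z => |K z| * (n * M)) (Metric.isOpen_ball.mem_nhds hx) ?_ ?_ ?_ ?_ ?_ ?_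
  · refine ⟨hmain.differentiableAt, fun i => ?_⟩
    change fderiv ℝ (fun x => ∫ z, K z * f (x - t • z)) x _ = _
    rw [hmain.fderiv, ContinuousLinearMap.integral_apply]
    · rfl
    · exact (hK.integrable.norm.mul_const (n * M)).mono' (hmeas x) (ae_of_all _ fun z => hbd z x hx)
  · exact Eventually.of_forall fun x =>
      (hKc.measurable.mul (hf.comp (by fun_prop))).aestronglyMeasurable
  · exact integrable_cv hK hf hx ht htr h
  · exact hmeas x
  · exact ae_of_all _ fun z y hy => hbd z y hy
  · exact hK.integrable.norm.mul_const (n * M)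
  · refine ae_of_all _ fun z y hy => ?_
    rcases le_or_gt ‖z‖ 1 with h1 | h1
    · have h2 : HasFDerivAt (fun x : E n => x - t • z) (ContinuousLinearMap.id ℝ (E n)) y :=
        (hasFDerivAt_id y).sub_const _
      have h3 := ((hfd _ (sub_smul_mem hy ht htr h1)).hasFDerivAt.comp y h2).const_mul (K z)
      simpa using h3
    · simp [hK.supp z h1, hasFDerivAt_const]

end

section

variable {n : ℕ}

/-- Bounded and Hölder continuous functions on `B_R` with a single controlling constant. -/
def Hol (α R M : ℝ) (f : E n → ℝ) : Prop :=
  (∀ x ∈ Metric.ball (0 : E n) R, |f x| ≤ M) ∧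
    ∀ x ∈ Metric.ball (0 : E n) R, ∀ y ∈ Metric.ball (0 : E n) R, |f x - f y| ≤ 2 * M * ‖x - y‖ ^ α

/-- Functions whose partial derivatives up to order `k` are controlled on `B_R` by `M`
in the Hölder class `α`. -/
def Reg (α R M : ℝ) : ℕ → (E n → ℝ) → Prop
  | 0, f => Hol α R M f
  | k + 1, f => Hol α R M f ∧ (∀ x ∈ Metric.ball (0 : E n) R, DifferentiableAt ℝ f x) ∧
      ∀ i, Reg α R M k (pd i f)

theorem hol_zero {R M : ℝ} {f : E n → ℝ} (h : ∀ x ∈ Metric.ball (0 : E n) R, |f x| ≤ M) :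
    Hol 0 R M f := by
  refine ⟨h, fun x hx y hy => ?_⟩
  rw [Real.rpow_zero]
  have := abs_sub (f x) (f y)
  linarith [h x hx, h y hy]

theorem Reg.hol {α R M : ℝ} {k : ℕ} {f : E n → ℝ} (h : Reg α R M k f) : Hol α R M f := by
  cases k with
  | zero => exact h
  | succ k => exact h.1

theorem Hol.mono {α R M R' M' : ℝ} {f : E n → ℝ} (h : Hol α R M f) (hR : R' ≤ R) (hM : M ≤ M') :
    Hol α R' M' f := by
  have hs := Metric.ball_subset_ball (x := (0 : E n)) hR
  refine ⟨fun x hx => (h.1 x (hs hx)).trans hM, fun x hx y hy => (h.2 x (hs hx) y (hs hy)).trans ?_⟩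
  gcongr

theorem Reg.mono {α R M R' M' : ℝ} {k : ℕ} {f : E n → ℝ} (h : Reg α R M k f) (hR : R' ≤ R)
    (hM : M ≤ M') : Reg α R' M' k f := by
  induction k generalizing f with
  | zero => exact Hol.mono h hR hM
  | succ k ih =>
    exact ⟨h.1.mono hR hM, fun x hx => h.2.1 x (Metric.ball_subset_ball hR hx), fun i => ih (h.2.2 i)⟩

theorem Reg.pred {α R M : ℝ} {k : ℕ} {f : E n → ℝ} (h : Reg α R M (k + 1) f) : Reg α R M k f := by
  induction k generalizing f with
  | zero => exact h.1
  | succ k ih => exact ⟨h.1, h.2.1, fun i => ih (h.2.2 i)⟩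

theorem Hol.congr {α R M : ℝ} {f g : E n → ℝ} (h : Hol α R M f)
    (e : EqOn f g (Metric.ball (0 : E n) R)) : Hol α R M g := by
  refine ⟨fun x hx => e hx ▸ h.1 x hx, fun x hx y hy => ?_⟩
  rw [← e hx, ← e hy]; exact h.2 x hx y hy

theorem Reg.congr {α R M : ℝ} {k : ℕ} {f g : E n → ℝ} (h : Reg α R M k f)
    (e : EqOn f g (Metric.ball (0 : E n) R)) : Reg α R M k g := by
  induction k generalizing f g with
  | zero => exact Hol.congr h e
  | succ k ih =>
    refine ⟨h.1.congr e, fun x hx => (h.2.1 x hx).congr_of_eventuallyEq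
      (e.symm.eventuallyEq_of_mem (Metric.isOpen_ball.mem_nhds hx)),
      fun i => ih (h.2.2 i) (pd_eqOn Metric.isOpen_ball e)⟩

theorem Hol.add {α R M M' : ℝ} {f g : E n → ℝ} (h : Hol α R M f) (h' : Hol α R M' g) :
    Hol α R (M + M') (fun x => f x + g x) := by
  refine ⟨fun x hx => (abs_add_le _ _).trans (add_le_add (h.1 x hx) (h'.1 x hx)),
    fun x hx y hy => ?_⟩
  have := abs_add_le (f x - f y) (g x - g y)
  rw [show f x + g x - (f y + g y) = f x - f y + (g x - g y) by ring]
  linarith [h.2 x hx y hy, h'.2 x hx y hy]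

theorem Reg.add {α R M M' : ℝ} {k : ℕ} {f g : E n → ℝ} (h : Reg α R M k f) (h' : Reg α R M' k g) :
    Reg α R (M + M') k (fun x => f x + g x) := by
  induction k generalizing f g with
  | zero => exact Hol.add h h'
  | succ k ih =>
    exact ⟨h.1.add h'.1, fun x hx => (h.2.1 x hx).fun_add (h'.2.1 x hx), fun i =>
      (ih (h.2.2 i) (h'.2.2 i)).congr fun x hx => (pd_add (h.2.1 x hx) (h'.2.1 x hx)).symm⟩

theorem reg_const_zero {α R : ℝ} {k : ℕ} : Reg α R 0 k (fun _ : E n => 0) := by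
  have h0 : Hol α R 0 (fun _ : E n => 0) := ⟨by simp, by simp⟩
  induction k with
  | zero => exact h0
  | succ k ih =>
    refine ⟨h0, by simp, fun i => ih.congr fun x _ => ?_⟩
    rw [pd_const]

theorem reg_sum {ι : Type*} (s : Finset ι) {α R M : ℝ} {k : ℕ} {f : ι → E n → ℝ}
    (h : ∀ i ∈ s, Reg α R M k (f i)) : Reg α R (s.card * M) k (fun x => ∑ i ∈ s, f i x) := by
  classical
  induction s using Finset.induction_on with
  | empty => simpa using reg_const_zero
  | insert a s ha ih =>
    have h1 := (h a (by simp)).add (ih fun i hi => h i (by simp [hi]))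
    simp only [Finset.sum_insert ha, Finset.card_insert_of_notMem ha]
    refine h1.mono le_rfl (le_of_eq ?_)
    push_cast; ring

theorem Hol.const_mul {α R M : ℝ} {f : E n → ℝ} (h : Hol α R M f) (c : ℝ) :
    Hol α R (|c| * M) (fun x => c * f x) := by
  refine ⟨fun x hx => ?_, fun x hx y hy => ?_⟩
  · rw [abs_mul]; gcongr; exact h.1 x hx
  · rw [← mul_sub, abs_mul]
    have := mul_le_mul_of_nonneg_left (h.2 x hx y hy) (abs_nonneg c)
    linarith

theorem Reg.const_mul {α R M : ℝ} {k : ℕ} {f : E n → ℝ} (h : Reg α R M k f) (c : ℝ) :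
    Reg α R (|c| * M) k (fun x => c * f x) := by
  induction k generalizing f with
  | zero => exact Hol.const_mul h c
  | succ k ih =>
    exact ⟨h.1.const_mul c, fun x hx => (h.2.1 x hx).const_mul c, fun i =>
      (ih (h.2.2 i)).congr fun x hx => (pd_const_mul c (h.2.1 x hx)).symm⟩

theorem Hol.mul {α R M M' : ℝ} (hM : 0 ≤ M) (hM' : 0 ≤ M') {f g : E n → ℝ} (h : Hol α R M f)
    (h' : Hol α R M' g) : Hol α R (2 * M * M') (fun x => f x * g x) := by
  refine ⟨fun x hx => ?_, fun x hx y hy => ?_⟩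
  · rw [abs_mul]
    calc |f x| * |g x| ≤ M * M' := by gcongr; exacts [h.1 x hx, h'.1 x hx]
      _ ≤ 2 * M * M' := by nlinarith [mul_nonneg hM hM']
  · rw [show f x * g x - f y * g y = f x * (g x - g y) + (f x - f y) * g y by ring]
    refine (abs_add_le _ _).trans ?_
    rw [abs_mul, abs_mul]
    calc |f x| * |g x - g y| + |f x - f y| * |g y|
        ≤ M * (2 * M' * ‖x - y‖ ^ α) + 2 * M * ‖x - y‖ ^ α * M' := by
          gcongr
          exacts [h.1 x hx, h'.2 x hx y hy, h.2 x hx y hy, h'.1 y hy]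
      _ = _ := by ring

theorem Reg.mul {α R M M' : ℝ} (hM : 0 ≤ M) (hM' : 0 ≤ M') {k : ℕ} {f g : E n → ℝ}
    (h : Reg α R M k f) (h' : Reg α R M' k g) :
    Reg α R (2 ^ (k + 1) * M * M') k (fun x => f x * g x) := by
  induction k generalizing f g with
  | zero => exact (Hol.mul hM hM' h h').mono le_rfl (by simp)
  | succ k ih =>
    refine ⟨(h.1.mul hM hM' h'.1).mono le_rfl ?_, fun x hx => (h.2.1 x hx).fun_mul (h'.2.1 x hx),
      fun i => ?_⟩
    · gcongr
      calc (2 : ℝ) = 2 ^ 1 := by norm_num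
        _ ≤ 2 ^ (k + 1 + 1) := pow_le_pow_right₀ (by norm_num) (by omega)
    · refine (((ih (h.2.2 i) h'.pred).add (ih h.pred (h'.2.2 i))).mono le_rfl
        (le_of_eq ?_)).congr fun x hx => (pd_mul (h.2.1 x hx) (h'.2.1 x hx)).symm
      ring

theorem reg_cv (k : ℕ) : ∀ {K : E n → ℝ}, Ker K → ∀ {r : ℝ}, 0 < r → ∃ C, 0 ≤ C ∧
    ∀ (R M : ℝ) (f : E n → ℝ), Measurable f → 0 ≤ M → (∀ x ∈ Metric.ball (0 : E n) R, |f x| ≤ M) →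
      Reg 0 (R - r) (C * M) k (cv K r f) := by
  induction k with
  | zero =>
    intro K hK r hr
    exact ⟨L1 K, L1_nonneg K, fun R M f hf _ h => hol_zero fun x hx => abs_cv_le hK hx hr.le le_rfl h⟩
  | succ k ih =>
    intro K hK r hr
    choose C hC0 hC using fun i => ih (hK.pd i) hr
    refine ⟨L1 K + ∑ i, r⁻¹ * C i, ?_, fun R M f hf hM h => ⟨?_, ?_, ?_⟩⟩
    · exact add_nonneg (L1_nonneg K) (Finset.sum_nonneg fun i _ => mul_nonneg (by positivity) (hC0 i))
    · refine (hol_zero (M := L1 K * M) fun x hx => abs_cv_le hK hx hr.le le_rfl h).mono le_rfl ?_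
      have : 0 ≤ ∑ i, r⁻¹ * C i := Finset.sum_nonneg fun i _ => mul_nonneg (by positivity) (hC0 i)
      nlinarith
    · exact fun x hx => (cv_pd hK hf hx hr le_rfl h).1
    · intro i
      refine (((hC i R M f hf hM h).const_mul r⁻¹).mono le_rfl ?_).congr
        fun x hx => ((cv_pd hK hf hx hr le_rfl h).2 i).symm
      rw [abs_of_pos (inv_pos.2 hr), ← mul_assoc]
      refine mul_le_mul_of_nonneg_right ?_ hM
      have := Finset.single_le_sum (f := fun i => r⁻¹ * C i)
        (fun i _ => mul_nonneg (by positivity) (hC0 i)) (Finset.mem_univ i)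
      linarith [L1_nonneg K]

/-- Dyadic scales. -/
noncomputable def sc (r : ℝ) (j : ℕ) : ℝ := r * (1 / 2) ^ j

theorem sc_pos {r : ℝ} (hr : 0 < r) (j : ℕ) : 0 < sc r j := by unfold sc; positivity

theorem sc_le {r : ℝ} (hr : 0 < r) (j : ℕ) : sc r j ≤ r := by
  unfold sc
  exact mul_le_of_le_one_right hr.le (pow_le_one₀ (by norm_num) (by norm_num))

theorem hasSum_sc (r : ℝ) : HasSum (sc r) (2 * r) := by
  have := hasSum_geometric_two.mul_left r
  rwa [mul_comm r 2] at this

theorem summable_sqrt_sc (r : ℝ) : Summable fun j => √(sc r j) := by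
  have : ∀ j, √(sc r j) = √r * √(1 / 2) ^ j := fun j => by
    rw [sc, Real.sqrt_mul' _ (by positivity)]
    congr 1
    rw [Real.sqrt_eq_iff_mul_self_eq (by positivity) (by positivity), ← mul_pow,
      Real.mul_self_sqrt (by norm_num)]
  simp_rw [this]
  refine (summable_geometric_of_lt_one (Real.sqrt_nonneg _) ?_).mul_left _
  rw [Real.sqrt_lt' one_pos]; norm_num

/-- The sum of the averages over all dyadic scales: an integral operator of order `-1`. -/
noncomputable def Tp (K : E n → ℝ) (r : ℝ) (f : E n → ℝ) (x : E n) : ℝ :=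
  ∑' j, sc r j * cv K (sc r j) f x

section Tp

variable {K : E n → ℝ} (hK : Ker K) {R r M : ℝ} {f : E n → ℝ} (hr : 0 < r) (hf : Measurable f)

include hK hr in
theorem abs_Tp_term_le (h : ∀ x ∈ Metric.ball (0 : E n) R, |f x| ≤ M) (j : ℕ) {x : E n}
    (hx : x ∈ Metric.ball (0 : E n) (R - r)) :
    ‖sc r j * cv K (sc r j) f x‖ ≤ sc r j * (L1 K * M) := by
  rw [norm_mul, Real.norm_eq_abs, abs_of_pos (sc_pos hr j)]
  gcongr
  · exact (sc_pos hr j).le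
  · exact abs_cv_le hK hx (sc_pos hr j).le (sc_le hr j) h

include hK hr in
theorem summable_Tp (h : ∀ x ∈ Metric.ball (0 : E n) R, |f x| ≤ M) {x : E n}
    (hx : x ∈ Metric.ball (0 : E n) (R - r)) : Summable fun j => sc r j * cv K (sc r j) f x :=
  Summable.of_norm_bounded ((hasSum_sc r).summable.mul_right _)
    fun j => abs_Tp_term_le hK hr h j hx

include hK hr in
theorem abs_Tp_le (h : ∀ x ∈ Metric.ball (0 : E n) R, |f x| ≤ M) {x : E n}
    (hx : x ∈ Metric.ball (0 : E n) (R - r)) : |Tp K r f x| ≤ 2 * r * (L1 K * M) :=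
  tsum_of_norm_bounded ((hasSum_sc r).mul_right _) fun j => abs_Tp_term_le hK hr h j hx

include hK hr in
theorem Tp_pd (h : ∀ x ∈ Metric.ball (0 : E n) R, |f x| ≤ M) {v : ℕ → ℝ} (hv : Summable v)
    (hd : ∀ j, ∀ x ∈ Metric.ball (0 : E n) (R - r), DifferentiableAt ℝ (cv K (sc r j) f) x)
    (hb : ∀ j, ∀ x ∈ Metric.ball (0 : E n) (R - r), ∀ i,
      |sc r j * pd i (cv K (sc r j) f) x| ≤ v j)
    {x : E n} (hx : x ∈ Metric.ball (0 : E n) (R - r)) :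
    DifferentiableAt ℝ (Tp K r f) x ∧
      ∀ i, pd i (Tp K r f) x = ∑' j, sc r j * pd i (cv K (sc r j) f) x := by
  have hbd : ∀ j, ∀ y ∈ Metric.ball (0 : E n) (R - r),
      ‖sc r j • fderiv ℝ (cv K (sc r j) f) y‖ ≤ n * v j := by
    intro j y hy
    have h1 := norm_fderiv_le_sum (fun y => sc r j * cv K (sc r j) f y) y
    rw [fderiv_const_mul (hd j y hy)] at h1
    refine h1.trans ((Finset.sum_le_sum (g := fun _ => v j) fun i _ => ?_).trans (by simp))
    rw [pd_const_mul _ (hd j y hy)]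
    exact hb j y hy i
  have h1 := hasFDerivAt_tsum_of_isPreconnected (𝕜 := ℝ) (hv.mul_left (n : ℝ))
    Metric.isOpen_ball ((convex_ball (0 : E n) (R - r)).isPreconnected)
    (f := fun j x => sc r j * cv K (sc r j) f x)
    (fun j y hy => (hd j y hy).hasFDerivAt.const_mul (sc r j)) hbd hx (summable_Tp hK hr h hx) hx
  refine ⟨h1.differentiableAt, fun i => ?_⟩
  change fderiv ℝ (fun x => ∑' j, sc r j * cv K (sc r j) f x) x _ = _
  have hs : Summable fun j => sc r j • fderiv ℝ (cv K (sc r j) f) x :=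
    Summable.of_norm_bounded (hv.mul_left (n : ℝ)) fun j => hbd j x hx
  rw [h1.fderiv]
  exact (ContinuousLinearMap.apply ℝ ℝ (EuclideanSpace.single i (1 : ℝ))).map_tsum hs

include hK hr hf in
theorem Tp_hol (hr1 : r ≤ 1) (hM : 0 ≤ M) (h : ∀ x ∈ Metric.ball (0 : E n) R, |f x| ≤ M) :
    Hol (1 / 2) (R - r) ((2 * L1 K + √(2 * L1 K * ∑ i, L1 (pd i K)) * ∑' j, √(sc 1 j)) * M)
      (Tp K r f) := by
  set D := ∑ i, L1 (pd i K) with hD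
  have hD0 : 0 ≤ D := Finset.sum_nonneg fun i _ => L1_nonneg _
  have hL := L1_nonneg K
  have hS : 0 ≤ ∑' j, √(sc 1 j) := tsum_nonneg fun _ => Real.sqrt_nonneg _
  refine ⟨fun x hx => (abs_Tp_le hK hr h hx).trans ?_, fun x hx y hy => ?_⟩
  · have : 2 * r * (L1 K * M) ≤ 2 * (L1 K * M) := by
      have := mul_nonneg hL hM
      nlinarith
    have : 0 ≤ √(2 * L1 K * D) * (∑' j, √(sc 1 j)) * M := by positivity
    linarith
  · have hsx := summable_Tp hK hr h hx
    have hsy := summable_Tp hK hr h hy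
    have hterm : ∀ j, ‖sc r j * cv K (sc r j) f x - sc r j * cv K (sc r j) f y‖ ≤
        √(sc 1 j) * (√(2 * L1 K * D) * M * √‖x - y‖) := by
      intro j
      have hp := sc_pos hr j
      have b1 : ‖sc r j * cv K (sc r j) f x - sc r j * cv K (sc r j) f y‖ ≤
          sc r j * (2 * L1 K * M) := by
        refine (norm_sub_le _ _).trans ?_
        linarith [abs_Tp_term_le hK hr h j hx, abs_Tp_term_le hK hr h j hy]
      have b2 : ‖sc r j * cv K (sc r j) f x - sc r j * cv K (sc r j) f y‖ ≤ D * M * ‖x - y‖ := by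
        have hmv := (convex_ball (0 : E n) (R - r)).norm_image_sub_le_of_norm_fderiv_le (𝕜 := ℝ)
          (f := fun x => sc r j * cv K (sc r j) f x) (C := D * M) ?_ ?_ hy hx
        · exact hmv
        · exact fun z hz => (cv_pd hK hf hz hp (sc_le hr j) h).1.const_mul _
        · intro z hz
          refine (norm_fderiv_le_sum _ _).trans ?_
          rw [hD, Finset.sum_mul]
          refine Finset.sum_le_sum fun i _ => ?_
          have := cv_pd hK hf hz hp (sc_le hr j) h
          rw [pd_const_mul _ this.1, this.2, mul_inv_cancel_left₀ hp.ne']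
          exact abs_cv_le (hK.pd i) hz hp.le (sc_le hr j) h
      have hsc : sc r j ≤ sc 1 j := by unfold sc; gcongr
      refine Real.le_sqrt_of_sq_le ?_ |>.trans (b := √((sc r j * (2 * L1 K * M)) * (D * M * ‖x - y‖))) ?_
      · rw [sq]; gcongr
      · have : (sc r j * (2 * L1 K * M)) * (D * M * ‖x - y‖) ≤
            sc 1 j * ((2 * L1 K * D) * (M * M) * ‖x - y‖) := by
          have h0 : 0 ≤ (2 * L1 K * D) * (M * M) * ‖x - y‖ := by positivity
          nlinarith
        refine (Real.sqrt_le_sqrt this).trans (le_of_eq ?_)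
        rw [Real.sqrt_mul (sc_pos one_pos j).le, Real.sqrt_mul (by positivity),
          Real.sqrt_mul (by positivity), Real.sqrt_mul_self hM]
    have := tsum_of_norm_bounded (((summable_sqrt_sc 1).hasSum).mul_right _) hterm
    rw [hsx.tsum_sub hsy] at this
    refine this.trans ?_
    rw [← Real.sqrt_eq_rpow]
    have h3 : 0 ≤ L1 K * M * √‖x - y‖ := by positivity
    have h4 : 0 ≤ √(2 * L1 K * D) * (∑' j, √(sc 1 j)) * M * √‖x - y‖ := by positivity
    nlinarith

include hK hr hf in
theorem Tp_pd_of_reg {α : ℝ} {k : ℕ} (h : Reg α R M (k + 1) f) {x : E n}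
    (hx : x ∈ Metric.ball (0 : E n) (R - r)) :
    DifferentiableAt ℝ (Tp K r f) x ∧ ∀ i, pd i (Tp K r f) x = Tp K r (pd i f) x := by
  have hb : ∀ y ∈ Metric.ball (0 : E n) R, ∀ i, |pd i f y| ≤ M := fun y hy i => (h.2.2 i).hol.1 y hy
  have hc := fun j y (hy : y ∈ Metric.ball (0 : E n) (R - r)) =>
    cv_pd' hK hf hy (sc_pos hr j).le (sc_le hr j) h.hol.1 h.2.1 hb
  have := Tp_pd hK hr h.hol.1 ((hasSum_sc r).summable.mul_right (L1 K * M)) (fun j y hy => (hc j y hy).1)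
    (fun j y hy i => by
      rw [(hc j y hy).2]
      exact abs_Tp_term_le hK hr (fun z hz => hb z hz i) j hy) hx
  refine ⟨this.1, fun i => ?_⟩
  rw [this.2, Tp]
  refine tsum_congr fun j => ?_
  rw [(hc j x hx).2]

end Tp

/-- The operator gains half a derivative on bounded functions. -/
theorem Tp_reg_half {K : E n → ℝ} (hK : Ker K) : ∃ C, 0 ≤ C ∧ ∀ (k : ℕ) (R r M : ℝ) (f : E n → ℝ),
    0 < r → r ≤ 1 → 0 ≤ M → Measurable f → Reg 0 R M k f → Reg (1 / 2) (R - r) (C * M) k (Tp K r f) := by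
  refine ⟨2 * L1 K + √(2 * L1 K * ∑ i, L1 (pd i K)) * ∑' j, √(sc 1 j), ?_, fun k => ?_⟩
  · have hS : 0 ≤ ∑' j, √(sc 1 j) := tsum_nonneg fun _ => Real.sqrt_nonneg _
    have := L1_nonneg K
    positivity
  · induction k with
    | zero => exact fun R r M f hr hr1 hM hf h => Tp_hol hK hr hf hr1 hM h.1
    | succ k ih =>
      intro R r M f hr hr1 hM hf h
      refine ⟨Tp_hol hK hr hf hr1 hM h.hol.1, fun x hx => (Tp_pd_of_reg hK hr hf h hx).1, fun i => ?_⟩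
      exact (ih R r M _ hr hr1 hM (measurable_pd i f) (h.2.2 i)).congr
        fun x hx => ((Tp_pd_of_reg hK hr hf h hx).2 i).symm

theorem Tp_pd_of_hol {K : E n → ℝ} (hK : Ker K) {R r M : ℝ} {f : E n → ℝ} (hr : 0 < r)
    (hf : Measurable f) (hM : 0 ≤ M) (h : Hol (1 / 2) R M f) {x : E n}
    (hx : x ∈ Metric.ball (0 : E n) (R - r)) :
    DifferentiableAt ℝ (Tp K r f) x ∧
      ∀ i, |pd i (Tp K r f) x| ≤ (2 * ∑ i, L1 (pd i K)) * (∑' j, √(sc r j)) * M := by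
  have hc := fun j y (hy : y ∈ Metric.ball (0 : E n) (R - r)) =>
    cv_pd hK hf hy (sc_pos hr j) (sc_le hr j) h.1
  have hb : ∀ j, ∀ y ∈ Metric.ball (0 : E n) (R - r), ∀ i,
      |sc r j * pd i (cv K (sc r j) f) y| ≤ √(sc r j) * ((2 * ∑ i, L1 (pd i K)) * M) := by
    intro j y hy i
    have hp := sc_pos hr j
    rw [(hc j y hy).2, mul_inv_cancel_left₀ hp.ne']
    have e : cv (pd i K) (sc r j) f y = ∫ z, pd i K z * (f (y - sc r j • z) - f y) := by
      simp_rw [mul_sub]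
      rw [integral_sub (integrable_cv (hK.pd i) hf hy hp.le (sc_le hr j) h.1)
        ((hK.pd i).integrable.mul_const _), integral_mul_const,
        integral_pd_eq_zero (hK.smooth.of_le (by simp)) hK.hasCompactSupport, zero_mul, sub_zero]
      rfl
    have hy' : y ∈ Metric.ball (0 : E n) R := Metric.ball_subset_ball (by linarith) hy
    rw [e]
    refine (integral_mul_le (hK.pd i) (M := 2 * M * √(sc r j)) fun z hz => ?_).trans ?_
    · refine (h.2 _ (sub_smul_mem hy hp.le (sc_le hr j) hz) y hy').trans ?_
      rw [← Real.sqrt_eq_rpow]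
      gcongr
      rw [sub_sub_cancel_left, norm_neg, norm_smul, Real.norm_eq_abs, abs_of_pos hp]
      exact mul_le_of_le_one_right hp.le hz
    · have := Finset.single_le_sum (f := fun i => L1 (pd i K)) (fun i _ => L1_nonneg _)
        (Finset.mem_univ i)
      have h2 : 0 ≤ 2 * M * √(sc r j) := by positivity
      nlinarith
  have := Tp_pd hK hr h.1 ((summable_sqrt_sc r).mul_right _) (fun j y hy => (hc j y hy).1) hb hx
  refine ⟨this.1, fun i => ?_⟩
  rw [this.2]
  refine (tsum_of_norm_bounded (f := fun j => sc r j * pd i (cv K (sc r j) f) x)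
    ((summable_sqrt_sc r).hasSum.mul_right _) fun j => hb j x hx i).trans
    (le_of_eq ?_)
  ring

/-- The operator maps Hölder functions to functions with bounded derivatives. -/
theorem Tp_reg_one {K : E n → ℝ} (hK : Ker K) : ∃ C, 0 ≤ C ∧ ∀ (k : ℕ) (R r M : ℝ) (f : E n → ℝ),
    0 < r → r ≤ 1 → 0 ≤ M → Measurable f → Reg (1 / 2) R M k f →
      Reg 0 (R - r) (C * M) (k + 1) (Tp K r f) := by
  have hD : 0 ≤ ∑ i, L1 (pd i K) := Finset.sum_nonneg fun i _ => L1_nonneg _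
  have hS : ∀ r, 0 ≤ ∑' j, √(sc r j) := fun r => tsum_nonneg fun _ => Real.sqrt_nonneg _
  have hL := L1_nonneg K
  have hbase : ∀ (R r M : ℝ) (f : E n → ℝ), 0 < r → r ≤ 1 → 0 ≤ M →
      (∀ x ∈ Metric.ball (0 : E n) R, |f x| ≤ M) →
      Hol 0 (R - r) ((2 * L1 K + (2 * ∑ i, L1 (pd i K)) * (∑' j, √(sc 1 j))) * M) (Tp K r f) := by
    intro R r M f hr hr1 hM h
    refine (hol_zero fun x hx => abs_Tp_le hK hr h hx).mono le_rfl ?_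
    have h1 : 0 ≤ L1 K * M := by positivity
    have h2 : 0 ≤ (2 * ∑ i, L1 (pd i K)) * (∑' j, √(sc 1 j)) * M := by
      have := hS 1
      positivity
    nlinarith
  refine ⟨2 * L1 K + (2 * ∑ i, L1 (pd i K)) * (∑' j, √(sc 1 j)), ?_, fun k => ?_⟩
  · have := hS 1
    positivity
  induction k with
  | zero =>
    intro R r M f hr hr1 hM hf h
    refine ⟨hbase R r M f hr hr1 hM h.1, fun x hx => (Tp_pd_of_hol hK hr hf hM h hx).1, fun i =>
      hol_zero fun x hx => ((Tp_pd_of_hol hK hr hf hM h hx).2 i).trans ?_⟩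
    have : ∑' j, √(sc r j) ≤ ∑' j, √(sc 1 j) :=
      (summable_sqrt_sc r).tsum_le_tsum (fun j => Real.sqrt_le_sqrt (by unfold sc; gcongr))
        (summable_sqrt_sc 1)
    have := mul_le_mul_of_nonneg_left this (mul_nonneg zero_le_two hD)
    gcongr
    linarith
  | succ k ih =>
    intro R r M f hr hr1 hM hf h
    refine ⟨hbase R r M f hr hr1 hM h.hol.1, fun x hx => (Tp_pd_of_reg hK hr hf h hx).1, fun i => ?_⟩
    exact (ih R r M _ hr hr1 hM (measurable_pd i f) (h.2.2 i)).congr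
      fun x hx => ((Tp_pd_of_reg hK hr hf h hx).2 i).symm

end

section

variable {n : ℕ}

/-- The steady Navier-Stokes equations on `B_R` tested against the divergence free fields
`δ_jk ΔΨ - ∂_j ∂_k Ψ`. -/
def WeakNS (R : ℝ) (u : Fin n → E n → ℝ) : Prop :=
  ∀ k, ∀ Ψ : E n → ℝ, ContDiff ℝ ∞ Ψ → HasCompactSupport Ψ → tsupport Ψ ⊆ Metric.ball 0 R →
    ∫ x, (u k x * lap (lap Ψ) x + ∑ i, ∑ l, u i x * u l x *
      ((if l = k then pd i (lap Ψ) x else 0) - pd i (pd l (pd k Ψ)) x)) = 0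

theorem contDiff_lap {f : E n → ℝ} (hf : ContDiff ℝ ∞ f) : ContDiff ℝ ∞ (lap f) := by
  unfold lap
  exact ContDiff.sum fun i _ => contDiff_pd (contDiff_pd hf)

/-- The kernels of the Duhamel term. -/
noncomputable def KK (i l k : Fin n) : E n → ℝ := fun z =>
  (if l = k then pd i (lap pot) z else 0) - pd i (pd l (pd k pot)) z

theorem ker_KK (i l k : Fin n) : Ker (KK i l k) := by
  refine Ker.sub ?_ (((ker_pot.pd k).pd l).pd i)
  split_ifs
  · exact ker_pot.lap.pd i
  · exact ⟨contDiff_const, fun _ _ => rfl⟩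

theorem pd_rescale {f : E n → ℝ} (hf : ContDiff ℝ ∞ f) (c t : ℝ) (x : E n) (i : Fin n) :
    pd i (fun y => c * f (t⁻¹ • (x - y))) = fun y => (-t⁻¹ * c) * pd i f (t⁻¹ • (x - y)) := by
  ext y
  have h1 : HasFDerivAt (fun y : E n => t⁻¹ • (x - y)) (t⁻¹ • -ContinuousLinearMap.id ℝ (E n)) y :=
    ((hasFDerivAt_id y).const_sub x).const_smul t⁻¹
  have h2 := (((hf.differentiable (by simp) (t⁻¹ • (x - y))).hasFDerivAt.comp y h1).const_mul c)
  have h3 : HasFDerivAt (fun y => c * f (t⁻¹ • (x - y))) _ y := h2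
  simp only [pd]
  rw [h3.fderiv]
  simp
  ring

theorem lap_rescale {f : E n → ℝ} (hf : ContDiff ℝ ∞ f) (c t : ℝ) (x : E n) :
    lap (fun y => c * f (t⁻¹ • (x - y))) = fun y => (t⁻¹ ^ 2 * c) * lap f (t⁻¹ • (x - y)) := by
  ext y
  simp only [lap, pd_rescale hf, pd_rescale (contDiff_pd hf)]
  rw [← Finset.mul_sum]
  ring

theorem integrable_ker_mul {K : E n → ℝ} (hK : Ker K) {R r t : ℝ} {x : E n} {f : E n → ℝ}
    (hx : x ∈ Metric.ball (0 : E n) (R - r)) (ht : 0 < t) (htr : t ≤ r)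
    (hf : IntegrableOn f (Metric.ball 0 R)) : Integrable fun y => K (t⁻¹ • (x - y)) * f y := by
  rw [← integrableOn_iff_integrable_of_support_subset (s := Metric.ball (0 : E n) R)]
  · obtain ⟨M, _, hM⟩ := hK.bounded
    refine Integrable.bdd_mul (c := M) hf ?_ (ae_of_all _ fun y => hM _)
    exact (hK.smooth.continuous.comp (by fun_prop)).aestronglyMeasurable
  · intro y hy
    by_contra h
    refine hy ?_
    have : 1 < ‖t⁻¹ • (x - y)‖ := by
      rw [norm_smul, Real.norm_eq_abs, abs_of_pos (inv_pos.2 ht), ← div_eq_inv_mul, lt_div_iff₀ ht]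
      rw [mem_ball_zero_iff] at h hx
      have := norm_sub_norm_le y x
      rw [norm_sub_rev] at this
      linarith
    simp [hK.supp _ this]

theorem WeakNS.step {R r t : ℝ} {u : Fin n → E n → ℝ} (h : WeakNS R u)
    (hu : ∀ i, IntegrableOn (u i) (Metric.ball 0 R))
    (huu : ∀ i l, IntegrableOn (fun y => u i y * u l y) (Metric.ball 0 R)) (k : Fin n) {x : E n}
    (hx : x ∈ Metric.ball (0 : E n) (R - r)) (ht : 0 < t) (htr : t ≤ r) :
    cv phi (t / 2) (u k) x = cv phi t (u k) x +
      t * ∑ i, ∑ l, cv (KK i l k) t (fun y => u i y * u l y) x := by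
  have hpot := (ker_pot (n := n)).smooth
  have ht0 := ht.ne'
  set Ψ : E n → ℝ := fun y => 1 * pot (t⁻¹ • (x - y)) with hΨ
  have hΨs : ∀ y ∉ Metric.closedBall x t, Ψ y = 0 := by
    intro y hy
    simp only [hΨ, one_mul]
    refine ker_pot.supp _ ?_
    rw [norm_smul, Real.norm_eq_abs, abs_of_pos (inv_pos.2 ht), ← div_eq_inv_mul, lt_div_iff₀ ht,
      one_mul, norm_sub_rev]
    simpa [dist_eq_norm] using hy
  have hts : tsupport Ψ ⊆ Metric.closedBall x t :=
    closure_minimal (fun y hy => by_contra fun h' => hy (hΨs y h')) Metric.isClosed_closedBall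
  have h1 := h k Ψ (contDiff_const.mul (hpot.comp (by fun_prop)))
    (HasCompactSupport.intro (isCompact_closedBall x t) hΨs) (hts.trans fun y hy => by
      rw [mem_ball_zero_iff] at *
      rw [Metric.mem_closedBall, dist_eq_norm] at hy
      have := norm_sub_norm_le y x
      linarith)
  have hphi := (ker_phi (n := n))
  have eL : lap (lap Ψ) = fun y => t⁻¹ ^ 4 *
      (2 ^ n * phi ((t / 2)⁻¹ • (x - y)) - phi (t⁻¹ • (x - y))) := by
    rw [hΨ, lap_rescale hpot, lap_rescale (contDiff_lap hpot)]
    ext y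
    rw [lap_lap_pot, smul_smul, show 2 * t⁻¹ = (t / 2)⁻¹ by field_simp]
    ring
  have eK : ∀ i l y, ((if l = k then pd i (lap Ψ) y else 0) - pd i (pd l (pd k Ψ)) y) =
      -t⁻¹ ^ 3 * KK i l k (t⁻¹ • (x - y)) := by
    intro i l y
    rw [hΨ, lap_rescale hpot, pd_rescale (contDiff_lap hpot), pd_rescale hpot,
      pd_rescale (contDiff_pd hpot), pd_rescale (contDiff_pd (contDiff_pd hpot)), KK]
    split_ifs <;> ring
  simp only [eL, eK] at h1
  have i1 : Integrable fun y => phi (t⁻¹ • (x - y)) * u k y := integrable_ker_mul hphi hx ht htr (hu k)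
  have i2 : Integrable fun y => phi ((t / 2)⁻¹ • (x - y)) * u k y :=
    integrable_ker_mul hphi hx (by positivity) (by linarith) (hu k)
  have i3 : ∀ i l, Integrable fun y => KK i l k (t⁻¹ • (x - y)) * (u i y * u l y) := fun i l =>
    integrable_ker_mul (ker_KK i l k) hx ht htr (huu i l)
  have e3 : ∀ y, u k y * (t⁻¹ ^ 4 * (2 ^ n * phi ((t / 2)⁻¹ • (x - y)) - phi (t⁻¹ • (x - y)))) +
      ∑ i, ∑ l, u i y * u l y * (-t⁻¹ ^ 3 * KK i l k (t⁻¹ • (x - y))) =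
      t⁻¹ ^ 4 * (2 ^ n * (phi ((t / 2)⁻¹ • (x - y)) * u k y) - phi (t⁻¹ • (x - y)) * u k y) +
      -t⁻¹ ^ 3 * ∑ i, ∑ l, KK i l k (t⁻¹ • (x - y)) * (u i y * u l y) := by
    intro y
    simp only [Finset.mul_sum]
    congr 1
    · ring
    · exact Finset.sum_congr rfl fun i _ => Finset.sum_congr rfl fun l _ => by ring
  simp only [e3] at h1
  have i4 : Integrable fun y => t⁻¹ ^ 4 *
      (2 ^ n * (phi ((t / 2)⁻¹ • (x - y)) * u k y) - phi (t⁻¹ • (x - y)) * u k y) :=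
    ((i2.const_mul _).sub i1).const_mul _
  have i5 : Integrable fun y => -t⁻¹ ^ 3 *
      ∑ i, ∑ l, KK i l k (t⁻¹ • (x - y)) * (u i y * u l y) :=
    (integrable_finsetSum _ fun i _ => integrable_finsetSum _ fun l _ => i3 i l).const_mul _
  rw [integral_add i4 i5, integral_const_mul, integral_const_mul, integral_sub (i2.const_mul _) i1, integral_const_mul,
    integral_finsetSum _ (fun i _ => integrable_finsetSum _ fun l _ => i3 i l)] at h1
  simp only [integral_finsetSum _ (fun l _ => i3 _ l)] at h1
  rw [cv_eq phi (half_pos ht), cv_eq phi ht]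
  simp only [cv_eq _ ht, ← Finset.mul_sum]
  generalize ∑ i, ∑ l, ∫ a, KK i l k (t⁻¹ • (x - a)) * (u i a * u l a) = S at h1 ⊢
  generalize (∫ a, phi ((t / 2)⁻¹ • (x - a)) * u k a) = A at h1 ⊢
  generalize (∫ a, phi (t⁻¹ • (x - a)) * u k a) = B at h1 ⊢
  rw [div_pow]
  have : 2 ^ n * A - B - t * S = 0 := by
    have := congrArg (fun a => t ^ 4 * a) h1
    field_simp at this
    linarith
  field_simp
  linarith

theorem sc_zero (r : ℝ) : sc r 0 = r := by simp [sc]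

theorem sc_succ (r : ℝ) (j : ℕ) : sc r (j + 1) = sc r j / 2 := by
  simp only [sc, pow_succ]; ring

theorem WeakNS.partial_sum {R r : ℝ} {u : Fin n → E n → ℝ} (h : WeakNS R u)
    (hu : ∀ i, IntegrableOn (u i) (Metric.ball 0 R))
    (huu : ∀ i l, IntegrableOn (fun y => u i y * u l y) (Metric.ball 0 R)) (k : Fin n) {x : E n}
    (hx : x ∈ Metric.ball (0 : E n) (R - r)) (hr : 0 < r) (N : ℕ) :
    cv phi (sc r N) (u k) x = cv phi r (u k) x +
      ∑ j ∈ Finset.range N, sc r j * ∑ i, ∑ l, cv (KK i l k) (sc r j) (fun y => u i y * u l y) x := by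
  induction N with
  | zero => simp [sc_zero]
  | succ N ih =>
    rw [sc_succ, h.step hu huu k hx (sc_pos hr N) (sc_le hr N), ih, Finset.sum_range_succ]
    ring

theorem tendsto_sc (r : ℝ) : Tendsto (sc r) atTop (𝓝 0) := by
  have := (tendsto_pow_atTop_nhds_zero_of_lt_one (r := (1 / 2 : ℝ)) (by norm_num) (by norm_num)).const_mul r
  rw [mul_zero] at this
  exact this

theorem tendsto_cv {K : E n → ℝ} (hK : Ker K) {f : E n → ℝ} (hf : Measurable f) {x : E n}
    (hc : ContinuousAt f x) {r : ℝ} (hr : 0 < r) :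
    Tendsto (fun N => cv K (sc r N) f x) atTop (𝓝 ((∫ z, K z) * f x)) := by
  rw [Metric.tendsto_atTop]
  intro ε hε
  have hL := L1_nonneg K
  obtain ⟨δ, hδ, hδf⟩ := Metric.continuousAt_iff.1 hc (ε / (L1 K + 1)) (by positivity)
  obtain ⟨N, hN⟩ := Metric.tendsto_atTop.1 (tendsto_sc r) δ hδ
  refine ⟨N, fun m hm => ?_⟩
  have hp := sc_pos hr m
  have hm' := hN m hm
  rw [Real.dist_0_eq_abs, abs_of_pos hp] at hm'
  have hz : ∀ z : E n, ‖z‖ ≤ 1 → |f (x - sc r m • z) - f x| ≤ ε / (L1 K + 1) := by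
    intro z hz
    refine (hδf ?_).le
    rw [dist_eq_norm, sub_sub_cancel_left, norm_neg, norm_smul, Real.norm_eq_abs, abs_of_pos hp]
    exact lt_of_le_of_lt (mul_le_of_le_one_right hp.le hz) hm'
  have hi : Integrable fun z => K z * (f (x - sc r m • z) - f x) := by
    refine (hK.integrable.norm.mul_const (ε / (L1 K + 1))).mono' ?_ (ae_of_all _ fun z => ?_)
    · exact (hK.smooth.continuous.measurable.mul
        ((hf.comp (by fun_prop)).sub_const _)).aestronglyMeasurable
    · rcases le_or_gt ‖z‖ 1 with h1 | h1
      · rw [norm_mul]; gcongr; exact hz z h1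
      · simp [hK.supp z h1]
  have e : cv K (sc r m) f x = (∫ z, K z * (f (x - sc r m • z) - f x)) + (∫ z, K z) * f x := by
    rw [← integral_mul_const, ← integral_add hi (hK.integrable.mul_const _), cv]
    congr 1; ext z; ring
  rw [dist_eq_norm, e, add_sub_cancel_right]
  refine lt_of_le_of_lt (integral_mul_le hK hz) ?_
  rw [mul_div_assoc', div_lt_iff₀ (by positivity)]
  nlinarith

/-- The Duhamel representation of a solution on `B_R`. -/
def Rep (R : ℝ) (u : Fin n → E n → ℝ) : Prop :=
  ∀ k r, 0 < r → ∀ x ∈ Metric.ball (0 : E n) (R - r), (∫ z : E n, phi z) * u k x =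
    cv phi r (u k) x + ∑ i, ∑ l, Tp (KK i l k) r (fun y => u i y * u l y) x

theorem Rep.mono {R R' : ℝ} {u : Fin n → E n → ℝ} (h : Rep R u) (hR : R' ≤ R) : Rep R' u :=
  fun k r hr x hx => h k r hr x (Metric.ball_subset_ball (by linarith) hx)

theorem integrableOn_of_bdd {f : E n → ℝ} (hf : Measurable f) {R M : ℝ}
    (h : ∀ y ∈ Metric.ball (0 : E n) R, |f y| ≤ M) : IntegrableOn f (Metric.ball 0 R) :=
  (integrable_indicator_iff measurableSet_ball).1 (integrable_indicator_ball hf h)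

theorem WeakNS.rep_at {R M : ℝ} {u : Fin n → E n → ℝ} (h : WeakNS R u)
    (hm : ∀ j, Measurable (u j)) (hM : ∀ j, ∀ x ∈ Metric.ball (0 : E n) R, |u j x| ≤ M)
    {k : Fin n} {r : ℝ} (hr : 0 < r) {x : E n} (hx : x ∈ Metric.ball (0 : E n) (R - r))
    (hc : ContinuousAt (u k) x) : (∫ z : E n, phi z) * u k x =
      cv phi r (u k) x + ∑ i, ∑ l, Tp (KK i l k) r (fun y => u i y * u l y) x := by
  have hxR : x ∈ Metric.ball (0 : E n) R := Metric.ball_subset_ball (by linarith) hx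
  have hM0 : 0 ≤ M := (abs_nonneg _).trans (hM k x hxR)
  have hMM : ∀ i l, ∀ x ∈ Metric.ball (0 : E n) R, |u i x * u l x| ≤ M * M := fun i l x hx => by
    rw [abs_mul]; gcongr; exacts [hM i x hx, hM l x hx]
  have h1 := tendsto_cv ker_phi (hm k) hc hr
  have hs := fun i l => summable_Tp (ker_KK i l k) hr (hMM i l) hx
  have h2 : HasSum (fun j => ∑ i, ∑ l, sc r j * cv (KK i l k) (sc r j) (fun y => u i y * u l y) x)
      (∑ i, ∑ l, Tp (KK i l k) r (fun y => u i y * u l y) x) :=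
    hasSum_sum fun i _ => hasSum_sum fun l _ => (hs i l).hasSum
  have h3 := h2.tendsto_sum_nat.const_add (cv phi r (u k) x)
  refine tendsto_nhds_unique h1 (h3.congr fun N => ?_)
  rw [h.partial_sum (fun i => integrableOn_of_bdd (hm i) (hM i))
    (fun i l => integrableOn_of_bdd ((hm i).mul (hm l)) (hMM i l)) k hx hr N]
  simp only [Finset.mul_sum]

theorem WeakNS.rep {R M : ℝ} {u : Fin n → E n → ℝ} (h : WeakNS R u) (hm : ∀ j, Measurable (u j))
    (hM : ∀ j, ∀ x ∈ Metric.ball (0 : E n) R, |u j x| ≤ M)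
    (hc : ∀ j, ∀ x ∈ Metric.ball (0 : E n) R, ContinuousAt (u j) x) : Rep R u := fun k _ hr x hx =>
  h.rep_at hm hM hr hx (hc k x (Metric.ball_subset_ball (by linarith) hx))

theorem Reg.half {R M : ℝ} (hM : 0 ≤ M) {k : ℕ} {f : E n → ℝ} (h : Reg 0 R M (k + 1) f) :
    Reg (1 / 2) R ((n + 1) * M) k f := by
  have key : ∀ f : E n → ℝ, Hol 0 R M f → (∀ x ∈ Metric.ball (0 : E n) R, DifferentiableAt ℝ f x) →
      (∀ i, Hol 0 R M (pd i f)) → Hol (1 / 2) R ((n + 1) * M) f := by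
    intro f h1 h2 h3
    have hn : (0 : ℝ) ≤ n := Nat.cast_nonneg n
    refine ⟨fun x hx => (h1.1 x hx).trans (by nlinarith), fun x hx y hy => ?_⟩
    have b1 := h1.2 x hx y hy
    rw [Real.rpow_zero, mul_one] at b1
    have b2 : ‖f x - f y‖ ≤ (n * M) * ‖x - y‖ := by
      refine (convex_ball (0 : E n) R).norm_image_sub_le_of_norm_fderiv_le (𝕜 := ℝ) h2 ?_ hy hx
      intro z hz
      refine (norm_fderiv_le_sum _ _).trans ?_
      refine (Finset.sum_le_sum fun i _ => (h3 i).1 z hz).trans (by simp)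
    rw [← Real.sqrt_eq_rpow]
    have h0 : (0 : ℝ) ≤ 2 * ((n + 1) * M) := by positivity
    rw [← Real.sqrt_sq h0, ← Real.sqrt_mul (sq_nonneg _)]
    refine Real.abs_le_sqrt ?_
    rw [sq]
    have hh := norm_nonneg (x - y)
    calc (f x - f y) * (f x - f y) ≤ |f x - f y| * |f x - f y| := by
          rw [← abs_mul]; exact le_abs_self _
      _ ≤ (2 * M) * ((n * M) * ‖x - y‖) := by gcongr; exact b2
      _ ≤ (2 * ((n + 1) * M)) ^ 2 * ‖x - y‖ := by
        have : 2 * M * (n * M) ≤ (2 * ((n + 1) * M)) ^ 2 := by nlinarith [mul_nonneg hn (sq_nonneg M), sq_nonneg M, mul_nonneg (sq_nonneg (n:ℝ)) (sq_nonneg M)]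
        nlinarith
  induction k generalizing f with
  | zero => exact key f h.1 h.2.1 h.2.2
  | succ k ih =>
    exact ⟨key f h.1 h.2.1 fun i => (h.2.2 i).hol, h.2.1, fun i => ih (h.2.2 i)⟩

theorem Rep.step (hn : 4 ≤ n) (k : ℕ) {R M : ℝ} (hR : 0 < R) (hR1 : R ≤ 1) (hM : 0 ≤ M) :
    ∃ M', 0 ≤ M' ∧ ∀ u : Fin n → E n → ℝ, (∀ j, Measurable (u j)) → Rep R u →
      (∀ j, Reg 0 R M k (u j)) → ∀ j, Reg 0 (R / 2) M' (k + 1) (u j) := by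
  have hr : 0 < R / 4 := by positivity
  set c := ∫ z : E n, phi z with hc
  have hc0 : c ≠ 0 := integral_phi_ne_zero hn
  obtain ⟨C0, hC0, hcv⟩ := reg_cv (k + 1) (ker_phi (n := n)) hr
  choose C1 hC1 hT1 using fun i l j : Fin n => Tp_reg_half (ker_KK i l j)
  choose C2 hC2 hT2 using fun i l j : Fin n => Tp_reg_one (ker_KK i l j)
  set D1 := ∑ i, ∑ l, ∑ j, C1 i l j
  set D2 := ∑ i, ∑ l, ∑ j, C2 i l j
  have hle : ∀ C : Fin n → Fin n → Fin n → ℝ, (∀ i l j, 0 ≤ C i l j) →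
      ∀ i l j, C i l j ≤ ∑ i, ∑ l, ∑ j, C i l j := by
    intro C hC i l j
    refine (Finset.single_le_sum (f := fun j => C i l j) (fun j _ => hC i l j) (Finset.mem_univ j)).trans ?_
    refine (Finset.single_le_sum (f := fun l => ∑ j, C i l j)
      (fun l _ => Finset.sum_nonneg fun j _ => hC i l j) (Finset.mem_univ l)).trans ?_
    exact Finset.single_le_sum (f := fun i => ∑ l, ∑ j, C i l j) (fun i _ => Finset.sum_nonneg
      fun l _ => Finset.sum_nonneg fun j _ => hC i l j) (Finset.mem_univ i)
  have hD1 : 0 ≤ D1 := Finset.sum_nonneg fun i _ => Finset.sum_nonneg fun l _ =>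
    Finset.sum_nonneg fun j _ => hC1 i l j
  have hD2 : 0 ≤ D2 := Finset.sum_nonneg fun i _ => Finset.sum_nonneg fun l _ =>
    Finset.sum_nonneg fun j _ => hC2 i l j
  set M1 := 2 ^ (k + 1) * M * M
  have hM1 : 0 ≤ M1 := by positivity
  set M2 := |c⁻¹| * ((n + 1) * (C0 * M) + n * (n * (D1 * M1))) with hM2d
  have hM2 : 0 ≤ M2 := by positivity
  set M3 := 2 ^ (k + 1) * M2 * M2
  have hM3 : 0 ≤ M3 := by positivity
  refine ⟨|c⁻¹| * (C0 * M + n * (n * (D2 * M3))), by positivity, ?_⟩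
  intro u hm hrep hu
  have hphi : ∀ j, Reg 0 (R - R / 4) (C0 * M) (k + 1) (cv phi (R / 4) (u j)) := fun j =>
    hcv R M (u j) (hm j) hM (hu j).hol.1
  have eqn : ∀ j, ∀ x ∈ Metric.ball (0 : E n) (R - R / 4), c⁻¹ * (cv phi (R / 4) (u j) x +
      ∑ i, ∑ l, Tp (KK i l j) (R / 4) (fun y => u i y * u l y) x) = u j x := by
    intro j x hx
    rw [← hrep j (R / 4) hr x hx]
    field_simp
    rw [hc]
  have hhalf : ∀ j, Reg (1 / 2) (R - R / 4) M2 k (u j) := by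
    intro j
    have t1 : ∀ i l, Reg (1 / 2) (R - R / 4) (D1 * M1) k
        (Tp (KK i l j) (R / 4) (fun y => u i y * u l y)) := fun i l =>
      (hT1 i l j k R (R / 4) M1 _ hr (by linarith) hM1 ((hm i).mul (hm l))
        ((hu i).mul hM hM (hu l))).mono le_rfl
        (mul_le_mul_of_nonneg_right (hle C1 hC1 i l j) hM1)
    have t2 := reg_sum Finset.univ fun i _ => reg_sum Finset.univ fun l _ => t1 i l
    simp only [Finset.card_univ, Fintype.card_fin] at t2
    exact ((((hphi j).half (by positivity)).add t2).const_mul c⁻¹).congr (eqn j)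
  intro j
  have t1 : ∀ i l, Reg 0 (R / 2) (D2 * M3) (k + 1)
      (Tp (KK i l j) (R / 4) (fun y => u i y * u l y)) := fun i l =>
    (hT2 i l j k (R - R / 4) (R / 4) M3 _ hr (by linarith) hM3 ((hm i).mul (hm l))
      ((hhalf i).mul hM2 hM2 (hhalf l))).mono (by linarith)
      (mul_le_mul_of_nonneg_right (hle C2 hC2 i l j) hM3)
  have t2 := reg_sum Finset.univ fun i _ => reg_sum Finset.univ fun l _ => t1 i l
  simp only [Finset.card_univ, Fintype.card_fin] at t2
  exact ((((hphi j).mono (by linarith) le_rfl).add t2).const_mul c⁻¹).congr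
    fun x hx => eqn j x (Metric.ball_subset_ball (by linarith) hx)

/-- Interior regularity with estimates. -/
theorem Rep.reg (hn : 4 ≤ n) (k : ℕ) {R M : ℝ} (hR : 0 < R) (hR1 : R ≤ 1) (hM : 0 ≤ M) :
    ∃ M', 0 ≤ M' ∧ ∀ u : Fin n → E n → ℝ, (∀ j, Measurable (u j)) → Rep R u →
      (∀ j, ∀ x ∈ Metric.ball (0 : E n) R, |u j x| ≤ M) → ∀ j, Reg 0 (R / 2 ^ k) M' k (u j) := by
  induction k with
  | zero => exact ⟨M, hM, fun u _ _ h j => (hol_zero (h j)).mono (by simp) le_rfl⟩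
  | succ k ih =>
    obtain ⟨M1, hM1, h1⟩ := ih
    have hle : R / 2 ^ k ≤ R := div_le_self hR.le (one_le_pow₀ (by norm_num))
    obtain ⟨M2, hM2, h2⟩ := Rep.step hn k (R := R / 2 ^ k) (by positivity) (hle.trans hR1) hM1
    refine ⟨M2, hM2, fun u hm hrep h j => ?_⟩
    have := h2 u hm (hrep.mono hle) (h1 u hm hrep h) j
    rwa [div_div, ← pow_succ] at this

theorem Reg.contDiffOn {R M : ℝ} {k : ℕ} {f : E n → ℝ} (h : Reg 0 R M (k + 1) f) :
    ContDiffOn ℝ k f (Metric.ball (0 : E n) R) := by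
  induction k generalizing f with
  | zero =>
    exact contDiffOn_zero.2 fun x hx => (h.2.1 x hx).continuousAt.continuousWithinAt
  | succ k ih =>
    have : ((k + 1 : ℕ) : WithTop ℕ∞) = (k : WithTop ℕ∞) + 1 := by norm_cast
    rw [this, contDiffOn_succ_iff_fderiv_of_isOpen Metric.isOpen_ball]
    refine ⟨fun x hx => (h.2.1 x hx).differentiableWithinAt, by simp, ?_⟩
    have e : fderiv ℝ f = fun x => ∑ i, pd i f x • (EuclideanSpace.proj i : E n →L[ℝ] ℝ) := by
      ext x v
      rw [fderiv_apply_eq_sum]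
      simp [mul_comm]
    rw [e]
    exact ContDiffOn.sum fun i _ => (ih (h.2.2 i)).smul contDiffOn_const

theorem Rep.contDiffAt (hn : 4 ≤ n) {R M : ℝ} (hR : 0 < R) (hR1 : R ≤ 1) {u : Fin n → E n → ℝ}
    (hm : ∀ j, Measurable (u j)) (h : Rep R u)
    (hM : ∀ j, ∀ x ∈ Metric.ball (0 : E n) R, |u j x| ≤ M) (j : Fin n) :
    ContDiffAt ℝ ∞ (u j) 0 := by
  rw [contDiffAt_infty]
  intro k
  have hM0 : 0 ≤ M := (abs_nonneg _).trans (hM j 0 (by simpa using hR))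
  obtain ⟨M', _, h'⟩ := Rep.reg hn (k + 1) hR hR1 hM0
  exact (h' u hm h hM j).contDiffOn.contDiffAt (Metric.ball_mem_nhds _ (by positivity))

end

section

variable {n : ℕ}

/-- Smooth functions with scale-invariant bounds on `(0, ∞)`. -/
structure Sym (C : ℝ) (F : ℝ → ℝ) : Prop where
  smooth : ContDiff ℝ ∞ F
  b0 : ∀ s > 0, |F s| ≤ C
  b1 : ∀ s > 0, |s * deriv F s| ≤ C
  b2 : ∀ s > 0, |s ^ 2 * deriv (deriv F) s| ≤ C

theorem exists_sym_kap : ∃ C, 1 ≤ C ∧ ∀ c > 0, Sym C (fun s => kap (c * s)) := by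
  have d1 := contDiff_deriv contDiff_kap
  have d2 := contDiff_deriv d1
  have hz : ∀ s : ℝ, s ∉ Icc (1 : ℝ) 2 → deriv kap s = 0 := by
    intro s hs
    rw [mem_Icc, not_and_or, not_le, not_le] at hs
    rcases hs with hs | hs
    · have : kap =ᶠ[𝓝 s] fun _ => 0 := by
        filter_upwards [gt_mem_nhds hs] with y hy using kap_zero hy.le
      rw [this.deriv_eq]; simp
    · have : kap =ᶠ[𝓝 s] fun _ => 1 := by
        filter_upwards [lt_mem_nhds hs] with y hy using kap_one hy.le
      rw [this.deriv_eq]; simp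
  have hz2 : ∀ s : ℝ, s ∉ Icc (1 : ℝ) 2 → deriv (deriv kap) s = 0 := by
    intro s hs
    have : deriv kap =ᶠ[𝓝 s] fun _ => 0 := by
      filter_upwards [isClosed_Icc.isOpen_compl.mem_nhds hs] with y hy using hz y hy
    rw [this.deriv_eq]; simp
  obtain ⟨C1, h1⟩ := (HasCompactSupport.intro (f := fun s => s * deriv kap s)
    (K := Icc 1 2) isCompact_Icc
    (fun s hs => by simp [hz s hs])).exists_bound_of_continuous (continuous_id.mul d1.continuous)
  obtain ⟨C2, h2⟩ := (HasCompactSupport.intro (f := fun s => s ^ 2 * deriv (deriv kap) s)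
    (K := Icc 1 2) isCompact_Icc (fun s hs => by simp [hz2 s hs])).exists_bound_of_continuous
    ((continuous_pow 2).mul d2.continuous)
  refine ⟨1 + |C1| + |C2|, by linarith [abs_nonneg C1, abs_nonneg C2], fun c hc => ?_⟩
  have e1 : deriv (fun s => kap (c * s)) = fun s => c * deriv kap (c * s) := by
    ext s; rw [deriv_comp_mul_left]; rfl
  have e2 : deriv (deriv (fun s => kap (c * s))) = fun s => c * (c * deriv (deriv kap) (c * s)) := by
    ext s
    rw [e1, deriv_const_mul_field, deriv_comp_mul_left]; rfl
  refine ⟨contDiff_kap.comp (contDiff_const.mul contDiff_id), fun s _ => ?_, fun s _ => ?_, fun s _ => ?_⟩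
  · rw [abs_of_nonneg (kap_nonneg _)]
    linarith [abs_nonneg C1, abs_nonneg C2, kap_le_one (c * s)]
  · rw [e1]
    have := h1 (c * s)
    rw [Real.norm_eq_abs] at this
    rw [show s * (c * deriv kap (c * s)) = c * s * deriv kap (c * s) by ring]
    linarith [abs_nonneg C2, le_abs_self C1]
  · rw [e2]
    have := h2 (c * s)
    rw [Real.norm_eq_abs] at this
    rw [show s ^ 2 * (c * (c * deriv (deriv kap) (c * s))) = (c * s) ^ 2 * deriv (deriv kap) (c * s) by ring]
    linarith [abs_nonneg C1, le_abs_self C2]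

theorem pd_pd_mul {f g : E n → ℝ} (hf : ContDiff ℝ ∞ f) (hg : ContDiff ℝ ∞ g) (i j : Fin n)
    (x : E n) : pd i (pd j fun y => f y * g y) x = pd i (pd j f) x * g x + pd j f x * pd i g x +
      (pd i f x * pd j g x + f x * pd i (pd j g) x) := by
  have d : ∀ {f : E n → ℝ}, ContDiff ℝ ∞ f → ∀ x, DifferentiableAt ℝ f x := fun h x =>
    h.differentiable (by simp) x
  have e : (pd j fun y => f y * g y) = fun y => pd j f y * g y + f y * pd j g y := by
    ext y; exact pd_mul (d hf y) (d hg y)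
  rw [e, pd_add (f := fun y => pd j f y * g y) (g := fun y => f y * pd j g y)
    ((d (contDiff_pd hf) x).mul (d hg x)) ((d hf x).mul (d (contDiff_pd hg) x)),
    pd_mul (d (contDiff_pd hf) x) (d hg x), pd_mul (d hf x) (d (contDiff_pd hg) x)]

theorem Sym.abs_pd {C : ℝ} {F : ℝ → ℝ} (h : Sym C F) (i : Fin n) {x : E n} (hx : x ≠ 0) :
    |pd i (fun y => F (‖y‖ ^ 2)) x| ≤ 2 * C / ‖x‖ := by
  have hp : 0 < ‖x‖ := norm_pos_iff.2 hx
  rw [pd_radial' h.smooth, le_div_iff₀ hp]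
  have h1 := h.b1 (‖x‖ ^ 2) (by positivity)
  rw [abs_mul, abs_of_pos (by positivity : 0 < ‖x‖ ^ 2)] at h1
  have h2 : |x i| ≤ ‖x‖ := by simpa using PiLp.norm_apply_le x i
  rw [abs_mul, abs_mul, abs_two]
  have h3 := mul_le_mul_of_nonneg_right h2 (mul_nonneg (abs_nonneg (deriv F (‖x‖ ^ 2))) hp.le)
  nlinarith

theorem Sym.abs_pd_pd {C : ℝ} {F : ℝ → ℝ} (h : Sym C F) (i : Fin n) {x : E n} (hx : x ≠ 0) :
    |pd i (pd i (fun y => F (‖y‖ ^ 2))) x| ≤ 6 * C / ‖x‖ ^ 2 := by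
  have hp : 0 < ‖x‖ := norm_pos_iff.2 hx
  rw [pd_pd_radial h.smooth, le_div_iff₀ (by positivity), if_pos rfl]
  have h1 := h.b1 (‖x‖ ^ 2) (by positivity)
  have h2 := h.b2 (‖x‖ ^ 2) (by positivity)
  rw [abs_mul, abs_of_pos (by positivity)] at h1 h2
  have h3 : |x i| ≤ ‖x‖ := by simpa using PiLp.norm_apply_le x i
  have h4 : x i * x i ≤ ‖x‖ ^ 2 := by rw [← abs_mul_abs_self, sq]; gcongr
  have h5 := mul_le_mul_of_nonneg_right h4 (mul_nonneg (abs_nonneg (deriv (deriv F) (‖x‖ ^ 2))) (sq_nonneg ‖x‖))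
  refine (mul_le_mul_of_nonneg_right (abs_add_le _ _) (by positivity)).trans ?_
  rw [abs_mul, abs_two, mul_assoc 4, abs_mul, abs_of_nonneg (by nlinarith [mul_self_nonneg (x i)] : 0 ≤ 4 * (x i * x i))]
  nlinarith

theorem cut_bounds {C B : ℝ} {F : ℝ → ℝ} (h : Sym C F) (hC : 1 ≤ C) {f : E n → ℝ}
    (hf : ContDiff ℝ ∞ f) {x : E n} (hx : x ≠ 0) (hx1 : ‖x‖ ≤ 1) (h0 : |f x| ≤ B)
    (h1 : ∀ i, |pd i f x| ≤ B) (h2 : ∀ i, |pd i (pd i f) x| ≤ B) :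
    (∀ i, |pd i (fun y => F (‖y‖ ^ 2) * f y) x| ≤ 3 * C * B / ‖x‖) ∧
    |lap (fun y => F (‖y‖ ^ 2) * f y) x| ≤ n * (11 * C * B) / ‖x‖ ^ 2 := by
  have hp : 0 < ‖x‖ := norm_pos_iff.2 hx
  have hB : 0 ≤ B := (abs_nonneg _).trans h0
  have hF : ContDiff ℝ ∞ fun y : E n => F (‖y‖ ^ 2) := contDiff_radial h.smooth
  have hF0 := h.b0 (‖x‖ ^ 2) (by positivity)
  have a1 : (1 : ℝ) ≤ 1 / ‖x‖ := by rwa [le_div_iff₀ hp, one_mul]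
  have a2 : 1 / ‖x‖ ≤ 1 / ‖x‖ ^ 2 := by
    rw [div_le_div_iff_of_pos_left one_pos hp (by positivity)]; nlinarith
  constructor
  · intro i
    rw [pd_mul (hF.differentiable (by simp) x) (hf.differentiable (by simp) x)]
    calc _ ≤ (2 * C / ‖x‖) * B + C * B := by
          refine (abs_add_le _ _).trans ?_
          rw [abs_mul, abs_mul]
          gcongr
          exacts [h.abs_pd i hx, h1 i]
      _ ≤ (2 * C / ‖x‖) * B + C * B * (1 / ‖x‖) := by
          exact add_le_add le_rfl (le_mul_of_one_le_right (by positivity) a1)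
      _ = _ := by ring
  · rw [lap]
    refine (Finset.abs_sum_le_sum_abs _ _).trans ((Finset.sum_le_sum (g := fun _ => 11 * C * B / ‖x‖ ^ 2)
      fun i _ => ?_).trans_eq (by simp; ring))
    rw [pd_pd_mul hF hf]
    calc _ ≤ (6 * C / ‖x‖ ^ 2) * B + (2 * C / ‖x‖) * B + ((2 * C / ‖x‖) * B + C * B) := by
          refine (abs_add_le _ _).trans (add_le_add ((abs_add_le _ _).trans (add_le_add ?_ ?_))
            ((abs_add_le _ _).trans (add_le_add ?_ ?_)))
          all_goals rw [abs_mul]; gcongr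
          exacts [h.abs_pd_pd i hx, h.abs_pd i hx, h1 i, h.abs_pd i hx, h1 i, h2 i]
      _ = 6 * (C * B) * (1 / ‖x‖ ^ 2) + 4 * (C * B) * (1 / ‖x‖) + C * B * 1 := by ring
      _ ≤ 6 * (C * B) * (1 / ‖x‖ ^ 2) + 4 * (C * B) * (1 / ‖x‖ ^ 2) + C * B * (1 / ‖x‖ ^ 2) := by
          gcongr; exact a1.trans a2
      _ = _ := by ring

theorem integrableOn_rpow_norm (hn : 0 < n) {a : ℝ} (ha : a < n) (R : ℝ) :
    IntegrableOn (fun x : E n => ‖x‖ ^ (-a)) (Metric.ball 0 R) := by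
  have : Nonempty (Fin n) := ⟨⟨0, hn⟩⟩
  rw [integrableOn_fun_norm_addHaar volume (f := fun r => r ^ (-a)), finrank_euclideanSpace_fin]
  have h1 : IntegrableOn (fun r : ℝ => r ^ ((n : ℝ) - 1 - a)) (Ioo 0 R) := by
    rcases le_or_gt R 0 with h | h
    · simp [Ioo_eq_empty_of_le h]
    · have := intervalIntegral.intervalIntegrable_rpow' (a := 0) (b := R) (r := (n : ℝ) - 1 - a)
        (by linarith)
      rw [intervalIntegrable_iff_integrableOn_Ioo_of_le h.le] at this
      exact this
  refine h1.congr_fun (fun r hr => ?_) measurableSet_Ioo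
  have hr0 : 0 < r := hr.1
  simp only [smul_eq_mul]
  rw [← Real.rpow_natCast, ← Real.rpow_add hr0, Nat.cast_sub hn, Nat.cast_one]
  congr 1

theorem ae_ne_zero (hn : 0 < n) : ∀ᵐ x : E n, x ≠ 0 := by
  have : Nonempty (Fin n) := ⟨⟨0, hn⟩⟩
  have : NullSingletonClass (volume : Measure (E n)) := inferInstance
  exact compl_mem_ae_iff.2 (measure_singleton _)

theorem integral_eq_zero_of_dom (hn : 4 ≤ n) {G : E n → ℝ} {F : ℕ → E n → ℝ}
    (hF : ∀ N, Measurable (F N)) (hF0 : ∀ N, ∫ x, F N x = 0) {R D : ℝ}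
    (hb : ∀ N x, x ≠ 0 → x ∈ Metric.ball (0 : E n) R → |F N x| ≤ D / ‖x‖ ^ 3)
    (hb0 : ∀ N x, x ∉ Metric.ball (0 : E n) R → F N x = 0)
    (hl : ∀ x, x ≠ 0 → ∀ᶠ N in atTop, F N x = G x) : ∫ x, G x = 0 := by
  have hi : IntegrableOn (fun x : E n => D / ‖x‖ ^ 3) (Metric.ball 0 R) := by
    have h4 : (4 : ℝ) ≤ n := by exact_mod_cast hn
    refine ((integrableOn_rpow_norm (by omega) (a := 3) (by linarith) R).const_mul D).congr
      (ae_of_all _ fun x => ?_)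
    simp only
    rw [Real.rpow_neg (norm_nonneg _), div_eq_mul_inv]
    norm_cast
  have := tendsto_integral_of_dominated_convergence
    (bound := (Metric.ball (0 : E n) R).indicator fun x => D / ‖x‖ ^ 3) (F := F) (f := G)
    (μ := volume) (fun N => (hF N).aestronglyMeasurable)
    ((integrable_indicator_iff measurableSet_ball).2 hi)
    (fun N => (ae_ne_zero (by omega)).mono fun x hx => ?_)
    ((ae_ne_zero (by omega)).mono fun x hx => tendsto_const_nhds.congr' ((hl x hx).mono fun N h => h.symm))
  · simp only [hF0] at this
    exact (tendsto_nhds_unique this tendsto_const_nhds)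
  · by_cases hxR : x ∈ Metric.ball (0 : E n) R
    · rw [indicator_of_mem hxR]; exact hb N x hx hxR
    · rw [hb0 N x hxR]; simp [hxR]

end

section

variable {n : ℕ}

/-- Cutoff vanishing near the origin. -/
noncomputable def hole (N : ℕ) (x : E n) : ℝ := kap (((N : ℝ) + 1) * ‖x‖ ^ 2)

theorem contDiff_hole (N : ℕ) : ContDiff ℝ ∞ (hole (n := n) N) :=
  contDiff_radial (F := fun s => kap (((N : ℝ) + 1) * s))
    (contDiff_kap.comp (contDiff_const.mul contDiff_id))

theorem hole_eventually {x : E n} (hx : x ≠ 0) : ∀ᶠ N in atTop, hole N =ᶠ[𝓝 x] fun _ => 1 := by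
  have hp : 0 < ‖x‖ ^ 2 := by have := norm_pos_iff.2 hx; positivity
  obtain ⟨N0, hN0⟩ := exists_nat_gt (2 / ‖x‖ ^ 2)
  filter_upwards [eventually_ge_atTop N0] with N hN
  rw [div_lt_iff₀ hp] at hN0
  have : 2 < ((N : ℝ) + 1) * ‖x‖ ^ 2 := by
    have : (N0 : ℝ) ≤ N := by exact_mod_cast hN
    nlinarith
  have hc : ContinuousAt (fun y : E n => ((N : ℝ) + 1) * ‖y‖ ^ 2) x := by fun_prop
  filter_upwards [hc (lt_mem_nhds this)] with y hy using kap_one (le_of_lt hy)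

theorem hole_support (N : ℕ) {f : E n → ℝ} {R : ℝ} (hc : HasCompactSupport f)
    (hs : tsupport f ⊆ Metric.ball 0 R) : ∃ S : Set (E n), IsCompact S ∧
      S ⊆ Metric.ball 0 R \ {0} ∧ ∀ x ∉ S, hole N x * f x = 0 := by
  have hN : (0 : ℝ) < N + 1 := by positivity
  refine ⟨tsupport f ∩ {x | 1 ≤ ((N : ℝ) + 1) * ‖x‖ ^ 2}, hc.isCompact.inter_right ?_, ?_, ?_⟩
  · exact isClosed_le continuous_const (by fun_prop)
  · rintro x ⟨h1, h2⟩
    refine ⟨hs h1, fun h => ?_⟩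
    rw [mem_singleton_iff.1 h] at h2
    norm_num at h2
  · intro x hx
    by_cases h1 : x ∈ tsupport f
    · have : ¬ (1 ≤ ((N : ℝ) + 1) * ‖x‖ ^ 2) := fun h2 => hx ⟨h1, h2⟩
      rw [hole, kap_zero (by linarith), zero_mul]
    · rw [image_eq_zero_of_notMem_tsupport h1, mul_zero]

theorem hole_pd {f : E n → ℝ} {x : E n} (N : ℕ) (h : hole N =ᶠ[𝓝 x] fun _ => 1) :
    (fun y => hole N y * f y) =ᶠ[𝓝 x] f := by
  filter_upwards [h] with y hy
  rw [hy, one_mul]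

theorem lap_congr {f g : E n → ℝ} {x : E n} (h : f =ᶠ[𝓝 x] g) : lap f x = lap g x := by
  simp only [lap]
  refine Finset.sum_congr rfl fun i _ => pd_congr ?_
  exact h.eventuallyEq_nhds.mono fun y hy => pd_congr hy

theorem exists_bound_pd {f : E n → ℝ} (hf : ContDiff ℝ ∞ f) (hc : HasCompactSupport f) :
    ∃ B, 0 ≤ B ∧ ∀ x, |f x| ≤ B ∧ (∀ i, |pd i f x| ≤ B) ∧ ∀ i, |pd i (pd i f) x| ≤ B := by
  obtain ⟨B0, h0⟩ := hc.exists_bound_of_continuous hf.continuous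
  choose B1 h1 using fun i => (hasCompactSupport_pd (i := i) hc).exists_bound_of_continuous
    (contDiff_pd hf).continuous
  choose B2 h2 using fun i => (hasCompactSupport_pd (i := i)
    (hasCompactSupport_pd (i := i) hc)).exists_bound_of_continuous (contDiff_pd (contDiff_pd hf)).continuous
  have p0 : 0 ≤ B0 := (norm_nonneg _).trans (h0 0)
  have p1 : ∀ i, 0 ≤ B1 i := fun i => (norm_nonneg _).trans (h1 i 0)
  have p2 : ∀ i, 0 ≤ B2 i := fun i => (norm_nonneg _).trans (h2 i 0)
  have s1 := Finset.sum_nonneg fun i (_ : i ∈ Finset.univ) => p1 i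
  have s2 := Finset.sum_nonneg fun i (_ : i ∈ Finset.univ) => p2 i
  refine ⟨B0 + ∑ i, B1 i + ∑ i, B2 i, by positivity, fun x => ⟨?_, fun i => ?_, fun i => ?_⟩⟩
  · have := h0 x; rw [Real.norm_eq_abs] at this; linarith
  · have := h1 i x; rw [Real.norm_eq_abs] at this
    linarith [Finset.single_le_sum (f := B1) (fun i _ => p1 i) (Finset.mem_univ i)]
  · have := h2 i x; rw [Real.norm_eq_abs] at this
    linarith [Finset.single_le_sum (f := B2) (fun i _ => p2 i) (Finset.mem_univ i)]

theorem pd_zero_of_notMem {f : E n → ℝ} {x : E n} (hx : x ∉ tsupport f) (i : Fin n) :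
    pd i f x = 0 :=
  image_eq_zero_of_notMem_tsupport fun h => hx (tsupport_pd i f h)

theorem tsupport_mul_subset {f g : E n → ℝ} : tsupport (fun y => f y * g y) ⊆ tsupport g :=
  closure_mono (fun x hx h => hx (by simp only [h, mul_zero]))

variable {R A : ℝ} {u : Fin n → E n → ℝ} {p : E n → ℝ}

theorem NS.weak_div_ball (h : NS (Metric.ball 0 R \ {0}) u p) (hn : 4 ≤ n) (hR : R ≤ 1)
    (hu : ∀ j, ∀ x ∈ Metric.ball (0 : E n) R \ {0}, |u j x| ≤ A / ‖x‖) {f : E n → ℝ}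
    (hf : ContDiff ℝ ∞ f) (hc : HasCompactSupport f) (hs : tsupport f ⊆ Metric.ball 0 R) :
    ∫ x, ∑ i, u i x * pd i f x = 0 := by
  obtain ⟨C, hC, hk⟩ := exists_sym_kap
  obtain ⟨B, hB, hfB⟩ := exists_bound_pd hf hc
  refine integral_eq_zero_of_dom hn (F := fun N x => ∑ i, u i x * pd i (fun y => hole N y * f y) x)
    (D := n * (A * (3 * C * B))) (R := R) (fun N => ?_) (fun N => ?_) (fun N x hx hxR => ?_)
    (fun N x hxR => ?_) (fun x hx => ?_)
  · exact Finset.measurable_sum _ fun i _ => (h.meas_u i).mul (measurable_pd _ _)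
  · obtain ⟨S, hS, hSU, hS0⟩ := hole_support N hc hs
    exact h.weak_div ((contDiff_hole N).mul hf).contDiffOn hS hSU hS0
  · have hp : 0 < ‖x‖ := norm_pos_iff.2 hx
    have hx1 : ‖x‖ ≤ 1 := by rw [mem_ball_zero_iff] at hxR; linarith
    have hb := (cut_bounds (hk (N + 1) (by positivity)) hC hf hx hx1 (hfB x).1 (hfB x).2.1 (hfB x).2.2).1
    have hA : 0 ≤ A / ‖x‖ := (abs_nonneg _).trans (hu ⟨0, by omega⟩ x ⟨hxR, hx⟩)
    have hA : 0 ≤ A := by have := mul_nonneg hA hp.le; rwa [div_mul_cancel₀ _ hp.ne'] at this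
    calc |∑ i, u i x * pd i (fun y => hole N y * f y) x| ≤ ∑ i : Fin n, A / ‖x‖ * (3 * C * B / ‖x‖) := by
          refine (Finset.abs_sum_le_sum_abs _ _).trans (Finset.sum_le_sum fun i _ => ?_)
          rw [abs_mul]
          exact mul_le_mul (hu i x ⟨hxR, hx⟩) (hb i) (abs_nonneg _) (by positivity)
      _ = n * (A * (3 * C * B)) / ‖x‖ ^ 2 := by simp; field_simp
      _ ≤ _ := by
        refine div_le_div_of_nonneg_left (by positivity) (by positivity) ?_
        exact pow_le_pow_of_le_one hp.le hx1 (by norm_num)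
  · refine Finset.sum_eq_zero fun i _ => ?_
    rw [pd_zero_of_notMem (fun h => hxR (hs (tsupport_mul_subset h))), mul_zero]
  · filter_upwards [hole_eventually hx] with N hN
    exact Finset.sum_congr rfl fun i _ => by rw [pd_congr (hole_pd N hN)]

theorem NS.weak_mom_ball (h : NS (Metric.ball 0 R \ {0}) u p) (hn : 4 ≤ n) (hR : R ≤ 1)
    (hu : ∀ j, ∀ x ∈ Metric.ball (0 : E n) R \ {0}, |u j x| ≤ A / ‖x‖)
    (hpb : ∀ x ∈ Metric.ball (0 : E n) R \ {0}, |p x| ≤ A / ‖x‖ ^ 2) {ψ : Fin n → E n → ℝ}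
    (hψ : ∀ j, ContDiff ℝ ∞ (ψ j)) (hc : ∀ j, HasCompactSupport (ψ j))
    (hs : ∀ j, tsupport (ψ j) ⊆ Metric.ball 0 R) :
    ∫ x, ((∑ j, u j x * lap (ψ j) x) + (∑ i, ∑ j, u i x * u j x * pd i (ψ j) x)
      + p x * ∑ i, pd i (ψ i) x) = 0 := by
  obtain ⟨C, hC, hk⟩ := exists_sym_kap
  choose B' hB' hfB' using fun j => exists_bound_pd (hψ j) (hc j)
  set B := ∑ j, B' j
  have hB : 0 ≤ B := Finset.sum_nonneg fun i _ => hB' i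
  have hBj : ∀ j, B' j ≤ B := fun j => Finset.single_le_sum (fun i _ => hB' i) (Finset.mem_univ j)
  refine integral_eq_zero_of_dom hn (F := fun N x =>
    (∑ j, u j x * lap (fun y => hole N y * ψ j y) x) +
    (∑ i, ∑ j, u i x * u j x * pd i (fun y => hole N y * ψ j y) x)
      + p x * ∑ i, pd i (fun y => hole N y * ψ i y) x)
    (D := n * (A * (n * (11 * C * B))) + n * (n * (A * A * (3 * C * B))) + A * (n * (3 * C * B)))
    (R := R) (fun N => ?_) (fun N => ?_) (fun N x hx hxR => ?_)
    (fun N x hxR => ?_) (fun x hx => ?_)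
  · refine ((Finset.measurable_sum _ fun i _ => (h.meas_u i).mul ?_).add
      (Finset.measurable_sum _ fun i _ => Finset.measurable_sum _ fun j _ =>
        ((h.meas_u i).mul (h.meas_u j)).mul (measurable_pd _ _))).add
      (h.meas_p.mul (Finset.measurable_sum _ fun i _ => measurable_pd _ _))
    exact Finset.measurable_sum _ fun i _ => measurable_pd _ _
  · choose S hS hSU hS0 using fun j => hole_support N (hc j) (hs j)
    refine h.weak_mom (S := ⋃ j, S j) (fun j => ((contDiff_hole N).mul (hψ j)).contDiffOn)
      (isCompact_iUnion hS) (iUnion_subset hSU) fun j x hx => hS0 j x fun hh => hx (mem_iUnion.2 ⟨j, hh⟩)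
  · have hp : 0 < ‖x‖ := norm_pos_iff.2 hx
    have hx1 : ‖x‖ ≤ 1 := by rw [mem_ball_zero_iff] at hxR; linarith
    have hb := fun j => cut_bounds (hk (N + 1) (by positivity)) hC (hψ j) hx hx1
      ((hfB' j x).1.trans (hBj j)) (fun i => ((hfB' j x).2.1 i).trans (hBj j))
      (fun i => ((hfB' j x).2.2 i).trans (hBj j))
    have hA : 0 ≤ A / ‖x‖ := (abs_nonneg _).trans (hu ⟨0, by omega⟩ x ⟨hxR, hx⟩)
    have hA : 0 ≤ A := by have := mul_nonneg hA hp.le; rwa [div_mul_cancel₀ _ hp.ne'] at this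
    have hux := fun j => hu j x ⟨hxR, hx⟩
    calc _ ≤ (∑ _j : Fin n, A / ‖x‖ * (n * (11 * C * B) / ‖x‖ ^ 2)) +
          (∑ _i : Fin n, ∑ _j : Fin n, (A / ‖x‖) * (A / ‖x‖) * (3 * C * B / ‖x‖)) +
          A / ‖x‖ ^ 2 * ∑ _i : Fin n, 3 * C * B / ‖x‖ := by
          refine (abs_add_le _ _).trans (add_le_add ((abs_add_le _ _).trans (add_le_add ?_ ?_)) ?_)
          · refine (Finset.abs_sum_le_sum_abs _ _).trans (Finset.sum_le_sum fun i _ => ?_)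
            rw [abs_mul]
            exact mul_le_mul (hux i) (hb i).2 (abs_nonneg _) (by positivity)
          · refine (Finset.abs_sum_le_sum_abs _ _).trans (Finset.sum_le_sum fun i _ => ?_)
            refine (Finset.abs_sum_le_sum_abs _ _).trans (Finset.sum_le_sum fun j _ => ?_)
            rw [abs_mul, abs_mul]
            exact mul_le_mul (mul_le_mul (hux i) (hux j) (abs_nonneg _) (by positivity))
              ((hb j).1 i) (abs_nonneg _) (by positivity)
          · rw [abs_mul]
            refine mul_le_mul (hpb x ⟨hxR, hx⟩) ?_ (abs_nonneg _) (by positivity)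
            exact (Finset.abs_sum_le_sum_abs _ _).trans (Finset.sum_le_sum fun i _ => (hb i).1 i)
      _ = _ := by simp; field_simp
  · have hz : ∀ j, x ∉ tsupport fun y => hole N y * ψ j y :=
      fun j h => hxR (hs j (tsupport_mul_subset h))
    have hz2 : ∀ j, lap (fun y => hole N y * ψ j y) x = 0 := fun j => by
      refine Finset.sum_eq_zero fun i _ => ?_
      exact pd_zero_of_notMem (fun h => hz j (tsupport_pd _ _ h)) i
    simp [hz2, pd_zero_of_notMem (hz _)]
  · filter_upwards [hole_eventually hx] with N hN
    simp only [lap_congr (hole_pd N hN), pd_congr (hole_pd N hN)]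

theorem tsupport_lap (f : E n → ℝ) : tsupport (lap f) ⊆ tsupport f := by
  refine closure_minimal (fun x hx => by_contra fun h => hx ?_) (isClosed_tsupport _)
  exact Finset.sum_eq_zero fun i _ => pd_zero_of_notMem (fun h' => h (tsupport_pd _ _ h')) i

theorem lap_pd {f : E n → ℝ} (hf : ContDiff ℝ ∞ f) (j : Fin n) : lap (pd j f) = pd j (lap f) := by
  ext x
  have e : lap f = fun y => ∑ i, pd i (pd i f) y := rfl
  rw [e, lap, pd_sum fun i _ => (contDiff_pd (contDiff_pd hf)).differentiable (by simp) x]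
  refine Finset.sum_congr rfl fun i _ => ?_
  have : pd i (pd j f) = pd j (pd i f) := by ext y; exact pd_comm hf.contDiffAt i j
  rw [this, pd_comm (contDiff_pd hf).contDiffAt]

theorem lap_sub {f g : E n → ℝ} (hf : ContDiff ℝ ∞ f) (hg : ContDiff ℝ ∞ g) (x : E n) :
    lap (fun y => f y - g y) x = lap f x - lap g x := by
  simp only [lap, ← Finset.sum_sub_distrib]
  refine Finset.sum_congr rfl fun i _ => ?_
  have : (pd i fun y => f y - g y) = fun y => pd i f y - pd i g y := by
    ext y; exact pd_sub (hf.differentiable (by simp) y) (hg.differentiable (by simp) y)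
  rw [this]
  exact pd_sub ((contDiff_pd hf).differentiable (by simp) x) ((contDiff_pd hg).differentiable (by simp) x)

theorem integrable_u_mul (hn : 4 ≤ n) {v f : E n → ℝ} (hv : Measurable v)
    (hu : ∀ x ∈ Metric.ball (0 : E n) R \ {0}, |v x| ≤ A / ‖x‖)
    (hf : ContDiff ℝ ∞ f) (hc : HasCompactSupport f) (hs : tsupport f ⊆ Metric.ball 0 R) :
    Integrable fun x => v x * f x := by
  obtain ⟨B, hB⟩ := hc.exists_bound_of_continuous hf.continuous
  have h4 : (4 : ℝ) ≤ n := by exact_mod_cast hn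
  have hi := (integrableOn_rpow_norm (n := n) (by omega) (a := 1) (by linarith) R).const_mul (A * B)
  refine ((integrable_indicator_iff measurableSet_ball).2 hi).mono'
    (hv.mul hf.continuous.measurable).aestronglyMeasurable
    ((ae_ne_zero (by omega)).mono fun x hx => ?_)
  by_cases hxR : x ∈ Metric.ball (0 : E n) R
  · rw [indicator_of_mem hxR, norm_mul, Real.rpow_neg_one]
    calc _ ≤ A / ‖x‖ * B :=
          mul_le_mul (hu x ⟨hxR, hx⟩) (hB x) (norm_nonneg _) ((abs_nonneg _).trans (hu x ⟨hxR, hx⟩))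
      _ = _ := by ring
  · rw [image_eq_zero_of_notMem_tsupport (fun h => hxR (hs h))]
    simp [hxR]

theorem NS.weakNS (h : NS (Metric.ball 0 R \ {0}) u p) (hn : 4 ≤ n) (hR : R ≤ 1)
    (hu : ∀ j, ∀ x ∈ Metric.ball (0 : E n) R \ {0}, |u j x| ≤ A / ‖x‖)
    (hpb : ∀ x ∈ Metric.ball (0 : E n) R \ {0}, |p x| ≤ A / ‖x‖ ^ 2) : WeakNS R u := by
  intro k Ψ hΨ hc hs
  have hl := contDiff_lap hΨ
  have hcl : HasCompactSupport (lap Ψ) := hc.of_isClosed_subset (isClosed_tsupport _) (tsupport_lap Ψ)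
  have hsl := (tsupport_lap Ψ).trans hs
  set ψ : Fin n → E n → ℝ := fun j x => (if j = k then lap Ψ x else 0) - pd j (pd k Ψ) x with hψd
  have c1 : ∀ j, ContDiff ℝ ∞ fun x => if j = k then lap Ψ x else 0 := fun j => by
    split_ifs
    exacts [hl, contDiff_const]
  have hψ : ∀ j, ContDiff ℝ ∞ (ψ j) := fun j => (c1 j).sub (contDiff_pd (contDiff_pd hΨ))
  have ht : ∀ j, tsupport (ψ j) ⊆ tsupport Ψ := fun j => by
    refine closure_minimal (fun x hx => by_contra fun h => hx ?_) (isClosed_tsupport _)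
    simp only [hψd]
    rw [pd_zero_of_notMem fun h' => h (tsupport_pd _ _ h'),
      image_eq_zero_of_notMem_tsupport fun h' => h (tsupport_lap _ h')]
    simp
  have e1 : ∀ j x, lap (ψ j) x = (if j = k then lap (lap Ψ) x else 0) - pd j (pd k (lap Ψ)) x := by
    intro j x
    rw [lap_sub (c1 j) (contDiff_pd (contDiff_pd hΨ)), lap_pd (contDiff_pd hΨ), lap_pd hΨ]
    congr 1
    split_ifs
    · rfl
    · have : ∀ i, (pd i fun _ : E n => (0 : ℝ)) = fun _ => 0 := fun i => by ext y; exact pd_const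
      simp [lap, this]
  have e2 : ∀ i j x, pd i (ψ j) x =
      (if j = k then pd i (lap Ψ) x else 0) - pd i (pd j (pd k Ψ)) x := by
    intro i j x
    rw [pd_sub ((c1 j).differentiable (by simp) x)
      ((contDiff_pd (contDiff_pd hΨ)).differentiable (by simp) x)]
    congr 1
    split_ifs
    · rfl
    · exact pd_const
  have e3 : ∀ x, ∑ i, pd i (ψ i) x = 0 := by
    intro x
    simp only [e2, Finset.sum_sub_distrib]
    have := congrFun (lap_pd hΨ k) x
    rw [lap] at this
    rw [this]
    simp
  have m1 := h.weak_mom_ball hn hR hu hpb hψ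
    (fun j => hc.of_isClosed_subset (isClosed_tsupport _) (ht j)) fun j => (ht j).trans hs
  have m2 := h.weak_div_ball hn hR hu (contDiff_pd hl) (hasCompactSupport_pd (i := k) hcl)
    ((tsupport_pd _ _).trans hsl)
  have i2 : Integrable fun x => ∑ i, u i x * pd i (pd k (lap Ψ)) x :=
    integrable_finsetSum _ fun i _ => integrable_u_mul hn (h.meas_u i) (hu i)
      (contDiff_pd (contDiff_pd hl)) (hasCompactSupport_pd (hasCompactSupport_pd hcl))
      ((tsupport_pd _ _).trans ((tsupport_pd _ _).trans hsl))
  have key : ∀ x, (u k x * lap (lap Ψ) x + ∑ i, ∑ l, u i x * u l x *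
      ((if l = k then pd i (lap Ψ) x else 0) - pd i (pd l (pd k Ψ)) x)) =
      ((∑ j, u j x * lap (ψ j) x) + (∑ i, ∑ j, u i x * u j x * pd i (ψ j) x)
      + p x * ∑ i, pd i (ψ i) x) + ∑ i, u i x * pd i (pd k (lap Ψ)) x := by
    intro x
    rw [e3]
    simp only [e1, e2, mul_sub, Finset.sum_sub_distrib]
    simp
    ring
  simp only [key]
  by_cases hi : Integrable fun x => ((∑ j, u j x * lap (ψ j) x) +
      (∑ i, ∑ j, u i x * u j x * pd i (ψ j) x) + p x * ∑ i, pd i (ψ i) x)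
  · rw [integral_add hi i2, m1, m2, add_zero]
  · refine integral_undef fun h' => hi ?_
    have := h'.sub i2
    refine this.congr (ae_of_all _ fun x => ?_)
    simp

end

section

variable {n : ℕ}

theorem radial_bound {f : E n → ℝ} {G G' : ℝ → ℝ} {r0 : ℝ} {x : E n} (hx : x ≠ 0)
    (hr : ‖x‖ ≤ r0) (hd : ∀ y, ‖x‖ ≤ ‖y‖ → ‖y‖ ≤ r0 → DifferentiableAt ℝ f y ∧
      ‖fderiv ℝ f y‖ ≤ -G' ‖y‖) (hG : ∀ s ∈ Icc ‖x‖ r0, HasDerivAt G (G' s) s) :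
    |f x| ≤ |f ((r0 / ‖x‖) • x)| + (G ‖x‖ - G r0) := by
  have hp : 0 < ‖x‖ := norm_pos_iff.2 hx
  set e := ‖x‖⁻¹ • x with he
  have he1 : ‖e‖ = 1 := by rw [he, norm_smul, norm_inv, norm_norm, inv_mul_cancel₀ hp.ne']
  have hn : ∀ s ∈ Icc ‖x‖ r0, ‖s • e‖ = s := fun s hs => by
    rw [norm_smul, he1, mul_one, Real.norm_eq_abs, abs_of_pos (hp.trans_le hs.1)]
  have hg : ∀ s ∈ Icc ‖x‖ r0, HasDerivAt (fun s : ℝ => f (s • e)) (fderiv ℝ f (s • e) e) s ∧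
      |fderiv ℝ f (s • e) e| ≤ -G' s := by
    intro s hs
    have h1 := hd (s • e) (by rw [hn s hs]; exact hs.1) (by rw [hn s hs]; exact hs.2)
    refine ⟨?_, ?_⟩
    · have h2 : HasDerivAt (fun s : ℝ => s • e) e s := by
        simpa using (hasDerivAt_id s).smul_const e
      exact h1.1.hasFDerivAt.comp_hasDerivAt s h2
    · rw [hn s hs] at h1
      have := (fderiv ℝ f (s • e)).le_opNorm e
      rw [he1, mul_one] at this
      exact this.trans h1.2
  have key : ∀ c : ℝ, |c| = 1 → AntitoneOn (fun s => G s + c * f (s • e)) (Icc ‖x‖ r0) := by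
    intro c hc
    have hder : ∀ s ∈ Icc ‖x‖ r0, HasDerivAt (fun s => G s + c * f (s • e))
        (G' s + c * fderiv ℝ f (s • e) e) s := fun s hs => (hG s hs).add ((hg s hs).1.const_mul c)
    refine antitoneOn_of_deriv_nonpos (convex_Icc _ _)
      (fun s hs => (hder s hs).continuousAt.continuousWithinAt)
      (fun s hs => (hder s (interior_subset hs)).differentiableAt.differentiableWithinAt) fun s hs => ?_
    rw [(hder s (interior_subset hs)).deriv]
    have := (hg s (interior_subset hs)).2
    have h2 : c * fderiv ℝ f (s • e) e ≤ |fderiv ℝ f (s • e) e| := by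
      refine (le_abs_self _).trans ?_
      rw [abs_mul, hc, one_mul]
    linarith
  have q1 : ‖x‖ • e = x := by rw [he, smul_smul, mul_inv_cancel₀ hp.ne', one_smul]
  have q2 : r0 • e = (r0 / ‖x‖) • x := by rw [he, smul_smul, div_eq_mul_inv]
  have h1 := key 1 (by simp) (left_mem_Icc.2 hr) (right_mem_Icc.2 hr) hr
  have h2 := key (-1) (by simp) (left_mem_Icc.2 hr) (right_mem_Icc.2 hr) hr
  simp only [q1, q2] at h1 h2
  rw [abs_le]
  constructor
  · linarith [neg_abs_le (f ((r0 / ‖x‖) • x))]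
  · linarith [le_abs_self (f ((r0 / ‖x‖) • x))]

theorem pd_affine (c t : ℝ) (x : E n) (f : E n → ℝ) (i : Fin n) :
    pd i (fun y => c * f (x + t • y)) = fun y => c * t * pd i f (x + t • y) := by
  ext y
  simp only [pd]
  have e : (fun y => c * f (x + t • y)) = c • (fun y => (fun z => f (x + z)) (t • y)) := rfl
  rw [e, fderiv_const_smul_field]
  have := fderiv_comp_smul (𝕜 := ℝ) (f := fun z => f (x + z)) (x := y) t
  simp only [Pi.smul_apply]
  rw [this, fderiv_comp_add_left]
  simp [mul_assoc]

theorem NS.mono {U V : Set (E n)} {u : Fin n → E n → ℝ} {p : E n → ℝ} (h : NS U u p)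
    (hV : IsOpen V) (hVU : V ⊆ U) : NS V u p :=
  ⟨hV, fun j => (h.smooth_u j).mono hVU, h.smooth_p.mono hVU, h.meas_u, h.meas_p,
    fun x hx => h.mom x (hVU hx), fun x hx => h.div x (hVU hx)⟩

theorem NS.rescale {U V : Set (E n)} {u : Fin n → E n → ℝ} {p : E n → ℝ} (h : NS U u p)
    (hV : IsOpen V) (x : E n) (t : ℝ) (hVU : ∀ y ∈ V, x + t • y ∈ U) :
    NS V (fun j y => t * u j (x + t • y)) (fun y => t ^ 2 * p (x + t • y)) := by
  have hs : ContDiff ℝ ∞ fun y : E n => x + t • y := by fun_prop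
  have hm : Measurable fun y : E n => x + t • y := by fun_prop
  refine ⟨hV, fun j => ?_, ?_, fun j => ((h.meas_u j).comp hm).const_mul t,
    (h.meas_p.comp hm).const_mul _, fun y hy j => ?_, fun y hy => ?_⟩
  · exact contDiffOn_const.mul ((h.smooth_u j).comp hs.contDiffOn hVU)
  · exact contDiffOn_const.mul (h.smooth_p.comp hs.contDiffOn hVU)
  · have := h.mom _ (hVU y hy) j
    simp only [pd_affine]
    have h3 := congrArg (fun a => t ^ 3 * a) this
    simp only [mul_add, mul_neg, Finset.mul_sum, mul_zero] at h3
    rw [← h3]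
    congr 1
    · congr 1
      · rw [neg_inj]; exact Finset.sum_congr rfl fun i _ => by ring
      · exact Finset.sum_congr rfl fun i _ => by ring
  · have := h.div _ (hVU y hy)
    simp only [pd_affine]
    rw [← Finset.mul_sum, this, mul_zero]

/-- Scaled interior estimates for solutions of size `A/|x|`. -/
theorem NS.interior {u : Fin n → E n → ℝ} {p : E n → ℝ} (h : NS (Metric.ball 0 1 \ {0}) u p)
    (hn : 4 ≤ n) {A : ℝ} (hu : ∀ j, ∀ x ∈ Metric.ball (0 : E n) 1 \ {0}, |u j x| ≤ A / ‖x‖) :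
    ∃ D, 0 ≤ D ∧ ∀ x : E n, x ≠ 0 → ‖x‖ < 1 / 2 → ∀ i j, |pd i (u j) x| ≤ D / ‖x‖ ^ 2 ∧
      ∀ l, |pd l (pd i (u j)) x| ≤ D / ‖x‖ ^ 3 := by
  have hA : 0 ≤ |A| := abs_nonneg A
  obtain ⟨M, hM, hreg⟩ := Rep.reg (n := n) hn 3 (R := 1) one_pos le_rfl hA
  refine ⟨8 * M, by positivity, fun x hx hx2 i j => ?_⟩
  have hp : 0 < ‖x‖ := norm_pos_iff.2 hx
  set t := ‖x‖ / 2 with ht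
  have ht0 : 0 < t := by positivity
  have hin : ∀ y : E n, ‖y‖ ≤ 1 → t ≤ ‖x + t • y‖ ∧ ‖x + t • y‖ < 1 := by
    intro y hy
    have h1 : ‖t • y‖ ≤ t := by
      rw [norm_smul, Real.norm_eq_abs, abs_of_pos ht0]; exact mul_le_of_le_one_right ht0.le hy
    have h2 := norm_add_le x (t • y)
    have h3 := norm_sub_norm_le x (-(t • y))
    rw [sub_neg_eq_add, norm_neg] at h3
    constructor <;> linarith
  have hU : ∀ y : E n, ‖y‖ ≤ 1 → x + t • y ∈ Metric.ball (0 : E n) 1 \ {0} := fun y hy =>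
    ⟨mem_ball_zero_iff.2 (hin y hy).2, fun h0 => by
      have := (hin y hy).1
      rw [mem_singleton_iff.1 h0, norm_zero] at this
      linarith⟩
  have hb : ∀ y ∈ Metric.ball (0 : E n) 1, ‖y‖ ≤ 1 := fun y hy => (mem_ball_zero_iff.1 hy).le
  have hw := h.rescale (V := Metric.ball 0 1) Metric.isOpen_ball x t fun y hy => hU y (hb y hy)
  set w : Fin n → E n → ℝ := fun j y => t * u j (x + t • y) with hwd
  have hwA : ∀ j, ∀ y ∈ Metric.ball (0 : E n) 1, |w j y| ≤ |A| := by
    intro j y hy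
    have h1 := hu j _ (hU y (hb y hy))
    have h2 := (hin y (hb y hy)).1
    rw [hwd, abs_mul, abs_of_pos ht0]
    calc t * |u j (x + t • y)| ≤ t * (|A| / t) := by
          refine mul_le_mul_of_nonneg_left (h1.trans ?_) ht0.le
          exact (div_le_div_of_nonneg_right (le_abs_self A) (norm_nonneg _)).trans
            (div_le_div_of_nonneg_left hA ht0 h2)
      _ = |A| := by field_simp
  obtain ⟨Q, hQ⟩ := (isCompact_closedBall (0 : E n) 1).exists_bound_of_continuousOn
    (f := fun y => t ^ 2 * p (x + t • y)) (by
      refine continuousOn_const.mul (h.smooth_p.continuousOn.comp (by fun_prop) fun y hy => ?_)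
      exact hU y (mem_closedBall_zero_iff.1 hy))
  have hmx : 0 ≤ max |A| Q := hA.trans (le_max_left _ _)
  have hweak : WeakNS 1 w := by
    refine (hw.mono (Metric.isOpen_ball.sdiff isClosed_singleton) sdiff_subset).weakNS
      (A := max |A| Q) hn le_rfl (fun j y hy => ?_) fun y hy => ?_
    · have h1 : 0 < ‖y‖ := norm_pos_iff.2 hy.2
      rw [le_div_iff₀ h1]
      exact (mul_le_of_le_one_right (abs_nonneg _) (hb y hy.1)).trans
        ((hwA j y hy.1).trans (le_max_left _ _))
    · have h1 : 0 < ‖y‖ := norm_pos_iff.2 hy.2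
      rw [le_div_iff₀ (by positivity)]
      exact (mul_le_of_le_one_right (abs_nonneg _) (pow_le_one₀ h1.le (hb y hy.1))).trans
        ((hQ y (mem_closedBall_zero_iff.2 (hb y hy.1))).trans (le_max_right _ _))
  have hrep : Rep 1 w := hweak.rep hw.meas_u hwA fun j y hy => (hw.contDiffAt_u hy j).continuousAt
  have hr := hreg w hw.meas_u hrep hwA j
  have h0 : (0 : E n) ∈ Metric.ball (0 : E n) (1 / 2 ^ 3) := Metric.mem_ball_self (by norm_num)
  have r1 := (hr.2.2 i).hol.1 0 h0
  have r2 := fun l => ((hr.2.2 i).2.2 l).hol.1 0 h0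
  simp only [hwd, pd_affine, smul_zero, add_zero] at r1 r2
  constructor
  · rw [le_div_iff₀ (by positivity)]
    rw [abs_mul, abs_of_pos (by positivity : 0 < t * t), ht] at r1
    nlinarith
  · intro l
    have := r2 l
    rw [le_div_iff₀ (by positivity)]
    rw [abs_mul, abs_of_pos (by positivity : 0 < t * t * t), ht] at this
    nlinarith

end

section

variable {n : ℕ}

/-- A solution on the punctured ball of radius `1/4` with all scale-invariant bounds. -/
structure Sing (A : ℝ) (u : Fin n → E n → ℝ) (p : E n → ℝ) : Prop where
  ns : NS (Metric.ball 0 (1 / 4) \ {0}) u p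
  nonneg : 0 ≤ A
  bu : ∀ j, ∀ x ∈ Metric.ball (0 : E n) (1 / 4) \ {0}, |u j x| ≤ A / ‖x‖
  bdu : ∀ i j, ∀ x ∈ Metric.ball (0 : E n) (1 / 4) \ {0}, |pd i (u j) x| ≤ A / ‖x‖ ^ 2
  bddu : ∀ l i j, ∀ x ∈ Metric.ball (0 : E n) (1 / 4) \ {0}, |pd l (pd i (u j)) x| ≤ A / ‖x‖ ^ 3
  bp : ∀ x ∈ Metric.ball (0 : E n) (1 / 4) \ {0}, |p x| ≤ A / ‖x‖ ^ 2

theorem NS.pressure {u : Fin n → E n → ℝ} {p : E n → ℝ} (h : NS (Metric.ball 0 1 \ {0}) u p)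
    {A D : ℝ} (hA : 0 ≤ A) (hD : 0 ≤ D)
    (hu : ∀ j, ∀ x ∈ Metric.ball (0 : E n) 1 \ {0}, |u j x| ≤ A / ‖x‖)
    (hdu : ∀ x : E n, x ≠ 0 → ‖x‖ < 1 / 2 → ∀ i j, |pd i (u j) x| ≤ D / ‖x‖ ^ 2 ∧
      ∀ l, |pd l (pd i (u j)) x| ≤ D / ‖x‖ ^ 3) :
    ∃ Q, 0 ≤ Q ∧ ∀ x : E n, x ≠ 0 → ‖x‖ ≤ 1 / 4 → |p x| ≤ Q / ‖x‖ ^ 2 := by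
  have hU : ∀ x : E n, x ≠ 0 → ‖x‖ < 1 → x ∈ Metric.ball (0 : E n) 1 \ {0} := fun x hx h1 =>
    ⟨mem_ball_zero_iff.2 h1, hx⟩
  set K := n * (n * D + n * (A * D)) with hK
  have hK0 : 0 ≤ K := by positivity
  have hdp : ∀ x : E n, x ≠ 0 → ‖x‖ < 1 / 2 → ‖fderiv ℝ p x‖ ≤ K / ‖x‖ ^ 3 := by
    intro x hx h2
    have hp : 0 < ‖x‖ := norm_pos_iff.2 hx
    have hxU := hU x hx (by linarith)
    refine (norm_fderiv_le_sum _ _).trans ((Finset.sum_le_sum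
      (g := fun _ => (n * D + n * (A * D)) / ‖x‖ ^ 3) fun j _ => ?_).trans_eq (by simp [hK]; ring))
    have e : pd j p x = (∑ i, pd i (pd i (u j)) x) + -∑ i, u i x * pd i (u j) x := by
      have := h.mom x hxU j
      linarith
    rw [e]
    calc _ ≤ (∑ _i : Fin n, D / ‖x‖ ^ 3) + ∑ _i : Fin n, A / ‖x‖ * (D / ‖x‖ ^ 2) := by
          refine (abs_add_le _ _).trans (add_le_add ?_ ?_)
          · exact (Finset.abs_sum_le_sum_abs _ _).trans (Finset.sum_le_sum fun i _ =>
              (hdu x hx h2 i j).2 i)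
          · rw [abs_neg]
            refine (Finset.abs_sum_le_sum_abs _ _).trans (Finset.sum_le_sum fun i _ => ?_)
            rw [abs_mul]
            exact mul_le_mul (hu i x hxU) (hdu x hx h2 i j).1 (abs_nonneg _) (by positivity)
      _ = _ := by simp; field_simp
  obtain ⟨P, hP⟩ := (isCompact_sphere (0 : E n) (1 / 4)).exists_bound_of_continuousOn
    (h.smooth_p.continuousOn.mono fun x hx => by
      have := mem_sphere_zero_iff_norm.1 hx
      exact hU x (fun h0 => by rw [h0, norm_zero] at this; norm_num at this) (by rw [this]; norm_num))
  refine ⟨|P| + K / 2, by positivity, fun x hx h4 => ?_⟩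
  have hp : 0 < ‖x‖ := norm_pos_iff.2 hx
  have := radial_bound (f := p) (G := fun s => K / 2 * s ^ (-2 : ℤ))
    (G' := fun s => K / 2 * (((-2 : ℤ) : ℝ) * s ^ ((-2 : ℤ) - 1))) (r0 := 1 / 4) hx h4 (fun y h1 h2 => ?_)
    fun s hs => (hasDerivAt_zpow (-2) s (Or.inl (hp.trans_le hs.1).ne')).const_mul _
  · have hs : (1 / 4 / ‖x‖) • x ∈ Metric.sphere (0 : E n) (1 / 4) := by
      rw [mem_sphere_zero_iff_norm, norm_smul, Real.norm_eq_abs, abs_of_pos (by positivity)]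
      field_simp
    have h1 := (hP _ hs).trans (le_abs_self P)
    rw [Real.norm_eq_abs] at h1
    have h3 : (0 : ℝ) ≤ K / 2 * (1 / 4) ^ (-2 : ℤ) := by positivity
    have h5 : |P| ≤ |P| / ‖x‖ ^ 2 := by
      rw [le_div_iff₀ (by positivity)]
      exact mul_le_of_le_one_right (abs_nonneg _) (pow_le_one₀ hp.le (by linarith))
    have h6 : K / 2 * ‖x‖ ^ (-2 : ℤ) = K / 2 / ‖x‖ ^ 2 := by
      rw [zpow_neg, div_eq_mul_inv]; norm_cast
    simp only [h6] at this
    rw [add_div]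
    linarith
  · have hy : 0 < ‖y‖ := hp.trans_le h1
    refine ⟨h.diff_p (hU y (norm_pos_iff.1 hy) (by linarith)),
      (hdp y (norm_pos_iff.1 hy) (by linarith)).trans_eq ?_⟩
    rw [show (-2 : ℤ) - 1 = -3 by norm_num, zpow_neg]
    norm_cast
    push_cast
    rw [div_eq_mul_inv]
    ring

theorem NS.sing (hn : 4 ≤ n) {u : Fin n → E n → ℝ} {p : E n → ℝ}
    (h : NS (Metric.ball 0 1 \ {0}) u p) {A : ℝ} (hA : 0 ≤ A)
    (hu : ∀ j, ∀ x ∈ Metric.ball (0 : E n) 1 \ {0}, |u j x| ≤ A / ‖x‖) : ∃ K, Sing K u p := by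
  obtain ⟨D, hD, hdu⟩ := h.interior hn hu
  obtain ⟨Q, hQ, hp⟩ := h.pressure hA hD hu hdu
  have hsub : Metric.ball (0 : E n) (1 / 4) \ {0} ⊆ Metric.ball 0 1 \ {0} :=
    sdiff_subset_sdiff_left (Metric.ball_subset_ball (by norm_num))
  refine ⟨A + D + Q, h.mono (Metric.isOpen_ball.sdiff isClosed_singleton) hsub, by positivity,
    fun j x hx => (hu j x (hsub hx)).trans ?_, fun i j x hx => (hdu x hx.2 ?_ i j).1.trans ?_,
    fun l i j x hx => ((hdu x hx.2 ?_ i j).2 l).trans ?_, fun x hx => (hp x hx.2 ?_).trans ?_⟩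
  all_goals first
    | (gcongr; linarith)
    | (have := mem_ball_zero_iff.1 hx.1; linarith)

end

section

variable {n : ℕ}

theorem Sym.mul {C D : ℝ} {F G : ℝ → ℝ} (hF : Sym C F) (hG : Sym D G) :
    Sym (4 * (C * D)) (fun s => F s * G s) := by
  have dF : ∀ s, DifferentiableAt ℝ F s := fun s => hF.smooth.differentiable (by simp) s
  have dG : ∀ s, DifferentiableAt ℝ G s := fun s => hG.smooth.differentiable (by simp) s
  have dF' : ∀ s, DifferentiableAt ℝ (deriv F) s := fun s =>
    (contDiff_deriv hF.smooth).differentiable (by simp) s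
  have dG' : ∀ s, DifferentiableAt ℝ (deriv G) s := fun s =>
    (contDiff_deriv hG.smooth).differentiable (by simp) s
  have e1 : deriv (fun s => F s * G s) = fun s => deriv F s * G s + F s * deriv G s := by
    ext s; exact deriv_fun_mul (dF s) (dG s)
  have e2 : ∀ s, deriv (deriv fun s => F s * G s) s =
      deriv (deriv F) s * G s + 2 * (deriv F s * deriv G s) + F s * deriv (deriv G) s := by
    intro s
    rw [e1, deriv_fun_add (f := fun s => deriv F s * G s) (g := fun s => F s * deriv G s)
      ((dF' s).mul (dG s)) ((dF s).mul (dG' s)), deriv_fun_mul (dF' s) (dG s),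
      deriv_fun_mul (dF s) (dG' s)]
    ring
  have hC : 0 ≤ C := (abs_nonneg _).trans (hF.b0 1 one_pos)
  have hD : 0 ≤ D := (abs_nonneg _).trans (hG.b0 1 one_pos)
  have key : ∀ {a b : ℝ}, |a| ≤ C → |b| ≤ D → |a * b| ≤ C * D := fun h1 h2 => by
    rw [abs_mul]; exact mul_le_mul h1 h2 (abs_nonneg _) hC
  have hCD : 0 ≤ C * D := mul_nonneg hC hD
  refine ⟨hF.smooth.mul hG.smooth, fun s hs => ?_, fun s hs => ?_, fun s hs => ?_⟩
  · linarith [key (hF.b0 s hs) (hG.b0 s hs)]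
  · have h1 := key (hF.b1 s hs) (hG.b0 s hs)
    have h2 := key (hF.b0 s hs) (hG.b1 s hs)
    rw [e1, show s * (deriv F s * G s + F s * deriv G s) =
      s * deriv F s * G s + F s * (s * deriv G s) by ring]
    linarith [abs_add_le (s * deriv F s * G s) (F s * (s * deriv G s))]
  · have h1 := key (hF.b2 s hs) (hG.b0 s hs)
    have h2 := key (hF.b1 s hs) (hG.b1 s hs)
    have h3 := key (hF.b0 s hs) (hG.b2 s hs)
    rw [e2, show s ^ 2 * (deriv (deriv F) s * G s + 2 * (deriv F s * deriv G s) +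
      F s * deriv (deriv G) s) = s ^ 2 * deriv (deriv F) s * G s + 2 * (s * deriv F s *
      (s * deriv G s)) + F s * (s ^ 2 * deriv (deriv G) s) by ring]
    have a1 := abs_add_le (s ^ 2 * deriv (deriv F) s * G s + 2 * (s * deriv F s *
      (s * deriv G s))) (F s * (s ^ 2 * deriv (deriv G) s))
    have a2 := abs_add_le (s ^ 2 * deriv (deriv F) s * G s) (2 * (s * deriv F s *
      (s * deriv G s)))
    rw [abs_mul 2, abs_two] at a2
    linarith

theorem Sym.one_sub {C : ℝ} {F : ℝ → ℝ} (hF : Sym C F) : Sym (1 + C) (fun s => 1 - F s) := by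
  have e1 : deriv (fun s => 1 - F s) = fun s => - deriv F s := by
    ext s; rw [deriv_const_sub]
  refine ⟨contDiff_const.sub hF.smooth, fun s hs => ?_, fun s hs => ?_, fun s hs => ?_⟩
  · have := abs_sub (1 : ℝ) (F s)
    rw [abs_one] at this
    linarith [hF.b0 s hs]
  · rw [e1, mul_neg, abs_neg]; linarith [hF.b1 s hs]
  · rw [e1, deriv.fun_neg, mul_neg, abs_neg]; linarith [hF.b2 s hs]

/-- The cutoff to an annulus, in the squared radius. -/
noncomputable def cut (c s : ℝ) : ℝ := kap (c * s) * (1 - kap (64 * s))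

theorem contDiff_cut (c : ℝ) : ContDiff ℝ ∞ (cut c) :=
  (contDiff_kap.comp (contDiff_const.mul contDiff_id)).mul
    (contDiff_const.sub (contDiff_kap.comp (contDiff_const.mul contDiff_id)))

theorem cut_nonneg (c s : ℝ) : 0 ≤ cut c s :=
  mul_nonneg (kap_nonneg _) (by linarith [kap_le_one (64 * s)])

theorem cut_le_one (c s : ℝ) : cut c s ≤ 1 :=
  mul_le_one₀ (kap_le_one _) (by linarith [kap_le_one (64 * s)]) (by linarith [kap_nonneg (64 * s)])

theorem cut_lo {c s : ℝ} (h : c * s ≤ 1) : cut c s = 0 := by rw [cut, kap_zero h, zero_mul]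

theorem cut_hi {c s : ℝ} (h : 2 ≤ 64 * s) : cut c s = 0 := by rw [cut, kap_one h, sub_self, mul_zero]

theorem cut_one {c s : ℝ} (h : 2 ≤ c * s) (h' : 64 * s ≤ 1) : cut c s = 1 := by
  rw [cut, kap_one h, kap_zero h', sub_zero, one_mul]

theorem cut_mono {c d s : ℝ} (hs : 0 ≤ s) (h : 2 * c ≤ d) : cut c s ≤ cut d s := by
  refine mul_le_mul_of_nonneg_right ?_ (by linarith [kap_le_one (64 * s)])
  rcases le_total (c * s) 1 with h1 | h1
  · rw [kap_zero h1]; exact kap_nonneg _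
  · rw [kap_one (by nlinarith : 2 ≤ d * s)]; exact kap_le_one _

theorem exists_sym_cut : ∃ C, 1 ≤ C ∧ ∀ c > 0, Sym C (cut c) := by
  obtain ⟨C, hC, h⟩ := exists_sym_kap
  exact ⟨4 * (C * (1 + C)), by nlinarith, fun c hc => (h c hc).mul (h 64 (by norm_num)).one_sub⟩

/-- The transition regions of the cutoff. -/
def ring (c : ℝ) : Set ℝ := {s | 1 ≤ c * s ∧ c * s ≤ 2}

theorem cut_locally_const {c s : ℝ} (h1 : s ∉ ring c) (h2 : s ∉ ring 64) :
    ∃ a, cut c =ᶠ[𝓝 s] fun _ => a := by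
  simp only [ring, mem_ofPred_eq, not_and_or, not_le] at h1 h2
  have c1 : ContinuousAt (fun s => c * s) s := by fun_prop
  have c2 : ContinuousAt (fun s : ℝ => 64 * s) s := by fun_prop
  rcases h1 with h1 | h1
  · exact ⟨0, (c1.eventually (gt_mem_nhds h1)).mono fun y hy => cut_lo (le_of_lt hy)⟩
  rcases h2 with h2 | h2
  · refine ⟨1, ?_⟩
    filter_upwards [c1.eventually (lt_mem_nhds h1), c2.eventually (gt_mem_nhds h2)] with y hy hy'
    exact cut_one (le_of_lt hy) (le_of_lt hy')
  · exact ⟨0, (c2.eventually (lt_mem_nhds h2)).mono fun y hy => cut_hi (le_of_lt hy)⟩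

theorem deriv_cut {c s : ℝ} (h1 : s ∉ ring c) (h2 : s ∉ ring 64) :
    deriv (cut c) s = 0 ∧ deriv (deriv (cut c)) s = 0 := by
  obtain ⟨a, h⟩ := cut_locally_const h1 h2
  constructor
  · rw [h.deriv_eq]; simp
  · rw [h.deriv.deriv_eq]; simp

/-- The punctured ball on which the analysis takes place. -/
abbrev PB (n : ℕ) : Set (E n) := Metric.ball 0 (1 / 4) \ {0}

theorem isOpen_PB : IsOpen (PB n) := Metric.isOpen_ball.sdiff isClosed_singleton

/-- The support of the cutoff. -/
def ann (n : ℕ) (c : ℝ) : Set (E n) := {x | 1 ≤ c * ‖x‖ ^ 2 ∧ 64 * ‖x‖ ^ 2 ≤ 2}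

theorem ann_subset (c : ℝ) : ann n c ⊆ PB n := by
  rintro x ⟨h1, h2⟩
  refine ⟨?_, fun h => ?_⟩
  · rw [mem_ball_zero_iff]
    nlinarith [norm_nonneg x]
  · rw [mem_singleton_iff.1 h] at h1
    norm_num at h1

theorem isCompact_ann (c : ℝ) : IsCompact (ann n c) := by
  have hc : IsClosed ({x : E n | 1 ≤ c * ‖x‖ ^ 2} ∩ {x : E n | 64 * ‖x‖ ^ 2 ≤ 2}) :=
    (isClosed_le continuous_const (by fun_prop)).inter (isClosed_le (by fun_prop) continuous_const)
  refine Metric.isCompact_of_isClosed_isBounded hc ?_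
  exact Metric.isBounded_ball.subset ((ann_subset c).trans sdiff_subset)

theorem cut_off {c : ℝ} {x : E n} (hx : x ∉ ann n c) : cut c (‖x‖ ^ 2) = 0 := by
  simp only [ann, mem_ofPred_eq, not_and_or, not_le] at hx
  rcases hx with h | h
  · exact cut_lo h.le
  · exact cut_hi h.le

theorem integrable_of_continuousOn {U S : Set (E n)} (hS : IsCompact S) (hSU : S ⊆ U) {f : E n → ℝ}
    (hf : ContinuousOn f U) (h0 : ∀ x ∉ S, f x = 0) : Integrable f := by
  rw [← integrableOn_iff_integrable_of_support_subset (s := S)]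
  · exact (hf.mono hSU).integrableOn_compact hS
  · intro x hx; by_contra h; exact hx (h0 x h)

/-- The critical weight on the transition regions. -/
noncomputable def critWeight (c : ℝ) (x : E n) : ℝ :=
  {x : E n | ‖x‖ ^ 2 ∈ ring c}.indicator (fun x => (‖x‖ ^ n)⁻¹) x

theorem critWeight_bound : ∃ K, ∀ c > 0, Integrable (critWeight (n := n) c) ∧ ∫ x : E n, critWeight c x ≤ K := by
  refine ⟨√2 ^ n * (volume (Metric.closedBall (0 : E n) 1)).toReal, fun c hc => ?_⟩
  set s : Set (E n) := {x : E n | ‖x‖ ^ 2 ∈ ring c}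
  have hs : IsClosed ({x : E n | 1 ≤ c * ‖x‖ ^ 2} ∩ {x : E n | c * ‖x‖ ^ 2 ≤ 2}) :=
    (isClosed_le continuous_const (by fun_prop)).inter (isClosed_le (by fun_prop) continuous_const)
  replace hs : IsClosed s := hs
  have hsc : 0 < √c := Real.sqrt_pos.2 hc
  have hsb : s ⊆ Metric.closedBall 0 (√2 / √c) := by
    rintro x ⟨_, h⟩
    rw [mem_closedBall_zero_iff, le_div_iff₀ hsc]
    refine Real.le_sqrt_of_sq_le ?_
    rw [mul_pow, Real.sq_sqrt hc.le]; linarith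
  have hfin : volume (Metric.closedBall (0 : E n) (√2 / √c)) < ⊤ := measure_closedBall_lt_top
  have hsf : volume s < ⊤ := (measure_mono hsb).trans_lt hfin
  have hb : ∀ x ∈ s, ‖(‖x‖ ^ n)⁻¹‖ ≤ √c ^ n := by
    rintro x ⟨h, _⟩
    have hx : 0 < ‖x‖ := by
      rw [norm_pos_iff]; rintro rfl; norm_num at h
    have : 1 ≤ √c * ‖x‖ := by
      rw [← Real.sqrt_one, ← Real.sqrt_sq hx.le, ← Real.sqrt_mul hc.le]
      exact Real.sqrt_le_sqrt h
    rw [Real.norm_of_nonneg (by positivity), inv_le_iff_one_le_mul₀ (by positivity), ← mul_pow]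
    exact one_le_pow₀ this
  constructor
  · unfold critWeight
    refine (integrable_indicator_iff hs.measurableSet).2 ?_
    refine Measure.integrableOn_of_bounded (M := √c ^ n) hsf.ne ?_ ?_
    · exact ((measurable_norm.pow_const n).inv).aestronglyMeasurable
    · exact (ae_restrict_mem hs.measurableSet).mono fun x hx => hb x hx
  · unfold critWeight
    rw [integral_indicator hs.measurableSet]
    refine (le_abs_self _).trans ((norm_setIntegral_le_of_norm_le_const hsf hb).trans ?_)
    have : volume.real s ≤ volume.real (Metric.closedBall (0 : E n) (√2 / √c)) :=
      measureReal_mono hsb hfin.ne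
    refine (mul_le_mul_of_nonneg_left this (by positivity)).trans_eq ?_
    rw [Measure.real, Measure.addHaar_closedBall' _ _ (by positivity), ENNReal.toReal_mul,
      ENNReal.toReal_ofReal (by positivity), finrank_euclideanSpace_fin, div_pow]
    field_simp

theorem head_bound {A : ℝ} {u : Fin n → E n → ℝ} {p : E n → ℝ} (h : Sing A u p) {x : E n}
    (hx : x ∈ PB n) : |head u p x| ≤ (n * A ^ 2 + A) / ‖x‖ ^ 2 := by
  have hp : 0 < ‖x‖ := norm_pos_iff.2 hx.2
  have h1 : ∑ j, u j x * u j x ≤ ∑ _j : Fin n, (A / ‖x‖) ^ 2 := Finset.sum_le_sum fun j _ => by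
    rw [← abs_mul_abs_self, ← sq]
    exact pow_le_pow_left₀ (abs_nonneg _) (h.bu j x hx) 2
  simp only [Finset.sum_const, Finset.card_univ, Fintype.card_fin, nsmul_eq_mul] at h1
  have h0 : 0 ≤ ∑ j, u j x * u j x := Finset.sum_nonneg fun j _ => mul_self_nonneg _
  rw [head]
  refine (abs_add_le _ _).trans ?_
  have h2 := h.bp x hx
  rw [abs_of_nonneg (by positivity)]
  rw [div_pow] at h1
  rw [add_div, mul_div_assoc]
  linarith

end

section

variable {n : ℕ}

theorem pd_comp {g : ℝ → ℝ} {g' : ℝ} {f : E n → ℝ} {x : E n} (hg : HasDerivAt g g' (f x))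
    (hf : DifferentiableAt ℝ f x) (i : Fin n) : pd i (fun y => g (f y)) x = g' * pd i f x := by
  have := (hg.comp_hasFDerivAt x hf.hasFDerivAt).fderiv
  rw [pd, show (fun y => g (f y)) = g ∘ f from rfl, this]
  rfl

/-- A smooth convex regularization of the positive part. -/
noncomputable def sp (s : ℝ) : ℝ := ∫ t in (0 : ℝ)..s, expNegInvGlue t

theorem expNegInvGlue_le_one (t : ℝ) : expNegInvGlue t ≤ 1 := by
  rw [expNegInvGlue]
  split_ifs with h
  · exact zero_le_one
  · exact Real.exp_le_one_iff.2 (by simpa using (not_le.1 h).le)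

theorem hasDerivAt_sp (s : ℝ) : HasDerivAt sp (expNegInvGlue s) s := by
  have hc : Continuous expNegInvGlue := (expNegInvGlue.contDiff (n := 0)).continuous
  exact intervalIntegral.integral_hasDerivAt_right (hc.intervalIntegrable _ _)
    (hc.stronglyMeasurableAtFilter _ _) hc.continuousAt

theorem contDiff_sp : ContDiff ℝ ∞ sp := by
  rw [contDiff_infty_iff_deriv]
  refine ⟨fun s => (hasDerivAt_sp s).differentiableAt, ?_⟩
  rw [show deriv sp = expNegInvGlue from funext fun s => (hasDerivAt_sp s).deriv]
  exact expNegInvGlue.contDiff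

theorem sp_of_nonpos {s : ℝ} (hs : s ≤ 0) : sp s = 0 := by
  rw [sp, intervalIntegral.integral_symm, neg_eq_zero]
  refine intervalIntegral.integral_zero_ae (ae_of_all _ fun t ht => ?_)
  rw [uIoc_of_le hs] at ht
  exact expNegInvGlue.zero_of_nonpos ht.2

theorem monotone_sp : Monotone sp :=
  monotone_of_deriv_nonneg (fun s => (hasDerivAt_sp s).differentiableAt) fun s => by
    rw [(hasDerivAt_sp s).deriv]; exact expNegInvGlue.nonneg s

theorem sp_nonneg (s : ℝ) : 0 ≤ sp s := by
  rcases le_total s 0 with h | h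
  · rw [sp_of_nonpos h]
  · rw [← sp_of_nonpos le_rfl]; exact monotone_sp h

theorem sp_le_abs (s : ℝ) : sp s ≤ |s| := by
  rcases le_total s 0 with h | h
  · rw [sp_of_nonpos h]; exact abs_nonneg s
  · have := intervalIntegral.norm_integral_le_of_norm_le_const (a := 0) (b := s) (C := 1)
      (f := expNegInvGlue) fun t _ => by
        rw [Real.norm_of_nonneg (expNegInvGlue.nonneg t)]; exact expNegInvGlue_le_one t
    rw [sub_zero, one_mul] at this
    exact (le_abs_self _).trans this

theorem sp_pos {s : ℝ} (hs : 0 < s) : 0 < sp s := by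
  have hc : Continuous expNegInvGlue := (expNegInvGlue.contDiff (n := 0)).continuous
  exact intervalIntegral.intervalIntegral_pos_of_pos_on (hc.intervalIntegrable _ _)
    (fun t ht => expNegInvGlue.pos_of_pos ht.1) hs

theorem deriv_expNegInvGlue_nonneg (s : ℝ) : 0 ≤ deriv expNegInvGlue s ∧
    (0 < s → 0 < deriv expNegInvGlue s) := by
  have hpos : 0 < s → 0 < deriv expNegInvGlue s := fun hs => by
    have e : expNegInvGlue =ᶠ[𝓝 s] fun t => Real.exp (-t⁻¹) := by
      filter_upwards [lt_mem_nhds hs] with t ht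
      rw [expNegInvGlue, if_neg (not_le.2 ht)]
    have hd : HasDerivAt (fun t : ℝ => Real.exp (-t⁻¹)) (Real.exp (-s⁻¹) * -(-(s ^ 2)⁻¹)) s :=
      (hasDerivAt_inv hs.ne').neg.exp
    rw [e.deriv_eq, hd.deriv, neg_neg]
    positivity
  refine ⟨?_, hpos⟩
  rcases le_or_gt s 0 with h | h
  · have : IsLocalMin expNegInvGlue s := Eventually.of_forall fun t => by
      rw [expNegInvGlue.zero_of_nonpos h]; exact expNegInvGlue.nonneg t
    rw [this.deriv_eq_zero]
  · exact (hpos h).le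

theorem NS.transport_sp {U : Set (E n)} {u : Fin n → E n → ℝ} {p : E n → ℝ} (h : NS U u p) (k : ℝ)
    {x : E n} (hx : x ∈ U) :
    (∀ i, pd i (fun y => sp (head u p y - k)) x = expNegInvGlue (head u p x - k) * pd i (head u p) x) ∧
    lap (fun y => sp (head u p y - k)) x - ∑ i, u i x * pd i (fun y => sp (head u p y - k)) x =
      deriv expNegInvGlue (head u p x - k) * (∑ i, pd i (head u p) x * pd i (head u p) x) +
      expNegInvGlue (head u p x - k) *
        (1 / 2 * ∑ i, ∑ j, (pd i (u j) x - pd j (u i) x) ^ 2) := by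
  have hdH : ∀ y ∈ U, DifferentiableAt ℝ (head u p) y := fun y hy =>
    (h.smooth_head.contDiffAt (h.isOpen.mem_nhds hy)).differentiableAt (by simp)
  have hk : ∀ y ∈ U, ∀ i, pd i (fun y => head u p y - k) y = pd i (head u p) y := fun y hy i => by
    rw [pd_sub (hdH y hy) (differentiableAt_const _), pd_const, sub_zero]
  have h1 : ∀ y ∈ U, ∀ i, pd i (fun y => sp (head u p y - k)) y =
      expNegInvGlue (head u p y - k) * pd i (head u p) y := fun y hy i => by
    rw [pd_comp (f := fun y => head u p y - k) (hasDerivAt_sp _) ((hdH y hy).sub_const k), hk y hy]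
  refine ⟨h1 x hx, ?_⟩
  have hlap : lap (fun y => sp (head u p y - k)) x = ∑ i,
      (deriv expNegInvGlue (head u p x - k) * (pd i (head u p) x * pd i (head u p) x) +
        expNegInvGlue (head u p x - k) * pd i (pd i (head u p)) x) := by
    rw [lap]
    refine Finset.sum_congr rfl fun i _ => ?_
    have hdd : DifferentiableAt ℝ (pd i (head u p)) x :=
      ((contDiffOn_pd h.isOpen h.smooth_head).contDiffAt (h.isOpen.mem_nhds hx)).differentiableAt
        (by simp)
    have hde : HasDerivAt expNegInvGlue (deriv expNegInvGlue (head u p x - k)) (head u p x - k) :=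
      ((expNegInvGlue.contDiff (n := 1)).differentiable (by simp) _).hasDerivAt
    rw [pd_eqOn (g := fun y => expNegInvGlue (head u p y - k) * pd i (head u p) y) h.isOpen
      (fun y hy => h1 y hy i) hx, pd_mul _ hdd, pd_comp (f := fun y => head u p y - k) hde
      ((hdH x hx).sub_const k), hk x hx]
    · ring
    · exact DifferentiableAt.comp (g := expNegInvGlue) x hde.differentiableAt ((hdH x hx).sub_const k)
  have e : ∑ i, u i x * pd i (fun y => sp (head u p y - k)) x =
      expNegInvGlue (head u p x - k) * ∑ i, u i x * pd i (head u p) x := by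
    rw [Finset.mul_sum]
    exact Finset.sum_congr rfl fun i _ => by rw [h1 x hx]; ring
  rw [hlap, e, Finset.sum_add_distrib, ← Finset.mul_sum, ← Finset.mul_sum,
    show ∑ i, pd i (pd i (head u p)) x = lap (head u p) x from rfl, h.lap_head hx]
  ring

theorem contDiffOn_lap {U : Set (E n)} (hU : IsOpen U) {f : E n → ℝ} (hf : ContDiffOn ℝ ∞ f U) :
    ContDiffOn ℝ ∞ (lap f) U :=
  ContDiffOn.sum fun _ _ => contDiffOn_pd hU (contDiffOn_pd hU hf)

end

section

variable {n : ℕ} {A : ℝ} {u : Fin n → E n → ℝ} {p : E n → ℝ}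

theorem cut_lap_bound {C : ℝ} {c : ℝ} (hs : Sym C (cut c)) {x : E n} (hx : x ∈ PB n)
    (h : Sing A u p) : |lap (fun y => cut c (‖y‖ ^ 2)) x +
      ∑ i, u i x * pd i (fun y => cut c (‖y‖ ^ 2)) x| ≤ n * (6 * C + 2 * A * C) / ‖x‖ ^ 2 := by
  have hp : 0 < ‖x‖ := norm_pos_iff.2 hx.2
  have h1 : |lap (fun y => cut c (‖y‖ ^ 2)) x| ≤ ∑ i : Fin n, 6 * C / ‖x‖ ^ 2 := by
    rw [lap]
    exact (Finset.abs_sum_le_sum_abs _ _).trans (Finset.sum_le_sum fun i _ => hs.abs_pd_pd i hx.2)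
  have h2 : |∑ i, u i x * pd i (fun y => cut c (‖y‖ ^ 2)) x| ≤
      ∑ i : Fin n, (A / ‖x‖) * (2 * C / ‖x‖) := by
    refine (Finset.abs_sum_le_sum_abs _ _).trans (Finset.sum_le_sum fun i _ => ?_)
    rw [abs_mul]
    exact mul_le_mul (h.bu i x hx) (hs.abs_pd i hx.2) (abs_nonneg _)
      (div_nonneg h.nonneg hp.le)
  refine (abs_add_le _ _).trans ((add_le_add h1 h2).trans_eq ?_)
  simp only [Finset.sum_const, Finset.card_univ, Fintype.card_fin, nsmul_eq_mul]
  field_simp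

theorem cut_lap_zero {c : ℝ} {x : E n} (h1 : ‖x‖ ^ 2 ∉ ring c) (h2 : ‖x‖ ^ 2 ∉ ring 64) :
    lap (fun y => cut c (‖y‖ ^ 2)) x = 0 ∧ ∀ i, pd i (fun y => cut c (‖y‖ ^ 2)) x = 0 := by
  obtain ⟨e1, e2⟩ := deriv_cut h1 h2
  constructor
  · rw [lap_radial (contDiff_cut c), e1, e2]; simp
  · intro i; rw [pd_radial' (contDiff_cut c), e1]; simp

theorem Sing.transport_tendsto (hn : 5 ≤ n) (h : Sing A u p) {k : ℝ}
    (hk : ∀ x : E n, ‖x‖ ^ 2 ∈ ring 64 → head u p x ≤ k) :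
    Tendsto (fun N : ℕ => ∫ x, sp (head u p x - k) * (lap (fun y => cut (N + 128) (‖y‖ ^ 2)) x +
      ∑ i, u i x * pd i (fun y => cut (N + 128) (‖y‖ ^ 2)) x)) atTop (𝓝 0) := by
  obtain ⟨C, hC, hs⟩ := exists_sym_cut
  have hA := h.nonneg
  have hz : ∀ (N : ℕ) (x : E n), ‖x‖ ^ 2 ∉ ring ((N : ℝ) + 128) →
      sp (head u p x - k) * (lap (fun y => cut (N + 128) (‖y‖ ^ 2)) x +
      ∑ i, u i x * pd i (fun y => cut (N + 128) (‖y‖ ^ 2)) x) = 0 := by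
    intro N x hx
    by_cases h2 : ‖x‖ ^ 2 ∈ ring 64
    · rw [sp_of_nonpos (by linarith [hk x h2]), zero_mul]
    · obtain ⟨e1, e2⟩ := cut_lap_zero hx h2
      simp [e1, e2]
  rw [show (0 : ℝ) = ∫ x : E n, (0 : ℝ) by simp]
  refine tendsto_integral_of_dominated_convergence
    ((Metric.ball (0 : E n) (1 / 4)).indicator fun x =>
      (n * A ^ 2 + A + |k|) * (n * (6 * C + 2 * A * C)) * ‖x‖ ^ (-4 : ℝ)) (fun N => ?_) ?_ (fun N => ?_) ?_
  · refine Measurable.aestronglyMeasurable ?_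
    refine (contDiff_sp.continuous.measurable.comp (Measurable.sub_const ?_ k)).mul (Measurable.add
      (Finset.measurable_sum _ fun i _ => measurable_pd _ _)
      (Finset.measurable_sum _ fun i _ => (h.ns.meas_u i).mul (measurable_pd _ _)))
    exact ((Finset.measurable_sum _ fun i _ => (h.ns.meas_u i).mul (h.ns.meas_u i)).const_mul _).add
      h.ns.meas_p
  · refine (integrable_indicator_iff measurableSet_ball).2 (Integrable.const_mul ?_ _)
    refine integrableOn_rpow_norm (by omega) (a := 4) ?_ _
    have : (5 : ℝ) ≤ n := by exact_mod_cast hn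
    linarith
  · filter_upwards [ae_ne_zero (n := n) (by omega)] with x hx
    have hp : 0 < ‖x‖ := norm_pos_iff.2 hx
    by_cases hx1 : x ∈ Metric.ball (0 : E n) (1 / 4)
    · rw [indicator_of_mem hx1, Real.norm_eq_abs, abs_mul, abs_of_nonneg (sp_nonneg _)]
      have hb := cut_lap_bound (hs ((N : ℝ) + 128) (by positivity)) ⟨hx1, hx⟩ h
      have hh := head_bound h ⟨hx1, hx⟩
      have h2 : |head u p x - k| ≤ (n * A ^ 2 + A + |k|) / ‖x‖ ^ 2 := by
        have : |k| ≤ |k| / ‖x‖ ^ 2 := by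
          rw [mem_ball_zero_iff] at hx1
          exact le_div_self (abs_nonneg k) (by positivity) (by nlinarith)
        rw [add_div]
        linarith [abs_sub (head u p x) k]
      refine (mul_le_mul ((sp_le_abs _).trans h2) hb (abs_nonneg _) (by positivity)).trans_eq ?_
      rw [Real.rpow_neg hp.le, show (4 : ℝ) = ((4 : ℕ) : ℝ) by norm_num, Real.rpow_natCast]
      field_simp
    · rw [indicator_of_notMem hx1, hz, norm_zero]
      rintro ⟨h1, h2⟩
      rw [mem_ball_zero_iff, not_lt] at hx1
      have : (0 : ℝ) ≤ N := Nat.cast_nonneg N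
      nlinarith
  · filter_upwards [ae_ne_zero (n := n) (by omega)] with x hx
    have hp : 0 < ‖x‖ ^ 2 := by have := norm_pos_iff.2 hx; positivity
    refine tendsto_const_nhds.congr' ?_
    obtain ⟨N0, hN0⟩ := exists_nat_gt (2 / ‖x‖ ^ 2)
    filter_upwards [eventually_ge_atTop N0] with N hN
    rw [hz]
    rintro ⟨h1, h2⟩
    rw [div_lt_iff₀ hp] at hN0
    have : (N0 : ℝ) ≤ N := by exact_mod_cast hN
    nlinarith

theorem Sing.head_le (hn : 5 ≤ n) (h : Sing A u p) :
    ∃ k, 0 ≤ k ∧ ∀ x : E n, x ≠ 0 → 64 * ‖x‖ ^ 2 ≤ 2 → head u p x ≤ k := by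
  have hU : IsOpen (PB n) := isOpen_PB
  have hH := h.ns.smooth_head
  obtain ⟨k, hk⟩ := (isCompact_ann (n := n) 64).exists_bound_of_continuousOn
    (hH.continuousOn.mono (ann_subset 64))
  have hk' : ∀ x : E n, ‖x‖ ^ 2 ∈ ring 64 → head u p x ≤ |k| := fun x hx =>
    (le_abs_self _).trans ((hk x hx).trans (le_abs_self k))
  generalize |k| = k at hk'
  refine ⟨|k|, abs_nonneg k, ?_⟩
  set B : E n → ℝ := fun y => sp (head u p y - k) with hB
  have hBs : ContDiffOn ℝ ∞ B (PB n) :=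
    contDiff_sp.comp_contDiffOn (hH.sub contDiffOn_const)
  set T : E n → ℝ := fun x => lap B x - ∑ i, u i x * pd i B x with hT
  have hTc : ContinuousOn T (PB n) := by
    refine (contDiffOn_lap hU hBs).continuousOn.sub (continuousOn_finsetSum _ fun i _ => ?_)
    exact (h.ns.smooth_u i).continuousOn.mul (contDiffOn_pd hU hBs).continuousOn
  have hTe := fun x (hx : x ∈ PB n) => (h.ns.transport_sp k hx).2
  have hT0 : ∀ x ∈ PB n, 0 ≤ T x := by
    intro x hx
    rw [hT]; simp only
    rw [hTe x hx]
    have h1 := (deriv_expNegInvGlue_nonneg (head u p x - k)).1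
    have h2 := expNegInvGlue.nonneg (head u p x - k)
    have h3 : 0 ≤ ∑ i, pd i (head u p) x * pd i (head u p) x :=
      Finset.sum_nonneg fun i _ => mul_self_nonneg _
    have h4 : 0 ≤ ∑ i, ∑ j, (pd i (u j) x - pd j (u i) x) ^ 2 :=
      Finset.sum_nonneg fun i _ => Finset.sum_nonneg fun j _ => sq_nonneg _
    positivity
  have hη : ∀ c, ContDiff ℝ ∞ fun y : E n => cut c (‖y‖ ^ 2) := fun c => contDiff_radial (contDiff_cut c)
  have hI1 : ∀ c, Integrable fun x => cut c (‖x‖ ^ 2) * T x := fun c =>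
    integrable_of_continuousOn (isCompact_ann c) (ann_subset c) ((hη c).continuous.continuousOn.mul hTc)
      fun x hx => by rw [cut_off hx, zero_mul]
  have hI2 : ∀ c, Integrable fun x => B x * (lap (fun y => cut c (‖y‖ ^ 2)) x +
      ∑ i, u i x * pd i (fun y => cut c (‖y‖ ^ 2)) x) := fun c => by
    refine integrable_of_continuousOn (isCompact_ann c) (ann_subset c) (hBs.continuousOn.mul
      ((contDiffOn_lap hU (hη c).contDiffOn).continuousOn.add (continuousOn_finsetSum _ fun i _ =>
        (h.ns.smooth_u i).continuousOn.mul (contDiff_pd (hη c)).continuous.continuousOn))) fun x hx => ?_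
    have hc := (isCompact_ann (n := n) c).isClosed
    rw [lap_eq_zero_off hc (fun x hx => cut_off hx) x hx, Finset.sum_eq_zero, add_zero, mul_zero]
    intro i _
    rw [pd_eq_zero_off hc (fun x hx => cut_off hx) i x hx, mul_zero]
  have hEq : ∀ c, ∫ x, cut c (‖x‖ ^ 2) * T x = ∫ x, B x * (lap (fun y => cut c (‖y‖ ^ 2)) x +
      ∑ i, u i x * pd i (fun y => cut c (‖y‖ ^ 2)) x) := fun c => by
    have := h.ns.weak_transport (hBs.of_le (by norm_cast)) (hη c).contDiffOn
      (isCompact_ann c) (ann_subset c) (fun x hx => cut_off hx)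
    rw [integral_sub (f := fun x => cut c (‖x‖ ^ 2) * T x) (hI1 c) (hI2 c)] at this
    linarith
  have hlim := h.transport_tendsto hn hk'
  have hz : ∀ c, 0 < c → ∀ x ∈ PB n, cut c (‖x‖ ^ 2) * T x = 0 := by
    intro c hc
    have hnn : ∀ c, ∀ x, 0 ≤ cut c (‖x‖ ^ 2) * T x := by
      intro c x
      by_cases hx : x ∈ PB n
      · exact mul_nonneg (cut_nonneg _ _) (hT0 x hx)
      · rw [cut_off fun h => hx (ann_subset c h), zero_mul]
    have hle : ∫ x, cut c (‖x‖ ^ 2) * T x ≤ 0 := by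
      refine ge_of_tendsto hlim ?_
      obtain ⟨N0, hN0⟩ := exists_nat_gt (2 * c)
      filter_upwards [eventually_ge_atTop N0] with N hN
      rw [← hEq]
      refine integral_mono (hI1 c) (hI1 _) fun x => ?_
      by_cases hx : x ∈ PB n
      · refine mul_le_mul_of_nonneg_right (cut_mono (by positivity) ?_) (hT0 x hx)
        have : (N0 : ℝ) ≤ N := by exact_mod_cast hN
        linarith
      · simp only
        rw [cut_off fun h => hx (ann_subset _ h), zero_mul]; exact hnn _ _
    have h0 : ∫ x, cut c (‖x‖ ^ 2) * T x = 0 := le_antisymm hle (integral_nonneg (hnn c))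
    have hae := (integral_eq_zero_iff_of_nonneg (hnn c) (hI1 c)).1 h0
    exact Measure.eqOn_open_of_ae_eq (μ := volume) (ae_restrict_of_ae hae) hU
      ((hη c).continuous.continuousOn.mul hTc) continuousOn_const
  have hgrad : ∀ x : E n, x ≠ 0 → 64 * ‖x‖ ^ 2 < 2 → ∀ i, pd i B x = 0 := by
    intro x hx hx1 i
    have hp : 0 < ‖x‖ ^ 2 := by have := norm_pos_iff.2 hx; positivity
    have hxU : x ∈ PB n := by
      refine ⟨?_, hx⟩
      rw [mem_ball_zero_iff]; nlinarith [norm_nonneg x]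
    rw [(h.ns.transport_sp k hxU).1]
    rcases le_or_gt (head u p x - k) 0 with h0 | h0
    · rw [expNegInvGlue.zero_of_nonpos h0, zero_mul]
    have hTx := hz (2 / ‖x‖ ^ 2) (by positivity) x hxU
    have hcut : cut (2 / ‖x‖ ^ 2) (‖x‖ ^ 2) ≠ 0 := by
      have : kap (64 * ‖x‖ ^ 2) < 1 := Real.smoothTransition.lt_one_of_lt_one (by linarith)
      rw [cut, kap_one (by rw [div_mul_cancel₀ _ hp.ne']), one_mul]
      linarith
    have hTx := (mul_eq_zero.1 hTx).resolve_left hcut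
    rw [hT] at hTx; simp only at hTx
    rw [hTe x hxU] at hTx
    have h1 := (deriv_expNegInvGlue_nonneg (head u p x - k)).2 h0
    have h2 := expNegInvGlue.nonneg (head u p x - k)
    have h4 : 0 ≤ ∑ i, ∑ j, (pd i (u j) x - pd j (u i) x) ^ 2 :=
      Finset.sum_nonneg fun i _ => Finset.sum_nonneg fun j _ => sq_nonneg _
    have h3 : pd i (head u p) x * pd i (head u p) x ≤ ∑ i, pd i (head u p) x * pd i (head u p) x :=
      Finset.single_le_sum (f := fun i => pd i (head u p) x * pd i (head u p) x)
        (fun i _ => mul_self_nonneg _) (Finset.mem_univ i)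
    have h5 : 0 ≤ expNegInvGlue (head u p x - k) *
        (1 / 2 * ∑ i, ∑ j, (pd i (u j) x - pd j (u i) x) ^ 2) := by positivity
    have h6 : ∑ i, pd i (head u p) x * pd i (head u p) x ≤ 0 := by
      by_contra h6
      nlinarith [mul_pos h1 (not_le.1 h6)]
    rw [mul_self_eq_zero.1 (le_antisymm (h3.trans h6) (mul_self_nonneg _)), mul_zero]
  intro x hx hx2
  refine le_trans ?_ (le_abs_self k)
  rcases le_total (1 / 8) ‖x‖ with h8 | h8
  · exact hk' x ⟨by nlinarith, hx2⟩
  by_contra hcon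
  have hp : 0 < ‖x‖ := norm_pos_iff.2 hx
  have hb := radial_bound (f := B) (G := fun _ => 0) (G' := fun _ => 0) hx h8 (fun y hy1 hy2 => ?_)
    (fun s _ => hasDerivAt_const _ _)
  · have hy : ‖(1 / 8 / ‖x‖) • x‖ = 1 / 8 := by
      rw [norm_smul, Real.norm_of_nonneg (by positivity)]; field_simp
    have hB0 : B ((1 / 8 / ‖x‖) • x) = 0 := sp_of_nonpos (sub_nonpos.2 (hk' _ (by
      rw [hy]; constructor <;> norm_num)))
    rw [hB0, abs_zero, sub_zero, add_zero] at hb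
    have := sp_pos (s := head u p x - k) (by linarith)
    linarith [le_abs_self (B x)]
  · have hy0 : y ≠ 0 := norm_pos_iff.1 (hp.trans_le hy1)
    refine ⟨(hBs.contDiffAt (hU.mem_nhds ⟨?_, hy0⟩)).differentiableAt (by simp), ?_⟩
    · rw [mem_ball_zero_iff]; linarith
    · refine (norm_fderiv_le_sum B y).trans_eq ?_
      rw [neg_zero]
      exact Finset.sum_eq_zero fun i _ => by
        rw [hgrad y hy0 (by nlinarith [norm_nonneg y]) i, abs_zero]

end

section

variable {n : ℕ} {A : ℝ} {u : Fin n → E n → ℝ} {p : E n → ℝ}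

/-- A power times the cutoff. -/
noncomputable def pcut (a c s : ℝ) : ℝ := s ^ a * cut c s

theorem contDiff_pcut (a : ℝ) {c : ℝ} (hc : 0 < c) : ContDiff ℝ ∞ (pcut a c) :=
  contDiff_rpow_mul (contDiff_cut c) (one_div_pos.2 hc) fun s hs => cut_lo (by
    rw [lt_div_iff₀ hc] at hs; linarith)

theorem pcut_off (a : ℝ) {c : ℝ} {x : E n} (hx : x ∉ ann n c) : pcut a c (‖x‖ ^ 2) = 0 := by
  rw [pcut, cut_off hx, mul_zero]

theorem deriv_pcut (a c : ℝ) {s : ℝ} (hs : 0 < s) :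
    deriv (pcut a c) s = a * s ^ (a - 1) * cut c s + s ^ a * deriv (cut c) s ∧
    deriv (deriv (pcut a c)) s = a * (a - 1) * s ^ (a - 2) * cut c s +
      2 * a * s ^ (a - 1) * deriv (cut c) s + s ^ a * deriv (deriv (cut c)) s := by
  have h0 : ∀ t, HasDerivAt (cut c) (deriv (cut c) t) t := fun t =>
    ((contDiff_cut c).differentiable (by simp) t).hasDerivAt
  have h0' : ∀ t, HasDerivAt (deriv (cut c)) (deriv (deriv (cut c)) t) t := fun t =>
    ((contDiff_deriv (contDiff_cut c)).differentiable (by simp) t).hasDerivAt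
  have h1 : ∀ t > 0, HasDerivAt (pcut a c) (a * t ^ (a - 1) * cut c t + t ^ a * deriv (cut c) t) t :=
    fun t ht => (Real.hasDerivAt_rpow_const (Or.inl ht.ne')).mul (h0 t)
  refine ⟨(h1 s hs).deriv, ?_⟩
  have e : deriv (pcut a c) =ᶠ[𝓝 s] fun t => a * t ^ (a - 1) * cut c t + t ^ a * deriv (cut c) t := by
    filter_upwards [lt_mem_nhds hs] with t ht using (h1 t ht).deriv
  have hd : HasDerivAt (fun t => a * t ^ (a - 1) * cut c t + t ^ a * deriv (cut c) t)
      ((a * ((a - 1) * s ^ (a - 1 - 1))) * cut c s + a * s ^ (a - 1) * deriv (cut c) s +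
      (a * s ^ (a - 1) * deriv (cut c) s + s ^ a * deriv (deriv (cut c)) s)) s :=
    (((Real.hasDerivAt_rpow_const (Or.inl hs.ne')).const_mul a).mul (h0 s)).add
      ((Real.hasDerivAt_rpow_const (Or.inl hs.ne')).mul (h0' s))
  rw [e.deriv_eq, hd.deriv, show a - 1 - 1 = a - 2 by ring]
  ring

theorem norm_sq_rpow (x : E n) : (‖x‖ ^ 2) ^ (-(n : ℝ) / 2) = (‖x‖ ^ n)⁻¹ := by
  rw [← Real.rpow_natCast ‖x‖ 2, ← Real.rpow_mul (norm_nonneg _), ← Real.rpow_natCast,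
    ← Real.rpow_neg (norm_nonneg _)]
  congr 1; push_cast; ring

/-- Combined weight on both transition regions. -/
noncomputable def tw (c : ℝ) (x : E n) : ℝ := critWeight c x + critWeight 64 x

theorem critWeight_nonneg (c : ℝ) (x : E n) : 0 ≤ critWeight c x :=
  indicator_nonneg (fun _ _ => by positivity) _

theorem tw_nonneg (c : ℝ) (x : E n) : 0 ≤ tw c x :=
  add_nonneg (critWeight_nonneg _ _) (critWeight_nonneg _ _)

theorem tw_bound : ∃ K, 0 ≤ K ∧ ∀ c > 0, Integrable (tw (n := n) c) ∧ ∫ x : E n, tw c x ≤ K := by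
  obtain ⟨K, hK⟩ := critWeight_bound (n := n)
  have h0 : 0 ≤ K := (integral_nonneg (critWeight_nonneg 1)).trans (hK 1 one_pos).2
  refine ⟨K + K, by linarith, fun c hc => ⟨(hK c hc).1.add (hK 64 (by norm_num)).1, ?_⟩⟩
  unfold tw
  rw [integral_add (hK c hc).1 (hK 64 (by norm_num)).1]
  exact add_le_add (hK c hc).2 (hK 64 (by norm_num)).2

theorem le_tw {c : ℝ} {x : E n} (h : ‖x‖ ^ 2 ∈ ring c ∨ ‖x‖ ^ 2 ∈ ring 64) :
    (‖x‖ ^ n)⁻¹ ≤ tw c x := by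
  have key : ∀ {c}, ‖x‖ ^ 2 ∈ ring c → critWeight c x = (‖x‖ ^ n)⁻¹ := fun {c} h =>
    indicator_of_mem (s := {x : E n | ‖x‖ ^ 2 ∈ ring c}) h _
  rcases h with h | h
  · rw [tw, key h]; linarith [critWeight_nonneg 64 x]
  · rw [tw, key h]; linarith [critWeight_nonneg c x]

/-- Derivative terms of the cutoff are controlled by the weight on the transition regions. -/
theorem cut_deriv_tw {C c : ℝ} (hs : Sym C (cut c)) {x : E n} (hx : x ≠ 0) :
    (‖x‖ ^ 2) ^ (-(n : ℝ) / 2) * |‖x‖ ^ 2 * deriv (cut c) (‖x‖ ^ 2)| ≤ C * tw c x ∧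
    (‖x‖ ^ 2) ^ (-(n : ℝ) / 2) * |(‖x‖ ^ 2) ^ 2 * deriv (deriv (cut c)) (‖x‖ ^ 2)| ≤ C * tw c x := by
  have hp : 0 < ‖x‖ := norm_pos_iff.2 hx
  have hC : 0 ≤ C := (abs_nonneg _).trans (hs.b0 1 one_pos)
  by_cases h : ‖x‖ ^ 2 ∈ ring c ∨ ‖x‖ ^ 2 ∈ ring 64
  · rw [norm_sq_rpow x, mul_comm C]
    exact ⟨mul_le_mul (le_tw h) (hs.b1 _ (by positivity)) (abs_nonneg _) (tw_nonneg _ _),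
      mul_le_mul (le_tw h) (hs.b2 _ (by positivity)) (abs_nonneg _) (tw_nonneg _ _)⟩
  · rw [not_or] at h
    obtain ⟨e1, e2⟩ := deriv_cut h.1 h.2
    rw [e1, e2]
    have := mul_nonneg hC (tw_nonneg c x)
    simpa using this

theorem Sing.abs_dot_le (h : Sing A u p) {x : E n} (hx : x ∈ PB n) :
    |∑ i, x i * u i x| ≤ n * A := by
  have hp : 0 < ‖x‖ := norm_pos_iff.2 hx.2
  refine (Finset.abs_sum_le_sum_abs _ _).trans ((Finset.sum_le_sum (g := fun _ => A) fun i _ => ?_).trans_eq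
    (by simp))
  rw [abs_mul]
  have h1 : |x i| ≤ ‖x‖ := by simpa using PiLp.norm_apply_le x i
  refine (mul_le_mul h1 (h.bu i x hx) (abs_nonneg _) hp.le).trans_eq ?_
  field_simp

theorem pd_coord_radial {F : ℝ → ℝ} (hF : ContDiff ℝ ∞ F) (i j : Fin n) (x : E n) :
    pd i (fun y => y j * F (‖y‖ ^ 2)) x =
      (if i = j then F (‖x‖ ^ 2) else 0) + x j * (2 * x i * deriv F (‖x‖ ^ 2)) := by
  have hc : DifferentiableAt ℝ (fun y : E n => y j) x := by fun_prop
  rw [pd_mul hc ((contDiff_radial hF).differentiable (by simp) x), pd_radial' hF, pd_coord]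
  split_ifs <;> simp

theorem lap_coord_radial {F : ℝ → ℝ} (hF : ContDiff ℝ ∞ F) (j : Fin n) (x : E n) :
    lap (fun y => y j * F (‖y‖ ^ 2)) x = x j * ((2 * n + 4) * deriv F (‖x‖ ^ 2) +
      4 * ‖x‖ ^ 2 * deriv (deriv F) (‖x‖ ^ 2)) := by
  have hc : ContDiff ℝ ∞ (fun y : E n => y j) := by fun_prop
  have hz : ∀ i k : Fin n, pd i (pd k fun y : E n => y j) x = 0 := fun i k => by
    rw [show (pd k fun y : E n => y j) = fun y => if k = j then 1 else 0 from
      funext fun y => by rw [pd_coord], pd_const]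
  have : lap (fun y => y j * F (‖y‖ ^ 2)) x = x j * lap (fun y => F (‖y‖ ^ 2)) x +
      2 * ∑ i, (if i = j then 2 * x i * deriv F (‖x‖ ^ 2) else 0) := by
    simp only [lap, Finset.mul_sum, ← Finset.sum_add_distrib]
    refine Finset.sum_congr rfl fun i _ => ?_
    rw [pd_pd_mul hc (contDiff_radial hF), hz, pd_coord, pd_radial' hF]
    split_ifs <;> ring
  rw [this, lap_radial hF, Finset.sum_ite_eq' Finset.univ j]
  simp only [Finset.mem_univ, if_true]
  ring

end

section

variable {n : ℕ} {A : ℝ} {u : Fin n → E n → ℝ} {p : E n → ℝ}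

theorem radial_test_identity {a c : ℝ} (ha : a = 1 + -(n : ℝ) / 2) (hc : 0 < c) {x : E n}
    (hx : x ≠ 0) :
    ((∑ j, u j x * lap (fun y => y j * pcut a c (‖y‖ ^ 2)) x) +
      (∑ i, ∑ j, u i x * u j x * pd i (fun y => y j * pcut a c (‖y‖ ^ 2)) x) +
      p x * ∑ i, pd i (fun y => y i * pcut a c (‖y‖ ^ 2)) x) -
      ∑ j, u j x * pd j (fun y => n * pcut a c (‖y‖ ^ 2) +
        2 * (‖y‖ ^ 2 * deriv (pcut a c) (‖y‖ ^ 2))) x =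
    2 * (pcut a c (‖x‖ ^ 2) * head u p x) +
      2 * a * ((‖x‖ ^ 2) ^ (-(n : ℝ) / 2) * cut c (‖x‖ ^ 2) * (∑ i, x i * u i x) ^ 2) +
      2 * ((‖x‖ ^ 2) ^ (-(n : ℝ) / 2) * (‖x‖ ^ 2 * deriv (cut c) (‖x‖ ^ 2)) *
        ((∑ i, x i * u i x) ^ 2 + ‖x‖ ^ 2 * p x)) := by
  have hs : 0 < ‖x‖ ^ 2 := by have := norm_pos_iff.2 hx; positivity
  have hG := contDiff_pcut a hc
  have hG1 := contDiff_deriv hG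
  have hF : ContDiff ℝ ∞ fun s => n * pcut a c s + 2 * (s * deriv (pcut a c) s) :=
    (contDiff_const.mul hG).add (contDiff_const.mul (contDiff_id.mul hG1))
  have hdF : deriv (fun s => n * pcut a c s + 2 * (s * deriv (pcut a c) s)) (‖x‖ ^ 2) =
      (n + 2) * deriv (pcut a c) (‖x‖ ^ 2) + 2 * (‖x‖ ^ 2 * deriv (deriv (pcut a c)) (‖x‖ ^ 2)) := by
    have h1 := (hG.differentiable (by simp) (‖x‖ ^ 2)).hasDerivAt
    have h2 := (hG1.differentiable (by simp) (‖x‖ ^ 2)).hasDerivAt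
    have h3 : HasDerivAt (fun s => n * pcut a c s + 2 * (s * deriv (pcut a c) s))
      (n * deriv (pcut a c) (‖x‖ ^ 2) + 2 * (1 * deriv (pcut a c) (‖x‖ ^ 2) +
        ‖x‖ ^ 2 * deriv (deriv (pcut a c)) (‖x‖ ^ 2))) (‖x‖ ^ 2) :=
      (h1.const_mul (n : ℝ)).add (((hasDerivAt_id _).mul h2).const_mul 2)
    rw [h3.deriv]; ring
  have e1 : ∀ j, u j x * pd j (fun y => n * pcut a c (‖y‖ ^ 2) +
        2 * (‖y‖ ^ 2 * deriv (pcut a c) (‖y‖ ^ 2))) x =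
      u j x * lap (fun y => y j * pcut a c (‖y‖ ^ 2)) x := fun j => by
    rw [pd_radial' hF, hdF, lap_coord_radial hG]; ring
  simp only [e1]
  have e2 : ∑ i, ∑ j, u i x * u j x * pd i (fun y => y j * pcut a c (‖y‖ ^ 2)) x =
      pcut a c (‖x‖ ^ 2) * (∑ j, u j x * u j x) +
        2 * deriv (pcut a c) (‖x‖ ^ 2) * (∑ i, x i * u i x) ^ 2 := by
    have : ∀ i j, u i x * u j x * pd i (fun y => y j * pcut a c (‖y‖ ^ 2)) x =
        (if i = j then pcut a c (‖x‖ ^ 2) * (u i x * u j x) else 0) +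
        2 * deriv (pcut a c) (‖x‖ ^ 2) * ((x i * u i x) * (x j * u j x)) := fun i j => by
      rw [pd_coord_radial hG]; split_ifs <;> ring
    simp only [this, Finset.sum_add_distrib]
    congr 1
    · rw [Finset.mul_sum]
      exact Finset.sum_congr rfl fun i _ => by simp
    · rw [sq (∑ i, x i * u i x), Finset.sum_mul_sum, Finset.mul_sum]
      exact Finset.sum_congr rfl fun i _ => by rw [Finset.mul_sum]
  have e3 : ∑ i, pd i (fun y => y i * pcut a c (‖y‖ ^ 2)) x =
      n * pcut a c (‖x‖ ^ 2) + 2 * (‖x‖ ^ 2 * deriv (pcut a c) (‖x‖ ^ 2)) := by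
    simp only [pd_coord_radial hG, if_true, Finset.sum_add_distrib]
    rw [← sum_mul_self_eq, Finset.sum_mul, Finset.mul_sum]
    simp only [Finset.sum_const, Finset.card_univ, Fintype.card_fin, nsmul_eq_mul]
    congr 1
    exact Finset.sum_congr rfl fun i _ => by ring
  rw [e2, e3, (deriv_pcut a c hs).1, head]
  have r1 : (‖x‖ ^ 2) ^ (a - 1) = (‖x‖ ^ 2) ^ (-(n : ℝ) / 2) := by rw [ha]; ring_nf
  have r2 : (‖x‖ ^ 2) ^ a = ‖x‖ ^ 2 * (‖x‖ ^ 2) ^ (-(n : ℝ) / 2) := by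
    rw [ha, Real.rpow_add hs, Real.rpow_one]
  rw [pcut, r1, r2]
  generalize (‖x‖ ^ 2) ^ (-(n : ℝ) / 2) = w
  generalize ∑ i, x i * u i x = d
  generalize ∑ j, u j x * u j x = e
  generalize ∑ j, u j x * _ = l
  generalize ‖x‖ ^ 2 = s
  subst ha
  ring

theorem Sing.radial_test_integral (h : Sing A u p) {a c : ℝ} (hc : 0 < c) :
    ∃ I : E n → ℝ, Integrable I ∧ ∫ x, I x = 0 ∧ (∀ x ∉ ann n c, I x = 0) ∧
      I = fun x => ((∑ j, u j x * lap (fun y => y j * pcut a c (‖y‖ ^ 2)) x) +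
      (∑ i, ∑ j, u i x * u j x * pd i (fun y => y j * pcut a c (‖y‖ ^ 2)) x) +
      p x * ∑ i, pd i (fun y => y i * pcut a c (‖y‖ ^ 2)) x) -
      ∑ j, u j x * pd j (fun y => n * pcut a c (‖y‖ ^ 2) +
        2 * (‖y‖ ^ 2 * deriv (pcut a c) (‖y‖ ^ 2))) x := by
  have hG := contDiff_pcut a hc
  have hG1 := contDiff_deriv hG
  have hU := isOpen_PB (n := n)
  have hA := (isCompact_ann (n := n) c).isClosed
  have hψ : ∀ j, ContDiff ℝ ∞ fun y : E n => y j * pcut a c (‖y‖ ^ 2) := fun j =>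
    ContDiff.mul (by fun_prop) (contDiff_radial hG)
  have hf : ContDiff ℝ ∞ fun y : E n => n * pcut a c (‖y‖ ^ 2) +
        2 * (‖y‖ ^ 2 * deriv (pcut a c) (‖y‖ ^ 2)) :=
    contDiff_radial (F := fun s => n * pcut a c s + 2 * (s * deriv (pcut a c) s))
      ((contDiff_const.mul hG).add (contDiff_const.mul (contDiff_id.mul hG1)))
  have hψ0 : ∀ j : Fin n, ∀ x ∉ ann n c, x j * pcut a c (‖x‖ ^ 2) = 0 := fun j x hx => by
    rw [pcut_off a hx, mul_zero]
  have hf0 : ∀ x ∉ ann n c, n * pcut a c (‖x‖ ^ 2) +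
        2 * (‖x‖ ^ 2 * deriv (pcut a c) (‖x‖ ^ 2)) = 0 := fun x hx => by
    by_cases hx0 : x = 0
    · rw [pcut_off a hx, hx0]; simp
    have hs : 0 < ‖x‖ ^ 2 := by have := norm_pos_iff.2 hx0; positivity
    have hd : deriv (cut c) (‖x‖ ^ 2) = 0 := by
      simp only [ann, mem_ofPred_eq, not_and_or, not_le] at hx
      have c1 : ContinuousAt (fun s : ℝ => c * s) (‖x‖ ^ 2) := by fun_prop
      have c2 : ContinuousAt (fun s : ℝ => 64 * s) (‖x‖ ^ 2) := by fun_prop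
      have : cut c =ᶠ[𝓝 (‖x‖ ^ 2)] fun _ => 0 := by
        rcases hx with h | h
        · exact (c1.eventually (gt_mem_nhds h)).mono fun y hy => cut_lo (le_of_lt hy)
        · exact (c2.eventually (lt_mem_nhds h)).mono fun y hy => cut_hi (le_of_lt hy)
      rw [this.deriv_eq, deriv_const]
    rw [(deriv_pcut a c hs).1, pcut, cut_off hx, hd]; simp
  set I1 : E n → ℝ := fun x => (∑ j, u j x * lap (fun y => y j * pcut a c (‖y‖ ^ 2)) x) +
      (∑ i, ∑ j, u i x * u j x * pd i (fun y => y j * pcut a c (‖y‖ ^ 2)) x) +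
      p x * ∑ i, pd i (fun y => y i * pcut a c (‖y‖ ^ 2)) x with hI1
  set I2 : E n → ℝ := fun x => ∑ j, u j x * pd j (fun y => n * pcut a c (‖y‖ ^ 2) +
        2 * (‖y‖ ^ 2 * deriv (pcut a c) (‖y‖ ^ 2))) x with hI2
  have z1 : ∀ x ∉ ann n c, I1 x = 0 := fun x hx => by
    have hl := fun j => lap_eq_zero_off hA (hψ0 j) x hx
    have hd := fun i j => pd_eq_zero_off hA (hψ0 j) i x hx
    simp [hI1, hl, hd]
  have z2 : ∀ x ∉ ann n c, I2 x = 0 := fun x hx => by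
    have hd := fun i => pd_eq_zero_off hA hf0 i x hx
    simp [hI2, hd]
  have cu := fun j => (h.ns.smooth_u j).continuousOn
  have i1 : Integrable I1 := by
    refine integrable_of_continuousOn (isCompact_ann c) (ann_subset c) (((continuousOn_finsetSum _
      fun j _ => (cu j).mul ?_).add (continuousOn_finsetSum _ fun i _ => continuousOn_finsetSum _
      fun j _ => ((cu i).mul (cu j)).mul ?_)).add (h.ns.smooth_p.continuousOn.mul
      (continuousOn_finsetSum _ fun i _ => ?_))) z1
    · exact (contDiffOn_lap hU (hψ j).contDiffOn).continuousOn
    · exact (contDiff_pd (hψ j)).continuous.continuousOn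
    · exact (contDiff_pd (hψ i)).continuous.continuousOn
  have i2 : Integrable I2 :=
    integrable_of_continuousOn (isCompact_ann c) (ann_subset c) (continuousOn_finsetSum _
      fun j _ => (cu j).mul (contDiff_pd hf).continuous.continuousOn) z2
  refine ⟨fun x => I1 x - I2 x, i1.sub i2, ?_, fun x hx => by simp only [z1 x hx, z2 x hx, sub_zero], rfl⟩
  rw [integral_sub i1 i2, hI1, hI2, h.ns.weak_mom (fun j => (hψ j).contDiffOn) (isCompact_ann c)
    (ann_subset c) hψ0, h.ns.weak_div hf.contDiffOn (isCompact_ann c) (ann_subset c) hf0, sub_zero]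

/-- The weighted integral of the head pressure is bounded. -/
theorem Sing.int_head (hn : 5 ≤ n) (h : Sing A u p) : ∃ K, ∀ c > 0,
    ∫ x, pcut (1 + -(n : ℝ) / 2) c (‖x‖ ^ 2) * |head u p x| ≤ K := by
  obtain ⟨k, hk0, hk⟩ := h.head_le hn
  obtain ⟨C, hC, hs⟩ := exists_sym_cut
  obtain ⟨K, hK0, hK⟩ := tw_bound (n := n)
  have hA := h.nonneg
  set a : ℝ := 1 + -(n : ℝ) / 2 with ha
  have hn' : (5 : ℝ) ≤ n := by exact_mod_cast hn
  set g : E n → ℝ := (Metric.ball (0 : E n) (1 / 4)).indicator fun x => ‖x‖ ^ (-((n : ℝ) - 2)) with hg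
  have hgi : Integrable g := (integrable_indicator_iff measurableSet_ball).2
    (integrableOn_rpow_norm (by omega) (by linarith) _)
  refine ⟨2 * k * (∫ x, g x) + C * ((n * A) ^ 2 + A) * K, fun c hc => ?_⟩
  obtain ⟨I, hI, hI0, hIz, hIe⟩ := h.radial_test_integral (a := a) hc
  obtain ⟨hKi, hKK⟩ := hK c hc
  have hle : ∀ x, pcut a c (‖x‖ ^ 2) * |head u p x| ≤
      (2 * k * g x + C * ((n * A) ^ 2 + A) * tw c x) - 1 / 2 * I x := by
    intro x
    by_cases hx : x ∉ ann n c
    · rw [pcut_off a hx, hIz x hx]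
      have h1 := tw_nonneg c x
      have h2 : 0 ≤ g x := indicator_nonneg (fun _ _ => by positivity) _
      rw [zero_mul, mul_zero, sub_zero]
      positivity
    rw [not_not] at hx
    have hxU := ann_subset c hx
    have hp : 0 < ‖x‖ := norm_pos_iff.2 hxU.2
    have hIx := congrFun hIe x
    rw [radial_test_identity ha hc hxU.2] at hIx
    have hH := hk x hxU.2 hx.2
    have hG0 : 0 ≤ pcut a c (‖x‖ ^ 2) := mul_nonneg (by positivity) (cut_nonneg _ _)
    have hGg : pcut a c (‖x‖ ^ 2) ≤ g x := by
      rw [hg, indicator_of_mem hxU.1, pcut]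
      refine (mul_le_of_le_one_right (by positivity) (cut_le_one _ _)).trans_eq ?_
      rw [← Real.rpow_natCast ‖x‖ 2, ← Real.rpow_mul hp.le, ha]
      congr 1; push_cast; ring
    have hd := h.abs_dot_le hxU
    have hw := (cut_deriv_tw (hs c hc) hxU.2).1
    have hsp : |‖x‖ ^ 2 * p x| ≤ A := by
      rw [abs_mul, abs_of_pos (by positivity)]
      have := h.bp x hxU
      rw [le_div_iff₀ (by positivity)] at this
      linarith
    have hdd : (∑ i, x i * u i x) ^ 2 ≤ (n * A) ^ 2 := by
      rw [← sq_abs]; exact pow_le_pow_left₀ (abs_nonneg _) hd 2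
    have t1 : |(‖x‖ ^ 2) ^ (-(n : ℝ) / 2) * (‖x‖ ^ 2 * deriv (cut c) (‖x‖ ^ 2)) *
        ((∑ i, x i * u i x) ^ 2 + ‖x‖ ^ 2 * p x)| ≤ C * tw c x * ((n * A) ^ 2 + A) := by
      rw [abs_mul]
      refine mul_le_mul ?_ ?_ (abs_nonneg _) (mul_nonneg (by linarith) (tw_nonneg _ _))
      · rw [abs_mul, abs_of_nonneg (by positivity)]; exact hw
      · refine (abs_add_le _ _).trans (add_le_add ?_ hsp)
        rwa [abs_of_nonneg (sq_nonneg _)]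
    have t2 : 0 ≤ (‖x‖ ^ 2) ^ (-(n : ℝ) / 2) * cut c (‖x‖ ^ 2) * (∑ i, x i * u i x) ^ 2 :=
      mul_nonneg (mul_nonneg (by positivity) (cut_nonneg _ _)) (sq_nonneg _)
    have ha0 : a ≤ 0 := by rw [ha]; linarith
    have t3 : |head u p x| ≤ 2 * k - head u p x := abs_le.2 ⟨by linarith, by linarith⟩
    have t4 := mul_le_mul_of_nonneg_left t3 hG0
    have t5 := mul_le_mul_of_nonneg_left hGg (by linarith : 0 ≤ 2 * k)
    have t6 := mul_nonneg (neg_nonneg.2 ha0) t2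
    have t7 := (abs_le.1 t1).2
    rw [hIx]
    linarith
  have hi : Integrable fun x => pcut a c (‖x‖ ^ 2) * |head u p x| :=
    integrable_of_continuousOn (isCompact_ann c) (ann_subset c)
      ((contDiff_radial (contDiff_pcut a hc)).continuous.continuousOn.mul
        h.ns.smooth_head.continuousOn.abs) fun x hx => by rw [pcut_off a hx, zero_mul]
  have j1 := hgi.const_mul (2 * k)
  have j2 := hKi.const_mul (C * ((n * A) ^ 2 + A))
  have j12 : Integrable fun x => 2 * k * g x + C * ((n * A) ^ 2 + A) * tw c x := j1.add j2
  have j3 := hI.const_mul (1 / 2)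
  refine (integral_mono hi (j12.sub j3) hle).trans ?_
  rw [integral_sub' j12 j3, integral_add j1 j2]
  simp only [integral_const_mul, hI0, mul_zero, sub_zero]
  have : 0 ≤ C * ((n * A) ^ 2 + A) := by positivity
  linarith [mul_le_mul_of_nonneg_left hKK this]

end

section

variable {n : ℕ} {A : ℝ} {u : Fin n → E n → ℝ} {p : E n → ℝ}

/-- The squared norm of the velocity gradient. -/
noncomputable def gsq (u : Fin n → E n → ℝ) (x : E n) : ℝ := ∑ i, ∑ j, pd i (u j) x * pd i (u j) x

theorem gsq_nonneg (x : E n) : 0 ≤ gsq u x :=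
  Finset.sum_nonneg fun _ _ => Finset.sum_nonneg fun _ _ => mul_self_nonneg _

theorem energy_algebra {N b w d e s t H θ θ1 θ2 A C g : ℝ} (hN : 0 ≤ N) (hb : b = 2 + -N / 2)
    (hb0 : b ≤ 0) (m1 : |s * e * (w * (s * θ1))| ≤ N * A ^ 2 * (C * t))
    (m2 : |s * e * (w * (s ^ 2 * θ2))| ≤ N * A ^ 2 * (C * t))
    (m3 : |d * (H * s) * (w * (s * θ1))| ≤ N * A * (N * A ^ 2 + A) * (C * t))
    (m4 : |d * H * (s * w * θ)| ≤ N * A * |H| * (s * w * θ)) (m5 : 0 ≤ e * (s * w * θ)) :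
    s * (s * w) * θ * g ≤
      (g * (s * (s * w) * θ) - 1 / 2 * e * (2 * N * (b * (s * w) * θ + s * (s * w) * θ1) +
        4 * s * (b * (b - 1) * w * θ + 2 * b * (s * w) * θ1 + s * (s * w) * θ2)) -
        H * (2 * (b * (s * w) * θ + s * (s * w) * θ1) * d)) +
      (N * A ^ 2 * ((N + 8) * C) + 2 * (N * A ^ 2) * C + 2 * (N * A) * (N * A ^ 2 + A) * C) * t +
      2 * (N * A) * (-b * (s * w * θ * |H|)) := by
  have m5' := mul_nonneg (neg_nonneg.2 hb0) m5
  have m4' := mul_le_mul_of_nonneg_left ((abs_le.1 m4).1) (neg_nonneg.2 hb0)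
  have m6 : (8 - N) * (s * e * (w * (s * θ1))) ≤ (N + 8) * (N * A ^ 2 * (C * t)) := by
    refine (le_abs_self _).trans ?_
    rw [abs_mul]
    exact mul_le_mul (abs_le.2 ⟨by linarith, by linarith⟩) m1 (abs_nonneg _) (by positivity)
  have m2' := (abs_le.1 m2).2
  have m3' := (abs_le.1 m3).2
  have hid : 2 * N * (b * (s * w) * θ + s * (s * w) * θ1) +
      4 * s * (b * (b - 1) * w * θ + 2 * b * (s * w) * θ1 + s * (s * w) * θ2) =
      4 * b * (s * w * θ) + (16 - 2 * N) * (s * (w * (s * θ1))) + 4 * (s * (w * (s ^ 2 * θ2))) := by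
    rw [hb]; ring
  rw [hid]
  linarith

theorem energy_pointwise (h : Sing A u p) {C c b : ℝ} (hb : b = 2 + -(n : ℝ) / 2) (hb0 : b ≤ 0)
    (hs : Sym C (cut c)) (hc : 0 < c) {x : E n} (hx : x ∈ PB n) :
    pcut b c (‖x‖ ^ 2) * gsq u x ≤
      (gsq u x * pcut b c (‖x‖ ^ 2) - 1 / 2 * (∑ j, u j x * u j x) *
        lap (fun y => pcut b c (‖y‖ ^ 2)) x -
        head u p x * ∑ i, u i x * pd i (fun y => pcut b c (‖y‖ ^ 2)) x) +
      (n * A ^ 2 * ((n + 8) * C) + 2 * (n * A ^ 2) * C +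
        2 * (n * A) * (n * A ^ 2 + A) * C) * tw c x +
      2 * (n * A) * (-b * (pcut (1 + -(n : ℝ) / 2) c (‖x‖ ^ 2) * |head u p x|)) := by
  have hp : 0 < ‖x‖ := norm_pos_iff.2 hx.2
  have hsp : 0 < ‖x‖ ^ 2 := by positivity
  have hA := h.nonneg
  have hC : 0 ≤ C := (abs_nonneg _).trans (hs.b0 1 one_pos)
  have hE := contDiff_pcut b hc
  obtain ⟨d1, d2⟩ := deriv_pcut b c hsp
  have hw0 : 0 ≤ (‖x‖ ^ 2) ^ (-(n : ℝ) / 2) := by positivity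
  have r1' : (‖x‖ ^ 2) ^ (1 + -(n : ℝ) / 2) = ‖x‖ ^ 2 * (‖x‖ ^ 2) ^ (-(n : ℝ) / 2) := by
    rw [Real.rpow_add hsp, Real.rpow_one]
  have r1 : (‖x‖ ^ 2) ^ (b - 1) = ‖x‖ ^ 2 * (‖x‖ ^ 2) ^ (-(n : ℝ) / 2) := by
    rw [show b - 1 = 1 + -(n : ℝ) / 2 by rw [hb]; ring, r1']
  have r2 : (‖x‖ ^ 2) ^ (b - 2) = (‖x‖ ^ 2) ^ (-(n : ℝ) / 2) := by
    rw [show b - 2 = -(n : ℝ) / 2 by rw [hb]; ring]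
  have r0 : (‖x‖ ^ 2) ^ b = ‖x‖ ^ 2 * (‖x‖ ^ 2 * (‖x‖ ^ 2) ^ (-(n : ℝ) / 2)) := by
    rw [show b = 1 + (1 + -(n : ℝ) / 2) by rw [hb]; ring, Real.rpow_add hsp, Real.rpow_one, r1']
  have e1 : ∑ i, u i x * pd i (fun y => pcut b c (‖y‖ ^ 2)) x =
      2 * deriv (pcut b c) (‖x‖ ^ 2) * ∑ i, x i * u i x := by
    rw [Finset.mul_sum]
    exact Finset.sum_congr rfl fun i _ => by rw [pd_radial' hE]; ring
  obtain ⟨w1, w2⟩ := cut_deriv_tw hs hx.2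
  have hd := h.abs_dot_le hx
  have hh := head_bound h hx
  rw [le_div_iff₀ hsp] at hh
  have hu : ‖x‖ ^ 2 * ∑ j, u j x * u j x ≤ n * A ^ 2 := by
    rw [Finset.mul_sum]
    refine (Finset.sum_le_sum (g := fun _ => A ^ 2) fun j _ => ?_).trans_eq (by simp)
    have := h.bu j x hx
    rw [le_div_iff₀ hp] at this
    have := pow_le_pow_left₀ (by positivity) this 2
    rw [mul_pow, sq_abs] at this
    linarith
  have hu0 : 0 ≤ ∑ j, u j x * u j x := Finset.sum_nonneg fun j _ => mul_self_nonneg _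
  have hcut := cut_nonneg c (‖x‖ ^ 2)
  have htw := tw_nonneg c x
  have hn0 : (0 : ℝ) ≤ n := Nat.cast_nonneg n
  rw [e1, lap_radial hE, d1, d2, pcut, pcut, r0, r1, r1', r2]
  clear e1 d1 d2 r0 r1 r1' r2 hE
  generalize (‖x‖ ^ 2) ^ (-(n : ℝ) / 2) = w at *
  generalize ∑ i, x i * u i x = d at *
  generalize ∑ j, u j x * u j x = e at *
  generalize tw c x = t at *
  generalize head u p x = H at *
  generalize deriv (deriv (cut c)) (‖x‖ ^ 2) = θ2 at *
  generalize deriv (cut c) (‖x‖ ^ 2) = θ1 at *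
  generalize cut c (‖x‖ ^ 2) = θ at *
  generalize gsq u x = g at *
  generalize ‖x‖ ^ 2 = s at *
  refine energy_algebra hn0 hb hb0 ?_ ?_ ?_ ?_ (by positivity)
  · rw [abs_mul, abs_of_nonneg (by positivity : 0 ≤ s * e), abs_mul w, abs_of_nonneg hw0]
    exact mul_le_mul hu w1 (by positivity) (by positivity)
  · rw [abs_mul, abs_of_nonneg (by positivity : 0 ≤ s * e), abs_mul w, abs_of_nonneg hw0]
    exact mul_le_mul hu w2 (by positivity) (by positivity)
  · rw [abs_mul, abs_mul d, abs_mul H, abs_of_pos hsp, abs_mul w, abs_of_nonneg hw0]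
    exact mul_le_mul (mul_le_mul hd hh (by positivity) (by positivity)) w1 (by positivity) (by positivity)
  · rw [abs_mul, abs_mul d, abs_of_nonneg (by positivity : 0 ≤ s * w * θ)]
    gcongr

/-- The weighted Dirichlet integral is bounded. -/
theorem Sing.int_grad (hn : 4 ≤ n) (h : Sing A u p) : ∃ K, ∀ c > 0,
    ∫ x, pcut (2 + -(n : ℝ) / 2) c (‖x‖ ^ 2) * gsq u x ≤ K := by
  obtain ⟨C, hC, hs⟩ := exists_sym_cut
  obtain ⟨K, hK0, hK⟩ := tw_bound (n := n)
  have hA := h.nonneg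
  set b : ℝ := 2 + -(n : ℝ) / 2 with hb
  have hn' : (4 : ℝ) ≤ n := by exact_mod_cast hn
  have hb0 : b ≤ 0 := by rw [hb]; linarith
  obtain ⟨K', hK'⟩ : ∃ K', ∀ c > 0, -b * ∫ x, pcut (1 + -(n : ℝ) / 2) c (‖x‖ ^ 2) *
      |head u p x| ≤ K' := by
    rcases hn.lt_or_eq with h5 | h4
    · obtain ⟨K', hK'⟩ := h.int_head h5
      exact ⟨-b * K', fun c hc => mul_le_mul_of_nonneg_left (hK' c hc) (neg_nonneg.2 hb0)⟩
    · refine ⟨0, fun c hc => ?_⟩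
      rw [show b = 0 by rw [hb, ← h4]; norm_num]
      simp
  set D := n * A ^ 2 * ((n + 8) * C) + 2 * (n * A ^ 2) * C +
        2 * (n * A) * (n * A ^ 2 + A) * C with hD
  have hD0 : 0 ≤ D := by positivity
  refine ⟨D * K + 2 * (n * A) * K', fun c hc => ?_⟩
  have hU := isOpen_PB (n := n)
  have hη := contDiff_radial (n := n) (contDiff_pcut b hc)
  have hη0 : ∀ x ∉ ann n c, pcut b c (‖x‖ ^ 2) = 0 := fun x hx => pcut_off b hx
  have hcl := (isCompact_ann (n := n) c).isClosed
  have hen := h.ns.energy hη.contDiffOn (isCompact_ann c) (ann_subset c) hη0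
  set I : E n → ℝ := fun x => gsq u x * pcut b c (‖x‖ ^ 2) - 1 / 2 * (∑ j, u j x * u j x) *
        lap (fun y => pcut b c (‖y‖ ^ 2)) x -
        head u p x * ∑ i, u i x * pd i (fun y => pcut b c (‖y‖ ^ 2)) x with hI
  have hIz : ∀ x ∉ ann n c, I x = 0 := fun x hx => by
    have hl := lap_eq_zero_off hcl hη0 x hx
    have hd := fun i => pd_eq_zero_off hcl hη0 i x hx
    simp [hI, hl, hd, hη0 x hx]
  have cu := fun j => (h.ns.smooth_u j).continuousOn
  have cdu := fun i j => (h.ns.smooth_du i j).continuousOn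
  have cg : ContinuousOn (gsq u) (PB n) := continuousOn_finsetSum _ fun i _ =>
    continuousOn_finsetSum _ fun j _ => (cdu i j).mul (cdu i j)
  have cη := hη.continuous.continuousOn (s := PB n)
  have hIi : Integrable I := by
    refine integrable_of_continuousOn (isCompact_ann c) (ann_subset c) (((cg.mul cη).sub
      ((continuousOn_const.mul (continuousOn_finsetSum _ fun j _ => (cu j).mul (cu j))).mul
        (contDiffOn_lap hU hη.contDiffOn).continuousOn)).sub (h.ns.smooth_head.continuousOn.mul
      (continuousOn_finsetSum _ fun i _ => (cu i).mul (contDiff_pd hη).continuous.continuousOn))) hIz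
  have hle : ∀ x, pcut b c (‖x‖ ^ 2) * gsq u x ≤ I x + D * tw c x +
      2 * (n * A) * (-b * (pcut (1 + -(n : ℝ) / 2) c (‖x‖ ^ 2) * |head u p x|)) := by
    intro x
    by_cases hx : x ∈ ann n c
    · exact energy_pointwise h hb hb0 (hs c hc) hc (ann_subset c hx)
    · rw [hη0 x hx, hIz x hx, pcut_off _ hx]
      have := mul_nonneg hD0 (tw_nonneg c x)
      simpa using this
  have i1 : Integrable fun x => pcut b c (‖x‖ ^ 2) * gsq u x :=
    integrable_of_continuousOn (isCompact_ann c) (ann_subset c) (cη.mul cg)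
      fun x hx => by rw [hη0 x hx, zero_mul]
  have i2 : Integrable fun x => pcut (1 + -(n : ℝ) / 2) c (‖x‖ ^ 2) * |head u p x| :=
    integrable_of_continuousOn (isCompact_ann c) (ann_subset c)
      ((contDiff_radial (contDiff_pcut _ hc)).continuous.continuousOn.mul
        h.ns.smooth_head.continuousOn.abs) fun x hx => by rw [pcut_off _ hx, zero_mul]
  obtain ⟨hKi, hKK⟩ := hK c hc
  have j2 := hKi.const_mul D
  have j3 := (i2.const_mul (-b)).const_mul (2 * (n * A))
  have j12 : Integrable fun x => I x + D * tw c x := hIi.add j2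
  refine (integral_mono i1 (j12.add j3) hle).trans ?_
  rw [integral_add' j12 j3, integral_add hIi j2]
  have hI0 : ∫ x, I x = 0 := hen
  simp only [integral_const_mul, hI0, zero_add]
  exact add_le_add (mul_le_mul_of_nonneg_left hKK hD0)
    (mul_le_mul_of_nonneg_left (hK' c hc) (by positivity))

end

section

variable {n : ℕ} {A : ℝ} {u : Fin n → E n → ℝ} {p : E n → ℝ}

theorem Sing.integrableOn_grad (hn : 4 ≤ n) (h : Sing A u p) :
    IntegrableOn (fun x => (‖x‖ ^ 2) ^ (2 + -(n : ℝ) / 2) * gsq u x) (Metric.ball 0 (1 / 8)) := by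
  obtain ⟨K, hK⟩ := h.int_grad hn
  set b : ℝ := 2 + -(n : ℝ) / 2
  set φ : ℕ → Set (E n) := fun N => {x | 2 ≤ ((N : ℝ) + 1) * ‖x‖ ^ 2} with hφ
  have hφm : ∀ N, MeasurableSet (φ N) := fun N => measurableSet_le (by fun_prop) (by fun_prop)
  have hcov : AECover (volume.restrict (Metric.ball (0 : E n) (1 / 8))) atTop φ := by
    refine ⟨?_, hφm⟩
    refine ae_restrict_of_ae ?_
    filter_upwards [ae_ne_zero (n := n) (by omega)] with x hx
    have hp : 0 < ‖x‖ ^ 2 := by have := norm_pos_iff.2 hx; positivity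
    have : Tendsto (fun N : ℕ => ((N : ℝ) + 1) * ‖x‖ ^ 2) atTop atTop :=
      (tendsto_natCast_atTop_atTop.atTop_add tendsto_const_nhds).atTop_mul_const hp
    exact this.eventually_ge_atTop 2
  have cg : ContinuousOn (gsq u) (PB n) := continuousOn_finsetSum _ fun i _ =>
    continuousOn_finsetSum _ fun j _ => (h.ns.smooth_du i j).continuousOn.mul
      (h.ns.smooth_du i j).continuousOn
  have hi : ∀ N : ℕ, Integrable fun x => pcut b (N + 1) (‖x‖ ^ 2) * gsq u x := fun N =>
    integrable_of_continuousOn (isCompact_ann _) (ann_subset _)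
      ((contDiff_radial (contDiff_pcut b (by positivity))).continuous.continuousOn.mul cg)
      fun x hx => by rw [pcut_off b hx, zero_mul]
  have heq : ∀ N : ℕ, EqOn (fun x => pcut b (N + 1) (‖x‖ ^ 2) * gsq u x)
      (fun x => (‖x‖ ^ 2) ^ b * gsq u x) (φ N ∩ Metric.ball 0 (1 / 8)) := fun N x hx => by
    have h1 : ‖x‖ < 1 / 8 := by simpa using hx.2
    have : 64 * ‖x‖ ^ 2 ≤ 1 := by nlinarith [norm_nonneg x]
    simp only [pcut, cut_one hx.1 this, mul_one]
  have hm := fun N => (hφm N).inter (measurableSet_ball (x := (0 : E n)) (ε := 1 / 8))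
  refine hcov.integrable_of_integral_bounded_of_nonneg_ae K (fun N => ?_)
    (Eventually.of_forall fun x => mul_nonneg (by positivity) (gsq_nonneg x))
    (Eventually.of_forall fun N => ?_)
  · rw [IntegrableOn, Measure.restrict_restrict (hφm N)]
    exact (hi N).integrableOn.congr_fun (heq N) (hm N)
  · rw [Measure.restrict_restrict (hφm N), ← setIntegral_congr_fun (hm N) (heq N)]
    exact (setIntegral_le_integral (hi N) (Eventually.of_forall fun x =>
      mul_nonneg (mul_nonneg (by positivity) (cut_nonneg _ _)) (gsq_nonneg x))).trans
      (hK _ (by positivity))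

theorem tendsto_integral_ball (hn : 0 < n) {f : E n → ℝ} {r : ℝ} (hr : 0 < r)
    (hf : IntegrableOn f (Metric.ball 0 r)) {δ : ℝ} (hδ : 0 ≤ δ) :
    Tendsto (fun x => ∫ y in Metric.ball x (δ * ‖x‖), f y) (𝓝 0) (𝓝 0) := by
  have hμ : Tendsto (fun x : E n => ENNReal.ofReal ((δ * ‖x‖) ^ n) * volume (Metric.ball (0 : E n) 1))
      (𝓝 0) (𝓝 0) := by
    have c : Continuous fun x : E n => ENNReal.ofReal ((δ * ‖x‖) ^ n) :=
      ENNReal.continuous_ofReal.comp (by fun_prop)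
    have := ENNReal.Tendsto.mul_const (b := volume (Metric.ball (0 : E n) 1)) (c.tendsto 0)
      (Or.inr measure_ball_lt_top.ne)
    simpa [hn.ne'] using this
  have hs : Tendsto (volume.restrict (Metric.ball (0 : E n) r) ∘ fun x => Metric.ball x (δ * ‖x‖))
      (𝓝 0) (𝓝 0) := by
    refine tendsto_of_tendsto_of_tendsto_of_le_of_le tendsto_const_nhds hμ (fun _ => zero_le)
      fun x => (Measure.restrict_apply_le _ _).trans
        ((measure_mono Metric.ball_subset_closedBall).trans_eq ?_)
    rw [Measure.addHaar_closedBall _ _ (by positivity)]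
    simp
  refine (Integrable.tendsto_setIntegral_nhds_zero hf hs).congr' ?_
  have c : Continuous fun x : E n => (1 + δ) * ‖x‖ := by fun_prop
  have : ∀ᶠ x : E n in 𝓝 0, (1 + δ) * ‖x‖ < r :=
    c.continuousAt.eventually (gt_mem_nhds (by simpa using hr))
  filter_upwards [this] with x hx
  rw [Measure.restrict_restrict measurableSet_ball, inter_eq_left.2]
  intro y hy
  rw [Metric.mem_ball, dist_eq_norm] at hy
  rw [Metric.mem_ball, dist_zero_right]
  have := norm_add_le (y - x) x
  rw [sub_add_cancel] at this
  linarith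

/-- If the gradient is large at a point, it is large on a proportional ball. -/
theorem Sing.grad_persist (h : Sing A u p) {ε δ : ℝ} (hδ0 : 0 < δ) (hδ : δ ≤ 1 / 4)
    (hδε : 6 * (n * A) * δ ≤ ε) {x : E n} (hx0 : x ≠ 0) (hx : ‖x‖ < 1 / 8) {i j : Fin n}
    (hε : ε / ‖x‖ ^ 2 ≤ |pd i (u j) x|) {y : E n} (hy : y ∈ Metric.ball x (δ * ‖x‖)) :
    ε / 2 / ‖x‖ ^ 2 ≤ |pd i (u j) y| := by
  have hp : 0 < ‖x‖ := norm_pos_iff.2 hx0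
  have hA := h.nonneg
  have key : ∀ z ∈ Metric.ball x (δ * ‖x‖), z ∈ PB n ∧ 3 / 4 * ‖x‖ ≤ ‖z‖ := by
    intro z hz
    rw [Metric.mem_ball, dist_eq_norm] at hz
    have h1 := norm_sub_norm_le x z
    rw [norm_sub_rev] at h1
    have h2 := norm_sub_norm_le z x
    have h3 : δ * ‖x‖ ≤ 1 / 4 * ‖x‖ := by gcongr
    have h4 : 3 / 4 * ‖x‖ ≤ ‖z‖ := by linarith
    refine ⟨⟨?_, ?_⟩, h4⟩
    · rw [Metric.mem_ball, dist_zero_right]; linarith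
    · rintro rfl; rw [norm_zero] at h4; linarith
  have hb : ∀ z ∈ Metric.ball x (δ * ‖x‖), ‖fderiv ℝ (pd i (u j)) z‖ ≤ 3 * (n * A) / ‖x‖ ^ 3 := by
    intro z hz
    obtain ⟨hzU, hzx⟩ := key z hz
    refine (norm_fderiv_le_sum _ _).trans ((Finset.sum_le_sum fun l _ => h.bddu l i j z hzU).trans ?_)
    simp only [Finset.sum_const, Finset.card_univ, Fintype.card_fin, nsmul_eq_mul]
    have : ‖x‖ ^ 3 ≤ 3 * ‖z‖ ^ 3 := by
      have := pow_le_pow_left₀ (by positivity) hzx 3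
      nlinarith [pow_pos hp 3]
    have hz0 : 0 < ‖z‖ := by linarith
    rw [← mul_div_assoc, div_le_div_iff₀ (by positivity) (by positivity)]
    have := mul_le_mul_of_nonneg_left this (by positivity : 0 ≤ n * A)
    linarith
  have hl := (convex_ball x (δ * ‖x‖)).norm_image_sub_le_of_norm_fderiv_le
    (fun z hz => h.ns.diff_du (key z hz).1 i j) hb hy (Metric.mem_ball_self (by positivity))
  rw [Metric.mem_ball, dist_comm, dist_eq_norm] at hy
  have h1 : 3 * (n * A) / ‖x‖ ^ 3 * ‖x - y‖ ≤ ε / 2 / ‖x‖ ^ 2 := by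
    calc _ ≤ 3 * (n * A) / ‖x‖ ^ 3 * (δ * ‖x‖) := by gcongr
      _ = 3 * (n * A) * δ / ‖x‖ ^ 2 := by field_simp
      _ ≤ _ := by gcongr; linarith
  have h2 := abs_sub_abs_le_abs_sub (pd i (u j) x) (pd i (u j) y)
  rw [Real.norm_eq_abs] at hl
  have h3 : ε / ‖x‖ ^ 2 = ε / 2 / ‖x‖ ^ 2 + ε / 2 / ‖x‖ ^ 2 := by ring
  linarith

theorem Sing.grad_decay (hn : 4 ≤ n) (h : Sing A u p) {ε : ℝ} (hε : 0 < ε) :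
    ∀ᶠ x in 𝓝 (0 : E n), x ≠ 0 → ∀ i j, |pd i (u j) x| ≤ ε / ‖x‖ ^ 2 := by
  have hA := h.nonneg
  have hI := h.integrableOn_grad hn
  set b : ℝ := 2 + -(n : ℝ) / 2 with hb
  have hn' : (4 : ℝ) ≤ n := by exact_mod_cast hn
  have hb0 : b ≤ 0 := by rw [hb]; linarith
  set δ : ℝ := min (1 / 4) (ε / (6 * (n * A) + 1)) with hδ
  have hδ0 : 0 < δ := by positivity
  have hδε : 6 * (n * A) * δ ≤ ε := by
    have : δ ≤ ε / (6 * (n * A) + 1) := min_le_right _ _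
    rw [le_div_iff₀ (by positivity)] at this
    linarith
  set v := volume.real (Metric.ball (0 : E n) 1) with hv
  have hv0 : 0 < v := ENNReal.toReal_pos (Metric.measure_ball_pos _ _ one_pos).ne' measure_ball_lt_top.ne
  have hτ : 0 < 4 ^ b * (ε / 2) ^ 2 * δ ^ n * v := by positivity
  have ht := (tendsto_integral_ball (by omega) (by norm_num) hI hδ0.le).eventually (gt_mem_nhds hτ)
  have hnear : ∀ᶠ x in 𝓝 (0 : E n), ‖x‖ < 1 / 16 :=
    continuous_norm.continuousAt.eventually (gt_mem_nhds (by simp))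
  filter_upwards [ht, hnear] with x hx hx8 hx0 i j
  by_contra hcon
  rw [not_le] at hcon
  refine absurd hx (not_lt.2 ?_)
  have hp : 0 < ‖x‖ := norm_pos_iff.2 hx0
  have hδ4 : δ ≤ 1 / 4 := min_le_left _ _
  have hδx : δ * ‖x‖ ≤ 1 / 4 * ‖x‖ := by gcongr
  have hyx : ∀ y ∈ Metric.ball x (δ * ‖x‖), 0 < ‖y‖ ∧ ‖y‖ ≤ 2 * ‖x‖ := by
    intro y hy
    rw [Metric.mem_ball, dist_eq_norm] at hy
    have h1 := norm_sub_norm_le x y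
    rw [norm_sub_rev] at h1
    have h2 := norm_sub_norm_le y x
    exact ⟨by linarith, by linarith⟩
  have hsub : Metric.ball x (δ * ‖x‖) ⊆ Metric.ball 0 (1 / 8) := fun y hy => by
    rw [Metric.mem_ball, dist_zero_right]
    linarith [hyx y hy]
  have hlow : ∀ y ∈ Metric.ball x (δ * ‖x‖), (4 * ‖x‖ ^ 2) ^ b * (ε / 2 / ‖x‖ ^ 2) ^ 2 ≤
      (‖y‖ ^ 2) ^ b * gsq u y := by
    intro y hy
    obtain ⟨hy0, hy2⟩ := hyx y hy
    refine mul_le_mul ?_ ?_ (by positivity) (by positivity)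
    · exact Real.rpow_le_rpow_of_nonpos (by positivity) (by nlinarith) hb0
    · have h1 := h.grad_persist hδ0 hδ4 hδε hx0 (by linarith) hcon.le hy
      have h2 := pow_le_pow_left₀ (by positivity) h1 2
      rw [sq_abs, sq] at h2
      rw [sq]
      refine h2.trans ?_
      rw [sq, gsq]
      have := Finset.single_le_sum (f := fun j => pd i (u j) y * pd i (u j) y)
        (fun j _ => mul_self_nonneg _) (Finset.mem_univ j)
      refine this.trans ?_
      exact Finset.single_le_sum (f := fun i => ∑ j, pd i (u j) y * pd i (u j) y)
        (fun i _ => Finset.sum_nonneg fun j _ => mul_self_nonneg _) (Finset.mem_univ i)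
  have hfin := setIntegral_ge_of_const_le_real measurableSet_ball measure_ball_lt_top.ne hlow
    (hI.mono_set hsub)
  refine le_trans (le_of_eq ?_) hfin
  have hvol : volume.real (Metric.ball x (δ * ‖x‖)) = (δ * ‖x‖) ^ n * v := by
    rw [Measure.real, Measure.addHaar_ball_of_pos _ _ (by positivity), ENNReal.toReal_mul,
      ENNReal.toReal_ofReal (by positivity)]
    simp [hv, Measure.real]
  have hpow : (‖x‖ ^ 2) ^ b = (‖x‖ ^ 2) ^ 2 * (‖x‖ ^ n)⁻¹ := by
    rw [hb, Real.rpow_add (by positivity), norm_sq_rpow x]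
    congr 1
    rw [← Real.rpow_natCast (‖x‖ ^ 2) 2, Nat.cast_ofNat]
  rw [hvol, Real.mul_rpow (by norm_num) (by positivity), hpow, mul_pow δ]
  field_simp

theorem Sing.decay (hn : 4 ≤ n) (h : Sing A u p) {ε : ℝ} (hε : 0 < ε) :
    ∃ ρ > 0, ρ ≤ 1 / 8 ∧ ∀ x : E n, x ≠ 0 → ‖x‖ < ρ → ∀ j, |u j x| ≤ ε / ‖x‖ := by
  have hA := h.nonneg
  have hn0 : (0 : ℝ) < n := by exact_mod_cast (by omega : 0 < n)
  obtain ⟨r, hr, hd⟩ := Metric.eventually_nhds_iff.1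
    (h.grad_decay hn (by positivity : 0 < ε / (2 * n)))
  set r0 := min (r / 2) (1 / 8) with hr0
  have hr0p : 0 < r0 := by positivity
  have hr0r : r0 < r := (min_le_left _ _).trans_lt (by linarith)
  have hr08 : r0 ≤ 1 / 8 := min_le_right _ _
  refine ⟨min r0 (r0 * (ε / (2 * (A + 1)))), by positivity, (min_le_left _ _).trans hr08,
    fun x hx0 hx j => ?_⟩
  have hp : 0 < ‖x‖ := norm_pos_iff.2 hx0
  have hxr : ‖x‖ < r0 := hx.trans_le (min_le_left _ _)
  have hx2 := hx.trans_le (min_le_right _ _)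
  have hb := radial_bound (f := u j) (G := fun s => ε / 2 * s⁻¹) (G' := fun s => ε / 2 * -(s ^ 2)⁻¹) (r0 := r0)
    hx0 hxr.le (fun y hy hyr => by
      have hyp : 0 < ‖y‖ := hp.trans_le hy
      have hy0 := norm_pos_iff.1 hyp
      have hyU : y ∈ PB n := ⟨by rw [Metric.mem_ball, dist_zero_right]; linarith, hy0⟩
      refine ⟨h.ns.diff_u hyU j, (norm_fderiv_le_sum _ _).trans ((Finset.sum_le_sum fun i _ =>
        hd (by rw [dist_zero_right]; linarith) hy0 i j).trans_eq ?_)⟩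
      simp only [Finset.sum_const, Finset.card_univ, Fintype.card_fin, nsmul_eq_mul]
      field_simp) (fun s hs => (hasDerivAt_inv (hp.trans_le hs.1).ne').const_mul _)
  have hnorm : ‖(r0 / ‖x‖) • x‖ = r0 := by
    rw [norm_smul, Real.norm_of_nonneg (by positivity), div_mul_cancel₀ _ hp.ne']
  have hu := h.bu j ((r0 / ‖x‖) • x) ⟨by rw [Metric.mem_ball, dist_zero_right, hnorm]; linarith,
    by rw [mem_singleton_iff, ← norm_eq_zero, hnorm]; exact hr0p.ne'⟩
  rw [hnorm] at hu
  have h1 : A / r0 ≤ ε / 2 * ‖x‖⁻¹ := by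
    rw [← mul_div_assoc, lt_div_iff₀ (by positivity)] at hx2
    rw [div_le_iff₀ hr0p, ← div_eq_mul_inv, div_mul_eq_mul_div, le_div_iff₀ hp]
    nlinarith
  have h2 : 0 ≤ ε / 2 * r0⁻¹ := by positivity
  have h3 : ε / ‖x‖ = ε / 2 * ‖x‖⁻¹ + ε / 2 * ‖x‖⁻¹ := by ring
  linarith

end

section

variable {n : ℕ} {A : ℝ} {u : Fin n → E n → ℝ} {p : E n → ℝ}

/-- The profile of the dyadic potential estimate. -/
noncomputable def mm (s : ℝ) : ℝ := min s (s ^ (-(1 / 4) : ℝ))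

theorem sum_mm : ∃ K, 0 ≤ K ∧ ∀ s > 0, ∀ N : ℕ, ∑ j ∈ Finset.range N, mm (s * (1 / 2) ^ j) ≤ K := by
  set q : ℝ := (1 / 2) ^ (1 / 4 : ℝ) with hq
  have hq0 : 0 < q := by positivity
  have hq1 : q < 1 := Real.rpow_lt_one (by norm_num) (by norm_num) (by norm_num)
  set G : ℝ → ℝ := fun s => s ^ (1 / 4 : ℝ) / (1 + s ^ (1 / 4 : ℝ)) with hG
  have key : ∀ s > 0, mm s ≤ 4 / (1 - q) * (G s - G (s * (1 / 2))) := by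
    intro s hs
    have e1 : (s * (1 / 2)) ^ (1 / 4 : ℝ) = q * s ^ (1 / 4 : ℝ) := by
      rw [Real.mul_rpow hs.le (by norm_num), mul_comm]
    have e2 : s = (s ^ (1 / 4 : ℝ)) ^ 4 := by
      rw [← Real.rpow_natCast, ← Real.rpow_mul hs.le]; norm_num
    have e3 : s ^ (-(1 / 4) : ℝ) = (s ^ (1 / 4 : ℝ))⁻¹ := Real.rpow_neg hs.le _
    have hσ : 0 < s ^ (1 / 4 : ℝ) := by positivity
    have e4 : min s ((s ^ (1 / 4 : ℝ))⁻¹) = min ((s ^ (1 / 4 : ℝ)) ^ 4) ((s ^ (1 / 4 : ℝ))⁻¹) := by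
      rw [← e2]
    simp only [hG, mm, e1, e3]
    rw [e4]
    clear_value q
    clear e1 e2 e3 e4
    generalize s ^ (1 / 4 : ℝ) = σ at hσ
    have h1 : σ / (1 + σ) - q * σ / (1 + q * σ) = (1 - q) * σ / ((1 + σ) * (1 + q * σ)) := by
      field_simp; ring
    have h2 : 4 / (1 - q) * ((1 - q) * σ / ((1 + σ) * (1 + q * σ))) = 4 * σ / ((1 + σ) * (1 + q * σ)) := by
      have : 1 - q ≠ 0 := by linarith
      field_simp
    rw [h1, h2, le_div_iff₀ (by positivity)]
    have h3 : (1 + σ) * (1 + q * σ) ≤ (1 + σ) * (1 + σ) := by gcongr; nlinarith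
    rcases le_total σ 1 with h | h
    · have h4 : (1 + σ) * (1 + σ) ≤ 4 := by nlinarith
      have h5 : σ ^ 4 ≤ σ := by
        have := pow_le_one₀ (n := 3) hσ.le h
        nlinarith
      calc _ ≤ σ * 4 := mul_le_mul ((min_le_left _ _).trans h5) (h3.trans h4) (by positivity) hσ.le
        _ = _ := mul_comm _ _
    · have h4 : (1 + σ) * (1 + σ) ≤ 4 * σ ^ 2 := by nlinarith
      calc _ ≤ σ⁻¹ * (4 * σ ^ 2) := mul_le_mul (min_le_right _ _) (h3.trans h4) (by positivity) (by positivity)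
        _ = _ := by field_simp
  have hG0 : ∀ s > 0, 0 ≤ G s ∧ G s ≤ 1 := fun s hs =>
    ⟨by positivity, (div_le_one (by positivity)).2 (by linarith)⟩
  have h1q : 0 < 1 - q := by linarith
  refine ⟨4 / (1 - q), by positivity, fun s hs N => ?_⟩
  have : ∑ j ∈ Finset.range N, mm (s * (1 / 2) ^ j) ≤ 4 / (1 - q) * (G s - G (s * (1 / 2) ^ N)) := by
    induction N with
    | zero => simp
    | succ N ih =>
      rw [Finset.sum_range_succ, pow_succ, ← mul_assoc]
      have := key (s * (1 / 2) ^ N) (by positivity)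
      linarith
  refine this.trans (mul_le_of_le_one_right (by positivity) ?_)
  have := (hG0 _ (by positivity : 0 < s * (1 / 2) ^ N)).1
  linarith [(hG0 s hs).2]

/-- Weighted average of a power of the norm. -/
noncomputable def av (K : E n → ℝ) (t a : ℝ) (x : E n) : ℝ := ∫ z, |K z| * ‖x - t • z‖ ^ (-a)

theorem av_le (hn : 0 < n) {K : E n → ℝ} (hK : Ker K) {a : ℝ} (ha : 0 ≤ a) (han : a < n) :
    ∃ C, 0 ≤ C ∧ ∀ t > 0, ∀ x, Integrable (fun z => |K z| * ‖x - t • z‖ ^ (-a)) ∧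
      av K t a x ≤ C * t ^ (-a) := by
  obtain ⟨M, hM0, hM⟩ := hK.bounded
  set h : E n → ℝ := (Metric.ball (0 : E n) 1).indicator fun y => ‖y‖ ^ (-a) with hh
  have hi : Integrable h := (integrable_indicator_iff measurableSet_ball).2
    (integrableOn_rpow_norm hn han 1)
  have hh0 : ∀ y, 0 ≤ h y := fun y => indicator_nonneg (fun _ _ => by positivity) _
  have hy : ∀ y : E n, ‖y‖ ^ (-a) ≤ 1 + h y := by
    intro y
    by_cases hy : y ∈ Metric.ball (0 : E n) 1
    · rw [hh, indicator_of_mem hy]; linarith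
    · rw [hh, indicator_of_notMem hy, add_zero]
      rw [Metric.mem_ball, dist_zero_right, not_lt] at hy
      exact Real.rpow_le_one_of_one_le_of_nonpos hy (by linarith)
  have hI0 : 0 ≤ ∫ y, h y := integral_nonneg hh0
  refine ⟨L1 K + M * ∫ y, h y, by have := L1_nonneg K; positivity, fun t ht x => ?_⟩
  have e : ∀ z, ‖x - t • z‖ ^ (-a) = t ^ (-a) * ‖t⁻¹ • x - z‖ ^ (-a) := fun z => by
    rw [← Real.mul_rpow ht.le (norm_nonneg _)]
    congr 1
    rw [← Real.norm_of_nonneg ht.le, ← norm_smul, Real.norm_of_nonneg ht.le, smul_sub, smul_inv_smul₀ ht.ne']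
  have hle : ∀ z, |K z| * ‖x - t • z‖ ^ (-a) ≤ t ^ (-a) * (|K z| + M * h (t⁻¹ • x - z)) := fun z => by
    rw [e z, mul_left_comm]
    refine mul_le_mul_of_nonneg_left ?_ (by positivity)
    have h1 := mul_le_mul_of_nonneg_left (hy (t⁻¹ • x - z)) (abs_nonneg (K z))
    have h2 := mul_le_mul_of_nonneg_right (hM z) (hh0 (t⁻¹ • x - z))
    linarith
  have hdi : Integrable fun z => |K z| + M * h (t⁻¹ • x - z) :=
    hK.integrable.abs.add ((hi.comp_sub_left _).const_mul M)
  have hInt : Integrable (fun z => |K z| * ‖x - t • z‖ ^ (-a)) := by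
    refine (hdi.const_mul (t ^ (-a))).mono' ?_ (ae_of_all _ fun z => ?_)
    · have := hK.smooth.continuous.measurable
      exact Measurable.aestronglyMeasurable (by fun_prop)
    · rw [Real.norm_of_nonneg (by positivity)]; exact hle z
  refine ⟨hInt, (integral_mono hInt (hdi.const_mul _) hle).trans_eq ?_⟩
  rw [integral_const_mul, integral_add hK.integrable.abs ((hi.comp_sub_left _).const_mul M),
    integral_const_mul, integral_sub_left_eq_self, L1, mul_comm]

theorem mul_av_le (hn : 0 < n) {K : E n → ℝ} (hK : Ker K) {a : ℝ} (ha : 5 / 4 ≤ a) (han : a < n) :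
    ∃ C, 0 ≤ C ∧ ∀ t > 0, ∀ x ≠ 0, t * av K t a x ≤ C * (‖x‖ ^ (1 - a) * mm (t / ‖x‖)) := by
  obtain ⟨C, hC, h⟩ := av_le hn hK (by linarith) han
  have hL := L1_nonneg K
  refine ⟨2 ^ a * (C + L1 K), by positivity, fun t ht x hx => ?_⟩
  have hp : 0 < ‖x‖ := norm_pos_iff.2 hx
  set s := t / ‖x‖ with hs
  have hs0 : 0 < s := by positivity
  have hts : t = ‖x‖ * s := by rw [hs]; field_simp
  rcases le_total s (1 / 2) with h1 | h1
  · have hmm : mm s = s := min_eq_left (h1.trans ((by norm_num : (1 / 2 : ℝ) ≤ 1).trans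
      (Real.one_le_rpow_of_pos_of_le_one_of_nonpos hs0 (by linarith) (by norm_num))))
    have hav : av K t a x ≤ L1 K * (2 ^ a * ‖x‖ ^ (-a)) := by
      rw [L1, ← integral_mul_const]
      refine integral_mono (h t ht x).1 (hK.integrable.abs.mul_const _) fun z => ?_
      rcases le_or_gt ‖z‖ 1 with hz | hz
      · refine mul_le_mul_of_nonneg_left ?_ (abs_nonneg _)
        have h2 : ‖x‖ / 2 ≤ ‖x - t • z‖ := by
          have h3 := norm_sub_norm_le x (t • z)
          rw [norm_smul, Real.norm_of_nonneg ht.le] at h3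
          have h4 : t * ‖z‖ ≤ t := mul_le_of_le_one_right ht.le hz
          nlinarith
        refine (Real.rpow_le_rpow_of_nonpos (by positivity) h2 (by linarith)).trans_eq ?_
        rw [Real.div_rpow hp.le (by norm_num), Real.rpow_neg (by norm_num : (0:ℝ) ≤ 2)]
        field_simp
      · simp [hK.supp z hz]
    rw [hmm]
    have e : ‖x‖ ^ (1 - a) = ‖x‖ * ‖x‖ ^ (-a) := by
      rw [sub_eq_add_neg, Real.rpow_add hp, Real.rpow_one]
    calc t * av K t a x ≤ t * (L1 K * (2 ^ a * ‖x‖ ^ (-a))) := by gcongr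
      _ = 2 ^ a * L1 K * (‖x‖ ^ (1 - a) * s) := by rw [e, hts]; ring
      _ ≤ _ := by gcongr; linarith
  · have hmm : s ^ (1 - a) ≤ 2 ^ a * mm s := by
      have h2 : ∀ b, 0 ≤ b → b ≤ a → s ^ (-b) ≤ 2 ^ a := fun b hb hba => by
        refine (Real.rpow_le_rpow_of_nonpos (by norm_num) h1 (by linarith)).trans ?_
        rw [one_div, Real.inv_rpow (by norm_num), Real.rpow_neg (by norm_num), inv_inv]
        exact Real.rpow_le_rpow_of_exponent_le (by norm_num) hba
      rw [mm, mul_min_of_nonneg _ _ (by positivity)]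
      refine le_min ?_ ?_
      · rw [sub_eq_neg_add, Real.rpow_add hs0, Real.rpow_one]
        exact mul_le_mul_of_nonneg_right (h2 a (by linarith) le_rfl) hs0.le
      · rw [show 1 - a = -(a - 5 / 4) + -(1 / 4) by ring, Real.rpow_add hs0]
        exact mul_le_mul_of_nonneg_right (h2 _ (by linarith) (by linarith)) (by positivity)
    have e : t * t ^ (-a) = ‖x‖ ^ (1 - a) * s ^ (1 - a) := by
      rw [← Real.mul_rpow hp.le hs0.le, ← hts, sub_eq_add_neg, Real.rpow_add ht, Real.rpow_one]
    calc t * av K t a x ≤ t * (C * t ^ (-a)) := mul_le_mul_of_nonneg_left (h t ht x).2 ht.le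
      _ = C * (‖x‖ ^ (1 - a) * s ^ (1 - a)) := by rw [← e]; ring
      _ ≤ C * (‖x‖ ^ (1 - a) * (2 ^ a * mm s)) := by gcongr
      _ ≤ 2 ^ a * (C + L1 K) * (‖x‖ ^ (1 - a) * mm s) := by
        have : 0 ≤ mm s := le_min hs0.le (by positivity)
        have : 0 ≤ 2 ^ a * L1 K * (‖x‖ ^ (1 - a) * mm s) := by positivity
        linarith

theorem sum_av_le (hn : 0 < n) {K : E n → ℝ} (hK : Ker K) {a : ℝ} (ha : 5 / 4 ≤ a) (han : a < n) :
    ∃ C, 0 ≤ C ∧ ∀ r > 0, ∀ x ≠ 0, ∀ N : ℕ,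
      ∑ j ∈ Finset.range N, sc r j * av K (sc r j) a x ≤ C * ‖x‖ ^ (1 - a) := by
  obtain ⟨C, hC, h⟩ := mul_av_le hn hK ha han
  obtain ⟨D, hD, hD'⟩ := sum_mm
  refine ⟨C * D, by positivity, fun r hr x hx N => ?_⟩
  have hp : 0 < ‖x‖ := norm_pos_iff.2 hx
  calc _ ≤ ∑ j ∈ Finset.range N, C * (‖x‖ ^ (1 - a) * mm (r / ‖x‖ * (1 / 2) ^ j)) :=
        Finset.sum_le_sum fun j _ => (h _ (sc_pos hr j) x hx).trans_eq (by rw [sc]; ring_nf)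
    _ = C * ‖x‖ ^ (1 - a) * ∑ j ∈ Finset.range N, mm (r / ‖x‖ * (1 / 2) ^ j) := by
        rw [Finset.mul_sum]; exact Finset.sum_congr rfl fun j _ => by ring
    _ ≤ C * ‖x‖ ^ (1 - a) * D := mul_le_mul_of_nonneg_left (hD' _ (by positivity) N) (by positivity)
    _ = _ := by ring

theorem abs_cv_le_av (hn : 0 < n) {K : E n → ℝ} (hK : Ker K) {R r t a b A B : ℝ} {x : E n} {f : E n → ℝ}
    (ha : 0 ≤ a) (han : a < n) (hb : 0 ≤ b) (hbn : b < n)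
    (hx : x ∈ Metric.ball (0 : E n) (R - r)) (ht : 0 < t) (htr : t ≤ r)
    (h : ∀ y ∈ Metric.ball (0 : E n) R, |f y| ≤ A * ‖y‖ ^ (-a) + B * ‖y‖ ^ (-b)) :
    |cv K t f x| ≤ A * av K t a x + B * av K t b x := by
  obtain ⟨_, _, ha'⟩ := av_le hn hK ha han
  obtain ⟨_, _, hb'⟩ := av_le hn hK hb hbn
  have i1 := (ha' t ht x).1.const_mul A
  have i2 := (hb' t ht x).1.const_mul B
  have := norm_integral_le_of_norm_le (f := fun z => K z * f (x - t • z)) (i1.add i2)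
    (ae_of_all _ fun z => ?_)
  · rw [integral_add' i1 i2, integral_const_mul, integral_const_mul] at this
    exact this
  · rw [norm_mul, Real.norm_eq_abs, Real.norm_eq_abs]
    rcases le_or_gt ‖z‖ 1 with hz | hz
    · refine (mul_le_mul_of_nonneg_left (h _ (sub_smul_mem hx ht.le htr hz)) (abs_nonneg _)).trans_eq ?_
      simp only [Pi.add_apply]; ring
    · simp [hK.supp z hz]

end

section

variable {n : ℕ} {A : ℝ} {u : Fin n → E n → ℝ} {p : E n → ℝ}

theorem integrableOn_of_le_rpow {f : E n → ℝ} (hn : 0 < n) (hf : Measurable f) {R B a : ℝ} (ha : a < n)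
    (h : ∀ y ∈ Metric.ball (0 : E n) R, |f y| ≤ B * ‖y‖ ^ (-a)) : IntegrableOn f (Metric.ball 0 R) :=
  Integrable.mono' ((integrableOn_rpow_norm hn ha R).const_mul B) hf.aestronglyMeasurable
    ((ae_restrict_iff' measurableSet_ball).2 (ae_of_all _ h))

theorem WeakNS.abs_le {R r S : ℝ} (h : WeakNS R u) (hm : ∀ j, Measurable (u j))
    (hu : ∀ i, IntegrableOn (u i) (Metric.ball 0 R))
    (huu : ∀ i l, IntegrableOn (fun y => u i y * u l y) (Metric.ball 0 R)) {k : Fin n} {x : E n}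
    (hx : x ∈ Metric.ball (0 : E n) (R - r)) (hr : 0 < r) (hc : ContinuousAt (u k) x)
    (hS : ∀ i l, ∀ N : ℕ, ∑ j ∈ Finset.range N,
      sc r j * |cv (KK i l k) (sc r j) (fun y => u i y * u l y) x| ≤ S) :
    |∫ z : E n, phi z| * |u k x| ≤ |cv phi r (u k) x| + n * (n * S) := by
  rw [← abs_mul]
  refine le_of_tendsto (tendsto_cv ker_phi (hm k) hc hr).abs (Eventually.of_forall fun N => ?_)
  rw [h.partial_sum hu huu k hx hr N]
  refine (abs_add_le _ _).trans (add_le_add_right ?_ _)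
  simp only [Finset.mul_sum]
  rw [Finset.sum_comm]
  refine (Finset.abs_sum_le_sum_abs _ _).trans ((Finset.sum_le_card_nsmul _ _ (n * S) fun i _ => ?_).trans (by simp))
  rw [Finset.sum_comm]
  refine (Finset.abs_sum_le_sum_abs _ _).trans ((Finset.sum_le_card_nsmul _ _ S fun l _ => ?_).trans (by simp))
  refine (Finset.abs_sum_le_sum_abs _ _).trans ((Finset.sum_le_sum fun j _ => ?_).trans (hS i l N))
  rw [abs_mul, abs_of_pos (sc_pos hr j)]

theorem exists_uniform {P : Fin n → Fin n → Fin n → ℝ → Prop} (h : ∀ i l k, ∃ C, 0 ≤ C ∧ P i l k C)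
    (hP : ∀ i l k C D, C ≤ D → P i l k C → P i l k D) : ∃ C, 0 ≤ C ∧ ∀ i l k, P i l k C := by
  choose C hC h using h
  refine ⟨∑ i, ∑ l, ∑ j, C i l j, Finset.sum_nonneg fun i _ => Finset.sum_nonneg fun l _ =>
    Finset.sum_nonneg fun j _ => hC i l j, fun i l j => hP i l j _ _ ?_ (h i l j)⟩
  refine (Finset.single_le_sum (f := fun j => C i l j) (fun j _ => hC i l j) (Finset.mem_univ j)).trans ?_
  refine (Finset.single_le_sum (f := fun l => ∑ j, C i l j)
    (fun l _ => Finset.sum_nonneg fun j _ => hC i l j) (Finset.mem_univ l)).trans ?_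
  exact Finset.single_le_sum (f := fun i => ∑ l, ∑ j, C i l j) (fun i _ => Finset.sum_nonneg
    fun l _ => Finset.sum_nonneg fun j _ => hC i l j) (Finset.mem_univ i)

theorem norm_rpow_mul {x : E n} {a b : ℝ} (h : a + b ≠ 0) (ha : a ≠ 0) : ‖x‖ ^ a * ‖x‖ ^ b = ‖x‖ ^ (a + b) := by
  rcases (norm_nonneg x).eq_or_lt with h0 | h0
  · rw [← h0, Real.zero_rpow h, Real.zero_rpow ha, zero_mul]
  · rw [Real.rpow_add h0]

theorem WeakNS.improve (hn : 4 ≤ n) : ∃ ε > 0, ∀ R > 0, 2 * R ≤ 1 → ∀ u : Fin n → E n → ℝ,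
    WeakNS (2 * R) u → (∀ j, Measurable (u j)) → (∀ j, u j 0 = 0) →
    (∀ j, ∀ x ∈ Metric.ball (0 : E n) (2 * R), |u j x| ≤ ε * ‖x‖ ^ (-1 : ℝ)) →
    (∀ j, ∀ x ∈ Metric.ball (0 : E n) (2 * R), x ≠ 0 → ContinuousAt (u j) x) →
    ∃ β ≥ 0, ∀ j, ∀ x ∈ Metric.ball (0 : E n) (2 * R), |u j x| ≤ β * ‖x‖ ^ (-(1 / 4) : ℝ) := by
  have hn4 : (4 : ℝ) ≤ n := by exact_mod_cast hn
  have hn0 : 0 < n := by omega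
  have hc0 : 0 < |∫ z : E n, phi z| := abs_pos.2 (integral_phi_ne_zero hn)
  set c := |∫ z : E n, phi z| with hc
  obtain ⟨C2, hC2, h2⟩ := exists_uniform (P := fun i l k C => ∀ r > 0, ∀ x : E n, x ≠ 0 → ∀ N : ℕ,
      ∑ j ∈ Finset.range N, sc r j * av (KK i l k) (sc r j) 2 x ≤ C * ‖x‖ ^ (1 - 2 : ℝ))
    (fun i l k => sum_av_le hn0 (ker_KK i l k) (by norm_num) (by linarith))
    (fun i l k C D hCD h r hr x hx N => (h r hr x hx N).trans (by gcongr))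
  obtain ⟨C5, hC5, h5⟩ := exists_uniform (P := fun i l k C => ∀ r > 0, ∀ x : E n, x ≠ 0 → ∀ N : ℕ,
      ∑ j ∈ Finset.range N, sc r j * av (KK i l k) (sc r j) (5 / 4) x ≤ C * ‖x‖ ^ (1 - 5 / 4 : ℝ))
    (fun i l k => sum_av_le hn0 (ker_KK i l k) (by norm_num) (by linarith))
    (fun i l k C D hCD h r hr x hx N => (h r hr x hx N).trans (by gcongr))
  obtain ⟨C0, hC0, h0⟩ := av_le (a := 1) hn0 (ker_phi (n := n)) (by norm_num) (by linarith)
  set ε := c / (2 * (n * n * (C2 + C5 + 1))) with hε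
  have hε0 : 0 < ε := by positivity
  have hεC : ε * (n * n * (C2 + C5)) ≤ c / 2 := by
    have : ε * (n * n * (C2 + C5 + 1)) = c / 2 := by rw [hε]; field_simp
    rw [← this]
    exact mul_le_mul_of_nonneg_left (mul_le_mul_of_nonneg_left (by linarith) (by positivity)) hε0.le
  refine ⟨ε, hε0, fun R hR hR1 u h hm hu0 hub hcont => ?_⟩
  set D := ε * (C0 * R ^ (-1 : ℝ)) / c with hD
  have hD0 : 0 ≤ D := by positivity
  set β := 2 * D + ε * R ^ (-1 : ℝ) with hβ
  have hβ0 : 0 ≤ β := by positivity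
  refine ⟨β, hβ0, ?_⟩
  have hInt : ∀ i, IntegrableOn (u i) (Metric.ball 0 (2 * R)) := fun i =>
    integrableOn_of_le_rpow hn0 (hm i) (a := 1) (by linarith) (hub i)
  have hInt2 : ∀ i l, IntegrableOn (fun y => u i y * u l y) (Metric.ball 0 (2 * R)) := fun i l =>
    integrableOn_of_le_rpow hn0 ((hm i).mul (hm l)) (B := ε * ε) (a := 2) (by linarith) fun y hy => by
      rw [Pi.mul_apply, abs_mul]
      refine (mul_le_mul (hub i y hy) (hub l y hy) (abs_nonneg _) (by positivity)).trans_eq ?_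
      rw [mul_mul_mul_comm, norm_rpow_mul (by norm_num) (by norm_num)]; norm_num
  have hone : ∀ x : E n, x ≠ 0 → ‖x‖ ≤ 1 → 1 ≤ ‖x‖ ^ (-(1 / 4) : ℝ) := fun x hx hx1 =>
    Real.one_le_rpow_of_pos_of_le_one_of_nonpos (norm_pos_iff.2 hx) hx1 (by norm_num)
  have step : ∀ α ≥ 0, (∀ j, ∀ x ∈ Metric.ball (0 : E n) (2 * R),
        |u j x| ≤ α * ‖x‖ ^ (-1 : ℝ) + β * ‖x‖ ^ (-(1 / 4) : ℝ)) →
      ∀ j, ∀ x ∈ Metric.ball (0 : E n) (2 * R),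
        |u j x| ≤ α / 2 * ‖x‖ ^ (-1 : ℝ) + β * ‖x‖ ^ (-(1 / 4) : ℝ) := by
    intro α hα hP k x hx
    rcases eq_or_ne x 0 with rfl | hx0
    · rw [hu0]; norm_num
    have hp := norm_pos_iff.2 hx0
    have hx' : ‖x‖ < 2 * R := by simpa using hx
    have h1x := hone x hx0 (by linarith)
    rcases le_or_gt R ‖x‖ with hRx | hRx
    · refine (hub k x hx).trans ?_
      have : ‖x‖ ^ (-1 : ℝ) ≤ R ^ (-1 : ℝ) := Real.rpow_le_rpow_of_nonpos hR hRx (by norm_num)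
      calc ε * ‖x‖ ^ (-1 : ℝ) ≤ ε * R ^ (-1 : ℝ) := by gcongr
        _ ≤ β := by rw [hβ]; linarith
        _ ≤ β * ‖x‖ ^ (-(1 / 4) : ℝ) := le_mul_of_one_le_right hβ0 h1x
        _ ≤ _ := by have : 0 ≤ α / 2 * ‖x‖ ^ (-1 : ℝ) := by positivity
                    linarith
    have hxb : x ∈ Metric.ball (0 : E n) (2 * R - R) := by simp; linarith
    have huu : ∀ i l, ∀ y ∈ Metric.ball (0 : E n) (2 * R), |u i y * u l y| ≤
        ε * α * ‖y‖ ^ (-2 : ℝ) + ε * β * ‖y‖ ^ (-(5 / 4) : ℝ) := fun i l y hy => by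
      rw [abs_mul]
      refine (mul_le_mul (hub i y hy) (hP l y hy) (abs_nonneg _) (by positivity)).trans_eq ?_
      rw [show (-2 : ℝ) = -1 + -1 by norm_num, show (-(5 / 4) : ℝ) = -1 + -(1 / 4) by norm_num,
        ← norm_rpow_mul (by norm_num) (by norm_num), ← norm_rpow_mul (by norm_num) (by norm_num)]
      ring
    have hS : ∀ i l, ∀ N : ℕ, ∑ j ∈ Finset.range N,
        sc R j * |cv (KK i l k) (sc R j) (fun y => u i y * u l y) x| ≤
        ε * (C2 + C5) * (α * ‖x‖ ^ (-1 : ℝ) + β * ‖x‖ ^ (-(1 / 4) : ℝ)) := fun i l N => by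
      have e2 := h2 i l k R hR x hx0 N
      have e5 := h5 i l k R hR x hx0 N
      norm_num at e2 e5
      calc _ ≤ ∑ j ∈ Finset.range N, (ε * α * (sc R j * av (KK i l k) (sc R j) 2 x) +
            ε * β * (sc R j * av (KK i l k) (sc R j) (5 / 4) x)) :=
            Finset.sum_le_sum fun j _ => (mul_le_mul_of_nonneg_left
              (abs_cv_le_av hn0 (ker_KK i l k) (by norm_num) (by linarith) (by norm_num) (by linarith)
                hxb (sc_pos hR j) (sc_le hR j) (huu i l)) (sc_pos hR j).le).trans_eq (by ring)
        _ ≤ ε * α * (C2 * ‖x‖ ^ (-1 : ℝ)) + ε * β * (C5 * ‖x‖ ^ (-(1 / 4) : ℝ)) := by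
            rw [Finset.sum_add_distrib, ← Finset.mul_sum, ← Finset.mul_sum]
            gcongr
        _ ≤ _ := by
          have : 0 ≤ ε * C5 * (α * ‖x‖ ^ (-1 : ℝ)) := by positivity
          have : 0 ≤ ε * C2 * (β * ‖x‖ ^ (-(1 / 4) : ℝ)) := by positivity
          linarith
    have hcv : |cv phi R (u k) x| ≤ c * D := by
      have := abs_cv_le_av (A := ε) (B := 0) (a := 1) (b := 1) hn0 ker_phi (by norm_num)
        (by linarith) (by norm_num) (by linarith) hxb hR le_rfl (by simpa using hub k)
      rw [hD, mul_div_cancel₀ _ hc0.ne']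
      refine this.trans ?_
      rw [zero_mul, add_zero]
      exact mul_le_mul_of_nonneg_left (h0 R hR x).2 hε0.le
    have hfin := h.abs_le hm hInt hInt2 hxb hR (hcont k x hx hx0) hS
    rw [← hc] at hfin
    set T := α * ‖x‖ ^ (-1 : ℝ) + β * ‖x‖ ^ (-(1 / 4) : ℝ) with hT
    have hT0 : 0 ≤ T := by positivity
    have h3 : c * |u k x| ≤ c * (D + T / 2) := by
      refine hfin.trans ?_
      have := mul_le_mul_of_nonneg_right hεC hT0
      linarith
    have h4 := le_of_mul_le_mul_left h3 hc0
    have h6 : D ≤ β / 2 * ‖x‖ ^ (-(1 / 4) : ℝ) := by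
      have : D ≤ β / 2 := by
        have : 0 ≤ ε * R ^ (-1 : ℝ) := by positivity
        rw [hβ]; linarith
      exact this.trans (le_mul_of_one_le_right (by positivity) h1x)
    rw [hT] at h4
    linarith
  have iter : ∀ m : ℕ, ∀ j, ∀ x ∈ Metric.ball (0 : E n) (2 * R),
      |u j x| ≤ ε * (1 / 2) ^ m * ‖x‖ ^ (-1 : ℝ) + β * ‖x‖ ^ (-(1 / 4) : ℝ) := by
    intro m
    induction m with
    | zero =>
      intro j x hx
      have : 0 ≤ β * ‖x‖ ^ (-(1 / 4) : ℝ) := by positivity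
      have := hub j x hx
      simp only [pow_zero, mul_one]
      linarith
    | succ m ih =>
      intro j x hx
      have := step _ (by positivity) ih j x hx
      rw [pow_succ]
      convert this using 3
      ring
  intro j x hx
  refine ge_of_tendsto (f := fun m : ℕ => ε * (1 / 2) ^ m * ‖x‖ ^ (-1 : ℝ) + β * ‖x‖ ^ (-(1 / 4) : ℝ))
    (b := |u j x|) (x := atTop) ?_ (Eventually.of_forall fun m => iter m j x hx)
  have := (((tendsto_pow_atTop_nhds_zero_of_lt_one (r := (1 / 2 : ℝ)) (by norm_num)
    (by norm_num)).const_mul ε).mul_const (‖x‖ ^ (-1 : ℝ))).add_const (β * ‖x‖ ^ (-(1 / 4) : ℝ))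
  simpa using this

theorem WeakNS.bounded_of_le (hn : 4 ≤ n) {R β : ℝ} (hR : 0 < R) (h : WeakNS (2 * R) u)
    (hm : ∀ j, Measurable (u j)) (hu0 : ∀ j, u j 0 = 0) (hβ : 0 ≤ β)
    (hub : ∀ j, ∀ x ∈ Metric.ball (0 : E n) (2 * R), |u j x| ≤ β * ‖x‖ ^ (-(1 / 4) : ℝ))
    (hcont : ∀ j, ∀ x ∈ Metric.ball (0 : E n) (2 * R), x ≠ 0 → ContinuousAt (u j) x) :
    ∃ M, ∀ j, ∀ x ∈ Metric.ball (0 : E n) R, |u j x| ≤ M := by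
  have hn4 : (4 : ℝ) ≤ n := by exact_mod_cast hn
  have hn0 : 0 < n := by omega
  have hc0 : 0 < |∫ z : E n, phi z| := abs_pos.2 (integral_phi_ne_zero hn)
  set c := |∫ z : E n, phi z| with hc
  obtain ⟨C, hC, h1⟩ := exists_uniform (P := fun i l k C => ∀ t > 0, ∀ x : E n,
      av (KK i l k) t (1 / 2) x ≤ C * t ^ (-(1 / 2) : ℝ))
    (fun i l k => by
      obtain ⟨C, hC, h⟩ := av_le (a := 1 / 2) hn0 (ker_KK i l k) (by norm_num) (by linarith)
      exact ⟨C, hC, fun t ht x => (h t ht x).2⟩)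
    (fun i l k C D hCD h t ht x => (h t ht x).trans (by gcongr))
  obtain ⟨C0, hC0, h0⟩ := av_le (a := 1 / 4) hn0 (ker_phi (n := n)) (by norm_num) (by linarith)
  set S := β * β * C * ∑' j, √(sc R j) with hS
  have hS0 : 0 ≤ S := by
    have : 0 ≤ ∑' j, √(sc R j) := tsum_nonneg fun _ => Real.sqrt_nonneg _
    positivity
  have huu : ∀ i l, ∀ y ∈ Metric.ball (0 : E n) (2 * R), |u i y * u l y| ≤
      β * β * ‖y‖ ^ (-(1 / 2) : ℝ) := fun i l y hy => by
    rw [abs_mul]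
    refine (mul_le_mul (hub i y hy) (hub l y hy) (abs_nonneg _) (by positivity)).trans_eq ?_
    rw [mul_mul_mul_comm, norm_rpow_mul (by norm_num) (by norm_num)]; norm_num
  have hInt : ∀ i, IntegrableOn (u i) (Metric.ball 0 (2 * R)) := fun i =>
    integrableOn_of_le_rpow hn0 (hm i) (a := 1 / 4) (by linarith) (hub i)
  have hInt2 : ∀ i l, IntegrableOn (fun y => u i y * u l y) (Metric.ball 0 (2 * R)) := fun i l =>
    integrableOn_of_le_rpow hn0 ((hm i).mul (hm l)) (a := 1 / 2) (by linarith) (huu i l)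
  refine ⟨(β * (C0 * R ^ (-(1 / 4) : ℝ)) + n * (n * S)) / c, fun k x hx => ?_⟩
  rcases eq_or_ne x 0 with rfl | hx0
  · rw [hu0, abs_zero]; positivity
  have hxb : x ∈ Metric.ball (0 : E n) (2 * R - R) := by
    rwa [two_mul, add_sub_cancel_right]
  have hx2 : x ∈ Metric.ball (0 : E n) (2 * R) := Metric.ball_subset_ball (by linarith) hx
  have hcv : |cv phi R (u k) x| ≤ β * (C0 * R ^ (-(1 / 4) : ℝ)) := by
    have := abs_cv_le_av (A := β) (B := 0) (a := 1 / 4) (b := 1 / 4) hn0 ker_phi (by norm_num)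
      (by linarith) (by norm_num) (by linarith) hxb hR le_rfl (by simpa using hub k)
    refine this.trans ?_
    rw [zero_mul, add_zero]
    exact mul_le_mul_of_nonneg_left (h0 R hR x).2 hβ
  have hSS : ∀ i l, ∀ N : ℕ, ∑ j ∈ Finset.range N,
      sc R j * |cv (KK i l k) (sc R j) (fun y => u i y * u l y) x| ≤ S := fun i l N => by
    rw [hS, ← tsum_mul_left]
    refine le_trans (Finset.sum_le_sum fun j _ => ?_) (((summable_sqrt_sc R).mul_left _).sum_le_tsum _
      fun j _ => by positivity)
    have hs := sc_pos hR j
    have := abs_cv_le_av (A := β * β) (B := 0) (a := 1 / 2) (b := 1 / 2)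
      (f := fun y => u i y * u l y) hn0 (ker_KK i l k)
      (by norm_num) (by linarith) (by norm_num) (by linarith) hxb hs (sc_le hR j)
      fun y hy => (huu i l y hy).trans_eq (by rw [zero_mul, add_zero])
    rw [zero_mul, add_zero] at this
    have e : sc R j * (sc R j) ^ (-(1 / 2) : ℝ) = √(sc R j) := by
      nth_rw 1 [← Real.rpow_one (sc R j)]
      rw [← Real.rpow_add hs, Real.sqrt_eq_rpow]; norm_num
    calc _ ≤ sc R j * (β * β * (C * sc R j ^ (-(1 / 2) : ℝ))) :=
          mul_le_mul_of_nonneg_left (this.trans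
            (mul_le_mul_of_nonneg_left (h1 i l k _ hs x) (by positivity))) hs.le
      _ = β * β * C * √(sc R j) := by rw [← e]; ring
  have hfin := h.abs_le hm hInt hInt2 hxb hR (hcont k x hx2 hx0) hSS
  rw [le_div_iff₀ hc0, mul_comm]
  linarith

end

section

variable {n : ℕ} {A : ℝ} {u : Fin n → E n → ℝ} {p : E n → ℝ}

theorem WeakNS.mono {R R' : ℝ} (h : WeakNS R u) (hR : R' ≤ R) : WeakNS R' u := fun k Ψ h1 h2 h3 =>
  h k Ψ h1 h2 (h3.trans (Metric.ball_subset_ball hR))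

theorem WeakNS.congr_ae {R : ℝ} (h : WeakNS R u) {v : Fin n → E n → ℝ}
    (huv : ∀ j, v j =ᵐ[volume] u j) : WeakNS R v := fun k Ψ h1 h2 h3 => by
  refine (integral_congr_ae ?_).trans (h k Ψ h1 h2 h3)
  filter_upwards [eventually_countable_forall.2 huv] with x hx
  simp only [hx]

theorem Hol.continuousAt {R M α : ℝ} (hα : 0 < α) {f : E n → ℝ} (h : Hol α R M f) {x : E n}
    (hx : x ∈ Metric.ball (0 : E n) R) : ContinuousAt f x := by
  rw [ContinuousAt, tendsto_iff_norm_sub_tendsto_zero]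
  refine squeeze_zero' (Eventually.of_forall fun _ => norm_nonneg _) (g := fun y => 2 * M * ‖y - x‖ ^ α)
    (by filter_upwards [Metric.isOpen_ball.mem_nhds hx] with y hy using h.2 y hy x hx) ?_
  have : ContinuousAt (fun y : E n => 2 * M * ‖y - x‖ ^ α) x := by
    have : Continuous fun y : E n => ‖y - x‖ := by fun_prop
    exact continuousAt_const.mul (this.continuousAt.rpow_const (Or.inr hα.le))
  simpa [ContinuousAt, Real.zero_rpow hα.ne'] using this

theorem WeakNS.extend (hn : 4 ≤ n) {R M : ℝ} (hR : 0 < R) (hR1 : R ≤ 1) (h : WeakNS R u)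
    (hm : ∀ j, Measurable (u j)) (hM : ∀ j, ∀ x ∈ Metric.ball (0 : E n) R, |u j x| ≤ M)
    (hcont : ∀ j, ∀ x ∈ Metric.ball (0 : E n) R, x ≠ 0 → ContinuousAt (u j) x) :
    ∃ v : Fin n → E n → ℝ, (∀ j, ContDiffAt ℝ ∞ (v j) 0) ∧ ∀ j, ∀ x ≠ 0, v j x = u j x := by
  have hr : 0 < R / 2 := by positivity
  have e2 : R - R / 2 = R / 2 := by ring
  have hsub : Metric.ball (0 : E n) (R / 2) ⊆ Metric.ball 0 R := Metric.ball_subset_ball (by linarith)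
  set c := ∫ z : E n, phi z with hc
  have hc0 : c ≠ 0 := integral_phi_ne_zero hn
  set F : Fin n → E n → ℝ := fun k x => c⁻¹ * (cv phi (R / 2) (u k) x +
    ∑ i, ∑ l, Tp (KK i l k) (R / 2) (fun y => u i y * u l y) x) with hF
  have hFu : ∀ k, ∀ x ∈ Metric.ball (0 : E n) (R / 2), x ≠ 0 → u k x = F k x := fun k x hx hx0 => by
    rw [hF]
    simp only
    rw [← h.rep_at hm hM hr (by rwa [e2]) (hcont k x (hsub hx) hx0), inv_mul_cancel_left₀ hc0]
  have hFc : ∀ k, ∀ x ∈ Metric.ball (0 : E n) (R / 2), ContinuousAt (F k) x := fun k x hx => by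
    have hM0 : 0 ≤ M := (abs_nonneg _).trans (hM k x (hsub hx))
    refine continuousAt_const.mul (ContinuousAt.add ?_ ?_)
    · exact (cv_pd ker_phi (hm k) (R := R) (r := R / 2) (by rwa [e2]) hr le_rfl (hM k)).1.continuousAt
    · refine tendsto_finsetSum _ fun i _ => tendsto_finsetSum _ fun l _ => ?_
      refine (Tp_hol (ker_KK i l k) (R := R) hr ((hm i).mul (hm l)) (by linarith)
        (mul_nonneg hM0 hM0) fun y hy => ?_).continuousAt (by norm_num) (by rwa [e2])
      rw [Pi.mul_apply, abs_mul]
      exact mul_le_mul (hM i y hy) (hM l y hy) (abs_nonneg _) hM0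
  classical
  set v : Fin n → E n → ℝ := fun k x => if x = 0 then F k 0 else u k x with hv
  have hvF : ∀ k, ∀ x ∈ Metric.ball (0 : E n) (R / 2), v k x = F k x := fun k x hx => by
    by_cases hx0 : x = 0
    · simp [hv, hx0]
    · simp [hv, hx0, hFu k x hx hx0]
  have hvu : ∀ k, ∀ x ≠ 0, v k x = u k x := fun k x hx => by simp [hv, hx]
  have hvm : ∀ k, Measurable (v k) := fun k =>
    Measurable.ite (measurableSet_singleton 0) measurable_const (hm k)
  have hvc : ∀ k, ∀ x ∈ Metric.ball (0 : E n) (R / 2), ContinuousAt (v k) x := fun k x hx =>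
    (hFc k x hx).congr (by
      filter_upwards [Metric.isOpen_ball.mem_nhds hx] with y hy using (hvF k y hy).symm)
  have hvM : ∀ k, ∀ x ∈ Metric.ball (0 : E n) (R / 2), |v k x| ≤ M + ∑ k, |F k 0| := fun k x hx => by
    have hM0 : 0 ≤ M := (abs_nonneg _).trans (hM k x (hsub hx))
    have h1 : |F k 0| ≤ ∑ k, |F k 0| :=
      Finset.single_le_sum (f := fun k => |F k 0|) (fun _ _ => abs_nonneg _) (Finset.mem_univ k)
    by_cases hx0 : x = 0
    · rw [hx0]; simp only [hv, if_true]; linarith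
    · rw [hvu k x hx0]; linarith [hM k x (hsub hx), abs_nonneg (F k 0)]
  have hvw : WeakNS (R / 2) v := (h.mono (by linarith)).congr_ae fun j =>
    (ae_ne_zero (by omega)).mono fun x hx => hvu j x hx
  exact ⟨v, fun j => Rep.contDiffAt hn hr (by linarith) hvm (hvw.rep hvm hvM hvc) hvM j, hvu⟩

theorem Sing.extend (hn : 4 ≤ n) (h : Sing A u p) (h0 : ∀ j, u j 0 = 0) :
    ∃ v : Fin n → E n → ℝ, (∀ j, ContDiffAt ℝ ∞ (v j) 0) ∧ ∀ j, ∀ x ≠ 0, v j x = u j x := by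
  obtain ⟨ε, hε, hi⟩ := WeakNS.improve hn
  obtain ⟨ρ, hρ, hρ1, hd⟩ := h.decay hn hε
  have hR : 0 < ρ / 2 := by positivity
  have e : 2 * (ρ / 2) = ρ := by ring
  have hw : WeakNS (2 * (ρ / 2)) u :=
    (h.ns.weakNS hn (by norm_num) h.bu h.bp).mono (by linarith)
  have hcont : ∀ j, ∀ x ∈ Metric.ball (0 : E n) (2 * (ρ / 2)), x ≠ 0 → ContinuousAt (u j) x :=
    fun j x hx hx0 => (h.ns.contDiffAt_u ⟨Metric.ball_subset_ball (by linarith) hx, hx0⟩ j).continuousAt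
  have hub : ∀ j, ∀ x ∈ Metric.ball (0 : E n) (2 * (ρ / 2)), |u j x| ≤ ε * ‖x‖ ^ (-1 : ℝ) :=
    fun j x hx => by
      rcases eq_or_ne x 0 with rfl | hx0
      · rw [h0, abs_zero]; positivity
      · rw [Real.rpow_neg_one, ← div_eq_mul_inv]
        exact hd x hx0 (by rw [e] at hx; simpa using hx) j
  obtain ⟨β, hβ, hb⟩ := hi _ hR (by linarith) u hw h.ns.meas_u h0 hub hcont
  obtain ⟨M, hM⟩ := hw.bounded_of_le hn hR h.ns.meas_u h0 hβ hb hcont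
  exact (hw.mono (by linarith)).extend hn hR (by linarith) h.ns.meas_u hM
    fun j x hx => hcont j x (Metric.ball_subset_ball (by linarith) hx)

theorem measurable_indicator_of_continuousOn {f : E n → ℝ} {U : Set (E n)} (hU : IsOpen U)
    (hf : ContinuousOn f U) : Measurable (U.indicator f) := by
  classical
  rw [← piecewise_eq_indicator]
  exact hf.measurable_piecewise continuousOn_const hU.measurableSet

end

end SteadyNS

theorem removable_singularity_steady_NS {n : ℕ} (hn : 4 ≤ n)
    (u : EuclideanSpace ℝ (Fin n) → EuclideanSpace ℝ (Fin n))
    (p : EuclideanSpace ℝ (Fin n) → ℝ)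
    (hu : ContDiffOn ℝ (⊤ : ℕ∞) u (Metric.ball (0 : EuclideanSpace ℝ (Fin n)) 1 \ {0}))
    (hp : ContDiffOn ℝ (⊤ : ℕ∞) p (Metric.ball (0 : EuclideanSpace ℝ (Fin n)) 1 \ {0}))
    (hNS : ∀ x ∈ Metric.ball (0 : EuclideanSpace ℝ (Fin n)) 1 \ {0}, ∀ j : Fin n,
      -(∑ i : Fin n, fderiv ℝ (fun y => fderiv ℝ (fun z => u z j) y
            (EuclideanSpace.single i 1)) x (EuclideanSpace.single i 1)) +
        (∑ i : Fin n, u x i * fderiv ℝ (fun z => u z j) x (EuclideanSpace.single i 1)) +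
        fderiv ℝ p x (EuclideanSpace.single j 1) = 0)
    (hdiv : ∀ x ∈ Metric.ball (0 : EuclideanSpace ℝ (Fin n)) 1 \ {0},
      ∑ i : Fin n, fderiv ℝ (fun z => u z i) x (EuclideanSpace.single i 1) = 0)
    (C : ℝ) (hC : 0 < C)
    (hbound : ∀ x ∈ Metric.ball (0 : EuclideanSpace ℝ (Fin n)) 1 \ {0}, ‖u x‖ ≤ C / ‖x‖) :
    ∃ v : EuclideanSpace ℝ (Fin n) → EuclideanSpace ℝ (Fin n),
      ContDiffOn ℝ (⊤ : ℕ∞) v (Metric.ball (0 : EuclideanSpace ℝ (Fin n)) 1) ∧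
      ∀ x ∈ Metric.ball (0 : EuclideanSpace ℝ (Fin n)) 1 \ {0}, v x = u x := by
  set U := Metric.ball (0 : EuclideanSpace ℝ (Fin n)) 1 \ {0} with hU
  have hUo : IsOpen U := Metric.isOpen_ball.sdiff isClosed_singleton
  have huj : ∀ j, ContDiffOn ℝ (⊤ : ℕ∞) (fun x => u x j) U := contDiffOn_euclidean.1 hu
  set w : Fin n → EuclideanSpace ℝ (Fin n) → ℝ := fun j => U.indicator fun x => u x j with hw
  set q : EuclideanSpace ℝ (Fin n) → ℝ := U.indicator p with hq
  have hwu : ∀ j, Set.EqOn (w j) (fun x => u x j) U := fun j x hx => Set.indicator_of_mem hx _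
  have hqp : Set.EqOn q p U := fun x hx => Set.indicator_of_mem hx _
  have hns : SteadyNS.NS U w q := {
    isOpen := hUo
    smooth_u := fun j => (huj j).congr (hwu j)
    smooth_p := hp.congr hqp
    meas_u := fun j => SteadyNS.measurable_indicator_of_continuousOn hUo (huj j).continuousOn
    meas_p := SteadyNS.measurable_indicator_of_continuousOn hUo hp.continuousOn
    mom := fun x hx j => by
      rw [← hNS x hx j, SteadyNS.pd_eqOn hUo hqp hx]
      congr 2
      · congr 1
        exact Finset.sum_congr rfl fun i _ =>
          SteadyNS.pd_eqOn hUo (SteadyNS.pd_eqOn hUo (hwu j)) hx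
      · exact Finset.sum_congr rfl fun i _ => by rw [hwu i hx, SteadyNS.pd_eqOn hUo (hwu j) hx]; rfl
    div := fun x hx => by
      rw [← hdiv x hx]
      exact Finset.sum_congr rfl fun i _ => SteadyNS.pd_eqOn hUo (hwu i) hx }
  obtain ⟨K, hK⟩ := hns.sing hn hC.le fun j x hx => by
    rw [hwu j hx, ← Real.norm_eq_abs]
    exact (PiLp.norm_apply_le (u x) j).trans (hbound x hx)
  obtain ⟨v, hv, hvw⟩ := hK.extend hn fun j => Set.indicator_of_notMem (by simp [hU]) _
  have hvu : ∀ j, ∀ x ∈ U, v j x = u x j := fun j x hx => by rw [hvw j x hx.2, hwu j hx]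
  refine ⟨fun x => WithLp.toLp 2 fun j => v j x, contDiffOn_euclidean.2 fun j x hx => ?_,
    fun x hx => by ext j; exact hvu j x hx⟩
  rcases eq_or_ne x 0 with rfl | hx0
  · exact (hv j).contDiffWithinAt
  · exact ((((huj j).congr (hvu j)).contDiffAt (hUo.mem_nhds ⟨hx, hx0⟩))).contDiffWithinAt
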